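/- Let d ≥ 3 and k ≥ 0, let R = ℤ[x_1,…,x_k], G = SL_d(R), and let S = F_1 ∪ F_2 be the generating set described in the context. Set ε = 1/((2d² + 18k + 30)·2^(2k+1)). Then for every unitary representation ρ of G on a complex Hilbert space H whose kernel is a finite-index subgroup of G, if there exists a nonzero vector v ∈ H with ‖ρ(s)v − v‖ < ε·‖v‖ for all s ∈ S, then H contains a nonzero vector fixed by ρ(g) for every g ∈ G. (In particular the universal lattice SL_d(ℤ[x_1,…,x_k]) has property τ, with τ-constant at least ε with respect to S.) -/

import Mathlib

/-- The elementary matrix `E_{ij}(r)`: the identity matrix with the entry `r`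
added in position `(i,j)`, as an element of `SL_d(A)`. -/
def elem {A : Type*} [CommRing A] {d : ℕ} (i j : Fin d) (h : i ≠ j) (r : A) :
    Matrix.SpecialLinearGroup (Fin d) A :=
  ⟨Matrix.transvection i j r, Matrix.det_transvection_of_ne i j h r⟩

/-- The generating set `S = F₁ ∪ F₂` of `SL_d(ℤ[x₁,…,x_k])`:
`F₁ = {E_{ij}(±1) : i ≠ j}` and `F₂ = {E_{ij}(±x_n) : |i−j| = 1, 1 ≤ n ≤ k}`. -/
def genSet (d k : ℕ) :
    Set (Matrix.SpecialLinearGroup (Fin d) (MvPolynomial (Fin k) ℤ)) :=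
  {g | ∃ (i j : Fin d) (h : i ≠ j),
      g = elem i j h 1 ∨ g = elem i j h (-1)} ∪
  {g | ∃ (i j : Fin d) (h : i ≠ j) (n : Fin k),
      ((i : ℕ) + 1 = (j : ℕ) ∨ (j : ℕ) + 1 = (i : ℕ)) ∧
      (g = elem i j h (MvPolynomial.X n) ∨ g = elem i j h (-MvPolynomial.X n))}

open Matrix

abbrev SLd (d : ℕ) (A : Type*) [CommRing A] := Matrix.SpecialLinearGroup (Fin d) A

/-- The elementary subgroup. -/
def EE (d : ℕ) (A : Type*) [CommRing A] : Subgroup (SLd d A) :=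
  Subgroup.closure {g | ∃ (i j : Fin d) (h : i ≠ j) (r : A), g = elem i j h r}

section P1
variable {d : ℕ} {A : Type*} [CommRing A]

/-- The underlying matrix. -/
def mx (g : SLd d A) : Matrix (Fin d) (Fin d) A := g.1

lemma mx_mul (g h : SLd d A) : mx (g * h) = mx g * mx h := rfl
lemma mx_one : mx (1 : SLd d A) = 1 := rfl
lemma mx_det (g : SLd d A) : (mx g).det = 1 := g.2
lemma mx_inj {g h : SLd d A} (e : mx g = mx h) : g = h := Subtype.ext e
lemma mx_mul_inv (g : SLd d A) : mx g * mx g⁻¹ = 1 := by rw [← mx_mul, mul_inv_cancel, mx_one]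
lemma mx_inv_mul (g : SLd d A) : mx g⁻¹ * mx g = 1 := by rw [← mx_mul, inv_mul_cancel, mx_one]
lemma mx_mk (M : Matrix (Fin d) (Fin d) A) (h : M.det = 1) : mx (⟨M, h⟩ : SLd d A) = M := rfl

lemma elem_mem_EE (i j : Fin d) (h : i ≠ j) (r : A) : elem i j h r ∈ EE d A :=
  Subgroup.subset_closure ⟨i, j, h, r, rfl⟩

lemma vecMulVec_single_single (i j : Fin d) (r : A) :
    vecMulVec (Pi.single i (1 : A)) (Pi.single j r) = Matrix.single i j r := by
  ext a b
  by_cases ha : i = a <;> by_cases hb : j = b <;>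
    simp [vecMulVec_apply, Matrix.single, Pi.single_apply, ha, hb, eq_comm]

lemma elem_coe (i j : Fin d) (h : i ≠ j) (r : A) :
    mx (elem i j h r) = 1 + vecMulVec (Pi.single i (1 : A)) (Pi.single j r) := by
  rw [vecMulVec_single_single]; rfl

lemma elem_add (i j : Fin d) (h : i ≠ j) (r s : A) :
    elem i j h (r + s) = elem i j h r * elem i j h s := by
  apply Subtype.ext
  exact (Matrix.transvection_mul_transvection_same _ _ h r s).symm

lemma elem_zero (i j : Fin d) (h : i ≠ j) : elem i j h (0 : A) = 1 := by
  apply Subtype.ext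
  exact Matrix.transvection_zero i j

lemma elem_neg (i j : Fin d) (h : i ≠ j) (r : A) :
    elem i j h (-r) = (elem i j h r)⁻¹ := by
  rw [eq_inv_iff_mul_eq_one, ← elem_add, neg_add_cancel, elem_zero]

/-- `TV N u y`: the matrix `1 + u yᵀ` is (the matrix of) an element of `N`. -/
def TV (N : Subgroup (SLd d A)) (u y : Fin d → A) : Prop :=
  ∃ g ∈ N, mx g = 1 + vecMulVec u y

lemma TV.add_right {N : Subgroup (SLd d A)} {u y y' : Fin d → A} (h : TV N u y) (h' : TV N u y')
    (hy : y ⬝ᵥ u = 0) : TV N u (y + y') := by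
  obtain ⟨g, hg, eg⟩ := h
  obtain ⟨g', hg', eg'⟩ := h'
  refine ⟨g * g', N.mul_mem hg hg', ?_⟩
  rw [mx_mul, eg, eg', add_mul, mul_add, mul_add, vecMulVec_mul_vecMulVec, hy,
    vecMulVec_add]
  simp; abel

lemma TV.add_left {N : Subgroup (SLd d A)} {u u' y : Fin d → A} (h : TV N u y) (h' : TV N u' y)
    (hy : y ⬝ᵥ u' = 0) : TV N (u + u') y := by
  obtain ⟨g, hg, eg⟩ := h
  obtain ⟨g', hg', eg'⟩ := h'
  refine ⟨g * g', N.mul_mem hg hg', ?_⟩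
  rw [mx_mul, eg, eg', add_mul, mul_add, mul_add, vecMulVec_mul_vecMulVec, hy,
    add_vecMulVec]
  simp; abel

lemma TV.zero_right {N : Subgroup (SLd d A)} {u : Fin d → A} : TV N u 0 :=
  ⟨1, N.one_mem, by simp [mx_one]⟩

lemma TV.zero_left {N : Subgroup (SLd d A)} {u : Fin d → A} : TV N 0 u :=
  ⟨1, N.one_mem, by simp [mx_one]⟩

lemma TV.sum_right {N : Subgroup (SLd d A)} {u : Fin d → A} {ι : Type*} (s : Finset ι)
    (y : ι → Fin d → A) (h : ∀ i ∈ s, TV N u (y i)) (hy : ∀ i ∈ s, y i ⬝ᵥ u = 0) :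
    TV N u (∑ i ∈ s, y i) := by
  classical
  induction s using Finset.induction_on with
  | empty => simpa using TV.zero_right
  | insert a s ha ih =>
    rw [Finset.sum_insert ha]
    exact (h a (by simp)).add_right (ih (fun i hi => h i (by simp [hi]))
      (fun i hi => hy i (by simp [hi]))) (hy a (by simp))

lemma TV.sum_left {N : Subgroup (SLd d A)} {y : Fin d → A} {ι : Type*} (s : Finset ι)
    (u : ι → Fin d → A) (h : ∀ i ∈ s, TV N (u i) y) (hy : ∀ i ∈ s, y ⬝ᵥ u i = 0) :
    TV N (∑ i ∈ s, u i) y := by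
  classical
  induction s using Finset.induction_on with
  | empty => simpa using TV.zero_left
  | insert a s ha ih =>
    rw [Finset.sum_insert ha, add_comm]
    exact (ih (fun i hi => h i (by simp [hi]))
      (fun i hi => hy i (by simp [hi]))).add_left (h a (by simp)) (hy a (by simp))

lemma conj_coe (g : SLd d A) (x : SLd d A) (u y : Fin d → A) (hx : mx x = 1 + vecMulVec u y) :
    mx (g * x * g⁻¹) = 1 + vecMulVec (mx g *ᵥ u) (y ᵥ* mx g⁻¹) := by
  rw [mx_mul, mx_mul, hx, mul_add, add_mul, mul_one,
    ← mx_mul, mul_inv_cancel, mx_one, mul_vecMulVec,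
    vecMulVec_mul]

lemma TV.smul_swap {N : Subgroup (SLd d A)} {u y : Fin d → A} {c : A} :
    TV N (c • u) y ↔ TV N u (c • y) := by
  unfold TV; rw [smul_vecMulVec, vecMulVec_smul]

lemma TV.elem {N : Subgroup (SLd d A)} {i j : Fin d} (h : i ≠ j) {r : A}
    (hN : elem i j h r ∈ N) : TV N (Pi.single i 1) (Pi.single j r) := ⟨_, hN, elem_coe i j h r⟩

lemma TV.elem_col {N : Subgroup (SLd d A)} {i j : Fin d} (h : i ≠ j) {r : A}
    (hN : _root_.elem i j h r ∈ N) : TV N (Pi.single i r) (Pi.single j 1) := by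
  have := TV.elem h hN
  have e1 : (Pi.single i r : Fin d → A) = r • Pi.single i 1 := by simp [← Pi.single_smul]
  have e2 : (Pi.single j r : Fin d → A) = r • Pi.single j 1 := by simp [← Pi.single_smul]
  rw [e1, TV.smul_swap, ← e2]; exact this

/-- hypothesis: `N` contains `e_ij(I)` and is normalized by the elementary group -/
structure RelN (N : Subgroup (SLd d A)) (I : Ideal A) : Prop where
  mem : ∀ i j h, ∀ r ∈ I, elem i j h r ∈ N
  conj : ∀ g ∈ EE d A, ∀ x ∈ N, g * x * g⁻¹ ∈ N

lemma RelN_top : RelN (EE d A) (⊤ : Ideal A) :=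
  ⟨fun i j h r _ => elem_mem_EE i j h r, fun _ hg _ hx => mul_mem (mul_mem hg hx) (inv_mem hg)⟩

lemma sum_single (y : Fin d → A) : ∑ j, Pi.single j (y j) = y := by
  ext k; simp [Finset.sum_apply, Pi.single_apply]

lemma TV.row {N : Subgroup (SLd d A)} {I : Ideal A} (hN : RelN N I) {t : Fin d} {y : Fin d → A}
    (hy : ∀ j, y j ∈ I) (ht : y t = 0) : TV N (Pi.single t 1) y := by
  rw [← sum_single y]
  apply TV.sum_right
  · intro j _
    by_cases hj : t = j
    · subst hj; rw [ht]; simpa using TV.zero_right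
    · exact TV.elem hj (hN.mem _ _ _ _ (hy j))
  · intro j _
    by_cases hj : t = j
    · subst hj; simp [ht]
    · simp [Ne.symm hj]

lemma TV.col {N : Subgroup (SLd d A)} {I : Ideal A} (hN : RelN N I) {t : Fin d} {y : Fin d → A}
    (hy : ∀ j, y j ∈ I) (ht : y t = 0) : TV N y (Pi.single t 1) := by
  rw [← sum_single y]
  apply TV.sum_left
  · intro j _
    by_cases hj : t = j
    · subst hj; rw [ht]; simpa using TV.zero_left
    · exact TV.elem_col (Ne.symm hj) (hN.mem _ _ _ _ (hy j))
  · intro j _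
    by_cases hj : t = j
    · subst hj; simp [ht]
    · simp [Ne.symm hj, hj]

/-- Lemma Z. -/
lemma TV.of_zero {N : Subgroup (SLd d A)} {I : Ideal A} (hN : RelN N I) {t : Fin d}
    {u y : Fin d → A} (hy : ∀ j, y j ∈ I) (ht : y t = 0) (hu : y ⬝ᵥ u = 0) : TV N u y := by
  -- u' is u with the t-entry removed
  set u' : Fin d → A := Function.update u t 0 with hu'
  have hsplit : u = u' + u t • Pi.single t 1 := by
    ext k; by_cases hk : k = t
    · subst hk; simp [hu']
    · simp [hu', hk]
  have hyt : y ⬝ᵥ (Pi.single t 1 : Fin d → A) = 0 := by simp [ht]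
  have hyu' : y ⬝ᵥ u' = 0 := by
    rw [hsplit, dotProduct_add, dotProduct_smul, hyt] at hu; simpa using hu
  have h1 : TV N (u t • Pi.single t 1) y := by
    rw [TV.smul_swap]
    exact TV.row hN (fun j => I.mul_mem_left _ (hy j)) (by simp [ht])
  have h2 : TV N (Pi.single t 1) y := TV.row hN hy ht
  have h2' : TV N (Pi.single t 1) (-y) := TV.row hN (fun j => I.neg_mem (hy j)) (by simp [ht])
  have h3 : TV N (Pi.single t 1 + u') y := by
    obtain ⟨g, hg, eg⟩ := TV.col (RelN_top (d := d) (A := A)) (t := t) (y := u')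
      (fun _ => trivial) (by simp [hu'])
    obtain ⟨x, hx, ex⟩ := h2
    refine ⟨g * x * g⁻¹, hN.conj g hg x hx, ?_⟩
    rw [conj_coe g x _ _ ex]
    congr 2
    · rw [eg, add_mulVec, one_mulVec, vecMulVec_mulVec]; simp
    · have : y ᵥ* mx g = y := by
        rw [eg, vecMul_add, vecMul_one, vecMul_vecMulVec, hyu']; simp
      conv_lhs => rw [← this]
      rw [vecMul_vecMul, ← mx_mul, mul_inv_cancel]; simp [mx_one]
  have h4 : TV N (-Pi.single t 1) y := by
    have := h2'
    rw [show -y = (-1 : A) • y by simp, ← TV.smul_swap] at this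
    simpa using this
  have h5 : TV N u' y := by
    have := h3.add_left h4 (by simp [ht])
    simpa [add_comm, add_assoc] using this
  rw [hsplit]
  exact h5.add_left h1 (by rw [dotProduct_smul, hyt]; simp)

/-- the basic vector orthogonal to `u` supported at `{k,l}`. -/
def pairVec (u : Fin d → A) (k l : Fin d) : Fin d → A := Pi.single k (u l) - Pi.single l (u k)

lemma pairVec_dot (u : Fin d → A) (k l : Fin d) : pairVec u k l ⬝ᵥ u = 0 := by
  simp [pairVec, sub_dotProduct, mul_comm]

lemma pairVec_self (u : Fin d → A) (k : Fin d) : pairVec u k k = 0 := by simp [pairVec]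

lemma exists_third (hd : 3 ≤ d) (k l : Fin d) : ∃ t : Fin d, t ≠ k ∧ t ≠ l := by
  have : ∃ t ∈ (Finset.univ : Finset (Fin d)), t ∉ ({k, l} : Finset (Fin d)) := by
    apply Finset.exists_mem_notMem_of_card_lt_card
    have := Finset.card_le_two (a := k) (b := l)
    simp; omega
  obtain ⟨t, _, ht⟩ := this
  simp at ht; exact ⟨t, ht.1, ht.2⟩

lemma TV.pair (hd : 3 ≤ d) {N : Subgroup (SLd d A)} {I : Ideal A} (hN : RelN N I)
    (u : Fin d → A) (k l : Fin d) {c : A} (h1 : c * u l ∈ I) (h2 : c * u k ∈ I) :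
    TV N u (c • pairVec u k l) := by
  obtain ⟨t, htk, htl⟩ := exists_third hd k l
  refine TV.of_zero hN (t := t) ?_ ?_ ?_
  · intro j
    simp only [pairVec, Pi.smul_apply, Pi.sub_apply, smul_eq_mul, mul_sub]
    apply I.sub_mem <;> rw [Pi.single_apply] <;> split_ifs <;> simp [h1, h2]
  · simp [pairVec, htk, htl]
  · rw [smul_dotProduct, pairVec_dot]; simp

lemma suslin_formula {u w g : Fin d → A} (hw : w ⬝ᵥ u = 0) (hg : g ⬝ᵥ u = 1) :
    w = ∑ k, ∑ l, (w k * g l) • pairVec u k l := by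
  have h1 : ∀ k l, (w k * g l) • pairVec u k l =
      Pi.single k (w k) * (fun _ => g l * u l) - Pi.single l (g l) * (fun _ => w k * u k) := by
    intro k l; ext x
    simp only [pairVec, Pi.smul_apply, Pi.sub_apply, smul_eq_mul, Pi.mul_apply, Pi.single_apply]
    split_ifs <;> ring
  simp only [h1, Finset.sum_sub_distrib]
  ext x
  simp only [Finset.sum_apply, Pi.sub_apply, Pi.mul_apply, Pi.single_apply, ite_mul, zero_mul]
  have e1 : ∑ l, g l * u l = 1 := hg
  have e2 : ∑ l, w l * u l = 0 := hw
  rw [Finset.sum_comm]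
  simp only [Finset.sum_ite_eq, Finset.mem_univ, if_true, ← Finset.mul_sum, e1, e2]
  simp [e2, ← Finset.mul_sum]

lemma TV.suslin (hd : 3 ≤ d) {N : Subgroup (SLd d A)} {I : Ideal A} (hN : RelN N I)
    {u w g : Fin d → A} (hw : w ⬝ᵥ u = 0) (hg : g ⬝ᵥ u = 1) (hI : ∀ j, w j ∈ I) : TV N u w := by
  rw [suslin_formula hw hg]
  have hdot : ∀ k l, ((w k * g l) • pairVec u k l) ⬝ᵥ u = 0 := by
    intro k l; rw [smul_dotProduct, pairVec_dot]; simp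
  apply TV.sum_right
  · intro k _
    apply TV.sum_right
    · intro l _
      apply TV.pair hd hN <;> exact I.mul_mem_right _ (I.mul_mem_right _ (hI k))
    · intro l _; exact hdot k l
  · intro k _
    rw [sum_dotProduct]; simp [hdot]

end P1

open Matrix

section P1b
variable {d : ℕ} {A B : Type*} [CommRing A] [CommRing B]

/-- functoriality -/
def mapSL (f : A →+* B) : SLd d A →* SLd d B := Matrix.SpecialLinearGroup.map f

lemma mx_map (f : A →+* B) (g : SLd d A) : mx (mapSL f g) = (mx g).map f := rfl

lemma mapSL_comp {C : Type*} [CommRing C] (f : A →+* B) (f' : B →+* C) (g : SLd d A) :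
    mapSL f' (mapSL f g) = mapSL (f'.comp f) g := rfl

lemma mapSL_id (g : SLd d A) : mapSL (RingHom.id A) g = g := rfl

lemma mapSL_inj {f : A →+* B} (hf : Function.Injective f) {g h : SLd d A}
    (e : mapSL f g = mapSL f h) : g = h := by
  apply mx_inj
  ext i j
  have := congrArg (fun x => mx x i j) e
  exact hf this

lemma map_elem (f : A →+* B) (i j : Fin d) (h : i ≠ j) (r : A) :
    mapSL f (elem i j h r) = elem i j h (f r) := by
  apply mx_inj
  rw [mx_map, elem_coe, elem_coe, vecMulVec_single_single, vecMulVec_single_single]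
  ext a b
  simp only [map_apply, Matrix.add_apply, Matrix.one_apply, Matrix.single_apply, map_add]
  split_ifs <;> simp

lemma EE_map (f : A →+* B) {g : SLd d A} (hg : g ∈ EE d A) : mapSL f g ∈ EE d B := by
  have : EE d A ≤ (EE d B).comap (mapSL f) := by
    refine (Subgroup.closure_le _).2 ?_
    rintro _ ⟨i, j, h, r, rfl⟩
    simp only [Subgroup.coe_comap, Set.mem_preimage, map_elem]
    exact elem_mem_EE _ _ _ _
  exact this hg

lemma EE_lift (f : A →+* B) (hf : Function.Surjective f) {g : SLd d B} (hg : g ∈ EE d B) :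
    ∃ g' ∈ EE d A, mapSL f g' = g := by
  have : EE d B ≤ (EE d A).map (mapSL f) := by
    refine (Subgroup.closure_le _).2 ?_
    rintro _ ⟨i, j, h, r, rfl⟩
    obtain ⟨r', rfl⟩ := hf r
    exact ⟨elem i j h r', elem_mem_EE _ _ _ _, map_elem _ _ _ _ _⟩
  exact this hg

lemma mx_conj_elem (g : SLd d A) (i j : Fin d) (h : i ≠ j) (r : A) :
    mx (g * elem i j h r * g⁻¹) =
      1 + vecMulVec (fun k => mx g k i) (r • fun k => mx g⁻¹ j k) := by
  rw [conj_coe g _ _ _ (elem_coe i j h r)]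
  congr 2
  · ext k; simp
  · ext k; simp [Matrix.vecMul, mul_comm]

lemma inv_row_dot_col (g : SLd d A) (i j : Fin d) :
    (fun k => mx g⁻¹ j k) ⬝ᵥ (fun k => mx g k i) = if j = i then 1 else 0 := by
  have := congrFun (congrFun (mx_inv_mul g) j) i
  rw [Matrix.one_apply] at this
  exact this

/-- Suslin: the elementary group is normal. -/
lemma EE_normal (hd : 3 ≤ d) {g x : SLd d A} (hx : x ∈ EE d A) : g * x * g⁻¹ ∈ EE d A := by
  have : EE d A ≤ (EE d A).comap (MulAut.conj g).toMonoidHom := by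
    refine (Subgroup.closure_le _).2 ?_
    rintro _ ⟨i, j, h, r, rfl⟩
    change g * elem i j h r * g⁻¹ ∈ EE d A
    obtain ⟨y, hy, ey⟩ := TV.suslin hd (RelN_top (d := d) (A := A))
      (u := fun k => mx g k i) (w := r • fun k => mx g⁻¹ j k) (g := fun k => mx g⁻¹ i k)
      (by rw [smul_dotProduct, inv_row_dot_col, if_neg h.symm, smul_zero])
      (by rw [inv_row_dot_col, if_pos rfl]) (fun _ => trivial)
    rw [← mx_conj_elem g i j h r] at ey
    rwa [← mx_inj ey]
  exact this hx

/-- Relative commutator lemma. -/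
lemma rel_commutator (hd : 3 ≤ d) (N : Subgroup (SLd d A)) [hN : N.Normal] (I : Ideal A)
    (hI : ∀ i j h, ∀ r ∈ I, elem i j h r ∈ N) (κ : SLd d A)
    (hκ : mapSL (Ideal.Quotient.mk I) κ = 1) {x : SLd d A} (hx : x ∈ EE d A) :
    κ * x * κ⁻¹ * x⁻¹ ∈ N := by
  let q := Ideal.Quotient.mk I
  let D : Subring (A × A) :=
    RingHom.eqLocus (q.comp (RingHom.fst A A)) (q.comp (RingHom.snd A A))
  let p1 : D →+* A := (RingHom.fst A A).comp D.subtype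
  let p2 : D →+* A := (RingHom.snd A A).comp D.subtype
  let Δ : A →+* D := ((RingHom.id A).prod (RingHom.id A)).codRestrict D (fun a => rfl)
  have key : ∀ y ∈ EE d D, mapSL p1 y * (mapSL p2 y)⁻¹ ∈ N := by
    intro y hy
    induction hy using Subgroup.closure_induction with
    | mem y hy =>
      obtain ⟨i, j, h, r, rfl⟩ := hy
      rw [map_elem, map_elem, ← elem_neg, ← elem_add]
      apply hI
      rw [← Ideal.Quotient.eq_zero_iff_mem, map_add, map_neg, ← sub_eq_add_neg, sub_eq_zero]
      exact r.2
    | one => simp [N.one_mem]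
    | mul y z _ _ hy hz =>
      rw [map_mul, map_mul]
      have : mapSL p1 y * mapSL p1 z * (mapSL p2 y * mapSL p2 z)⁻¹ =
        (mapSL p1 y * (mapSL p1 z * (mapSL p2 z)⁻¹) * (mapSL p1 y)⁻¹) *
          (mapSL p1 y * (mapSL p2 y)⁻¹) := by group
      rw [this]
      exact N.mul_mem (hN.conj_mem _ hz _) hy
    | inv y _ hy =>
      rw [map_inv, map_inv]
      have : (mapSL p1 y)⁻¹ * (mapSL p2 y)⁻¹⁻¹ =
        (mapSL p1 y)⁻¹ * (mapSL p1 y * (mapSL p2 y)⁻¹)⁻¹ * (mapSL p1 y)⁻¹⁻¹ := by group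
      rw [this]
      exact hN.conj_mem _ (N.inv_mem hy) _
  -- the element (κ, 1)
  have hmem : ∀ i j, (mx κ i j, (1 : Matrix (Fin d) (Fin d) A) i j) ∈ D := by
    intro i j
    have := congrFun (congrFun (congrArg mx hκ) i) j
    rw [mx_map, mx_one] at this
    change q (mx κ i j) = q ((1 : Matrix (Fin d) (Fin d) A) i j)
    rw [map_apply] at this
    rw [this, Matrix.one_apply, Matrix.one_apply]; split_ifs <;> simp
  let K : Matrix (Fin d) (Fin d) D := fun i j => ⟨_, hmem i j⟩
  have hK1 : K.map p1 = mx κ := rfl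
  have hK2 : K.map p2 = 1 := rfl
  have hdet : K.det = 1 := by
    have e1 : p1 K.det = 1 := by rw [RingHom.map_det]; exact mx_det κ
    have e2 : p2 K.det = 1 := by
      rw [RingHom.map_det, RingHom.mapMatrix_apply, hK2, det_one]
    apply Subtype.ext
    exact Prod.ext e1 e2
  let k : SLd d D := ⟨K, hdet⟩
  have hk1 : mapSL p1 k = κ := mx_inj hK1
  have hk2 : mapSL p2 k = 1 := mx_inj hK2
  have := key _ (EE_normal hd (g := k) (EE_map Δ hx))
  simp only [map_mul, map_inv, hk1, hk2, mapSL_comp] at this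
  have i1 : p1.comp Δ = RingHom.id A := rfl
  have i2 : p2.comp Δ = RingHom.id A := rfl
  rw [i1, i2, mapSL_id] at this
  simpa using this

/-- commutator relation -/
lemma elem_comm (i j k : Fin d) (hij : i ≠ j) (hjk : j ≠ k) (hik : i ≠ k) (r s : A) :
    elem i j hij r * elem j k hjk s = elem i k hik (r * s) * elem j k hjk s * elem i j hij r := by
  apply mx_inj
  simp only [mx_mul, elem_coe, vecMulVec_single_single, add_mul, mul_add, one_mul, mul_one]
  have h1 := Matrix.single_mul_single_same (c := r) i j k s
  have h2 : Matrix.single i k (r * s) * Matrix.single j k s = 0 :=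
    Matrix.single_mul_single_of_ne _ _ _ _ hjk.symm _
  have h3 : Matrix.single j k s * Matrix.single i j r = 0 :=
    Matrix.single_mul_single_of_ne _ _ _ _ hik.symm _
  have h4 : Matrix.single i k (r * s) * Matrix.single i j r = 0 :=
    Matrix.single_mul_single_of_ne _ _ _ _ hik.symm _
  rw [h1, h2, h3, h4]; simp; abel

lemma elem_commute (i j k l : Fin d) (hij : i ≠ j) (hkl : k ≠ l) (hjk : j ≠ k) (hil : i ≠ l)
    (r s : A) : elem i j hij r * elem k l hkl s = elem k l hkl s * elem i j hij r := by
  apply mx_inj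
  simp only [mx_mul, elem_coe, vecMulVec_single_single, add_mul, mul_add, one_mul, mul_one]
  have h1 : Matrix.single i j r * Matrix.single k l s = 0 :=
    Matrix.single_mul_single_of_ne _ _ _ _ hjk _
  have h2 : Matrix.single k l s * Matrix.single i j r = 0 :=
    Matrix.single_mul_single_of_ne _ _ _ _ hil.symm _
  rw [h1, h2]; simp; abel

/-- matrices fixing the basis vectors outside `s` (rows and columns) -/
def SS (s : Finset (Fin d)) : Subgroup (SLd d A) where
  carrier := {g | ∀ b ∉ s, mx g *ᵥ Pi.single b 1 = Pi.single b 1 ∧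
    Pi.single b 1 ᵥ* mx g = Pi.single b 1}
  one_mem' := fun b _ => by rw [mx_one, one_mulVec, vecMul_one]; exact ⟨rfl, rfl⟩
  mul_mem' := fun {x y} hx hy b hb => by
    rw [mx_mul, ← mulVec_mulVec, ← vecMul_vecMul, (hy b hb).1, (hx b hb).1, (hx b hb).2,
      (hy b hb).2]
    exact ⟨rfl, rfl⟩
  inv_mem' := fun {x} hx b hb => by
    constructor
    · conv_lhs => rw [← (hx b hb).1]
      rw [mulVec_mulVec, mx_inv_mul, one_mulVec]
    · conv_lhs => rw [← (hx b hb).2]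
      rw [vecMul_vecMul, mx_mul_inv, vecMul_one]

lemma SS_apply_right {s : Finset (Fin d)} {g : SLd d A} (hg : g ∈ SS s) {b : Fin d} (hb : b ∉ s)
    (a : Fin d) : mx g a b = if a = b then 1 else 0 := by
  have := congrFun (hg b hb).1 a
  simpa [Pi.single_apply] using this

lemma SS_apply_left {s : Finset (Fin d)} {g : SLd d A} (hg : g ∈ SS s) {b : Fin d} (hb : b ∉ s)
    (a : Fin d) : mx g b a = if a = b then 1 else 0 := by
  have := congrFun (hg b hb).2 a
  simpa [Pi.single_apply] using this

lemma SS_of_apply {s : Finset (Fin d)} {g : SLd d A}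
    (h : ∀ a, ∀ b ∉ s, mx g a b = (if a = b then 1 else 0) ∧ mx g b a = if a = b then 1 else 0) :
    g ∈ SS s := by
  intro b hb
  constructor <;> ext a
  · simpa [Pi.single_apply] using (h a b hb).1
  · simpa [Pi.single_apply] using (h a b hb).2

lemma elem_apply (i j : Fin d) (h : i ≠ j) (r : A) (a b : Fin d) :
    mx (elem i j h r) a b = (if a = b then 1 else 0) + if i = a ∧ j = b then r else 0 := by
  rw [elem_coe, vecMulVec_single_single, Matrix.add_apply, Matrix.one_apply, Matrix.single_apply]

lemma elem_mulVec (i j : Fin d) (h : i ≠ j) (r : A) (v : Fin d → A) (a : Fin d) :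
    (mx (elem i j h r) *ᵥ v) a = v a + if a = i then r * v j else 0 := by
  rw [elem_coe, add_mulVec, one_mulVec, vecMulVec_mulVec]
  by_cases ha : a = i
  · subst ha; simp
  · simp [ha]

lemma elem_mem_SS {s : Finset (Fin d)} {i j : Fin d} (h : i ≠ j) (r : A) (hi : i ∈ s)
    (hj : j ∈ s) : elem i j h r ∈ SS s := by
  apply SS_of_apply
  intro a b hb
  have h1 : i ≠ b := fun e => hb (e ▸ hi)
  have h2 : j ≠ b := fun e => hb (e ▸ hj)
  simp [elem_apply, h1, h2, eq_comm]

/-- the abstract reduction property -/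
def RedProp (d : ℕ) (A : Type*) [CommRing A] : Prop :=
  ∀ (s : Finset (Fin d)) (v : Fin d → A), (∃ w : Fin d → A, ∑ i ∈ s, w i * v i = 1) →
    ∃ g ∈ EE d A ⊓ SS s, ∃ i ∈ s, IsUnit ((mx g *ᵥ v) i)

lemma EE_eq_top_of_red_aux (hred : RedProp d A) (s : Finset (Fin d)) :
    ∀ g : SLd d A, g ∈ SS s → g ∈ EE d A := by
  induction s using Finset.strongInduction with
  | H s ih =>
  intro g hg
  rcases s.eq_empty_or_nonempty with rfl | ⟨a, ha⟩
  · have : g = 1 := by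
      apply mx_inj; ext i j
      rw [SS_apply_right hg (by simp), mx_one, Matrix.one_apply]
    rw [this]; exact one_mem _
  by_cases hs : ∃ b ∈ s, b ≠ a
  swap
  · push Not at hs
    have hdiag : mx g = diagonal (fun i => if i = a then mx g a a else 1) := by
      ext i j
      by_cases hj : j = a
      · by_cases hi : i = a
        · subst hi; subst hj; simp
        · have := SS_apply_left hg (b := i) (fun h => hi (hs i h)) j
          rw [this, diagonal_apply]
          by_cases hij : i = j
          · simp [hij, hj]; exact absurd (hij.trans hj) hi
          · simp [hij, Ne.symm hij]
      · have := SS_apply_right hg (b := j) (fun h => hj (hs j h)) i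
        rw [this, diagonal_apply]
        by_cases hij : i = j
        · simp [hij, hj]
        · simp [hij]
    have hdet := mx_det g
    rw [hdiag, det_diagonal, Finset.prod_ite_eq' ] at hdet
    simp at hdet
    have : g = 1 := by
      apply mx_inj; rw [hdiag, hdet, mx_one]; ext i j; simp [diagonal_apply, Matrix.one_apply]
    rw [this]; exact one_mem _
  obtain ⟨b, hb, hba⟩ := hs
  -- a unit somewhere in column a
  obtain ⟨e, ⟨heE, heS⟩, i, hi, hu⟩ := hred s (fun k => mx g k a) ⟨fun k => mx g⁻¹ a k, by
    have := inv_row_dot_col g a a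
    rw [if_pos rfl] at this
    rw [← this]
    apply Finset.sum_subset (Finset.subset_univ _)
    intro x _ hx
    have : a ≠ x := fun h => hx (h ▸ ha)
    rw [SS_apply_left hg hx, if_neg this, mul_zero]⟩
  have claim1 : ∃ e ∈ EE d A ⊓ SS s, ∃ i ∈ s, i ≠ a ∧ IsUnit ((mx e *ᵥ (fun k => mx g k a)) i) := by
    by_cases hia : i = a
    · subst hia
      obtain ⟨u, hu⟩ := hu
      refine ⟨elem b i hba ((1 - (mx e *ᵥ (fun k => mx g k i)) b) * ↑u⁻¹) * e,
        ⟨mul_mem (elem_mem_EE _ _ _ _) heE, mul_mem (elem_mem_SS _ _ hb ha) heS⟩, b, hb, hba, ?_⟩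
      rw [mx_mul, ← mulVec_mulVec, elem_mulVec, if_pos rfl, ← hu, mul_assoc, Units.inv_mul]
      simp
    · exact ⟨e, ⟨heE, heS⟩, i, hi, hia, hu⟩
  have claim2 : ∃ e ∈ EE d A ⊓ SS s, (mx e *ᵥ (fun k => mx g k a)) a = 1 := by
    obtain ⟨e, ⟨heE, heS⟩, i, hi, hia, u, hu⟩ := claim1
    refine ⟨elem a i hia.symm ((1 - (mx e *ᵥ (fun k => mx g k a)) a) * ↑u⁻¹) * e,
      ⟨mul_mem (elem_mem_EE _ _ _ _) heE, mul_mem (elem_mem_SS _ _ ha hi) heS⟩, ?_⟩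
    rw [mx_mul, ← mulVec_mulVec, elem_mulVec, if_pos rfl, ← hu, mul_assoc, Units.inv_mul]
    simp
  obtain ⟨e, ⟨heE, heS⟩, he1⟩ := claim2
  have hcol : ∀ k, mx (e * g) k a = (mx e *ᵥ (fun k => mx g k a)) k := fun k => by
    rw [mx_mul]; rfl
  set h := e * g with hh
  have hS : h ∈ SS s := mul_mem heS hg
  have haa : mx h a a = 1 := by rw [hcol, he1]
  obtain ⟨c, hc, ec⟩ := TV.col (RelN_top (d := d) (A := A)) (t := a)
    (y := fun k => if k = a then 0 else - mx h k a) (fun _ => trivial) (by simp)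
  obtain ⟨r, hr, er⟩ := TV.row (RelN_top (d := d) (A := A)) (t := a)
    (y := fun k => if k = a then 0 else - mx h a k) (fun _ => trivial) (by simp)
  have hfin : c * h * r ∈ SS (s.erase a) := by
    have e1 : ∀ x y, mx (c * h) x y = mx h x y + (if x = a then 0 else - mx h x a) * mx h a y := by
      intro x y
      rw [mx_mul, ec, add_mul, one_mul, vecMulVec_mul, Matrix.add_apply, vecMulVec_apply]
      simp
    have e2 : ∀ x y, mx (c * h * r) x y =
        mx (c * h) x y + mx (c * h) x a * (if y = a then 0 else - mx h a y) := by
      intro x y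
      rw [mx_mul _ r, er, mul_add, mul_one, mul_vecMulVec, Matrix.add_apply, vecMulVec_apply]
      simp
    apply SS_of_apply
    intro x y hy
    rw [e2, e2, e1, e1, e1, e1]
    by_cases hya : y = a
    · subst hya
      by_cases hxy : x = y
      · subst hxy; simp [haa]
      · simp [hxy, haa]
    · have hys : y ∉ s := fun h' => hy (Finset.mem_erase.2 ⟨hya, h'⟩)
      have h1 := SS_apply_left hS hys
      have h2 := SS_apply_right hS hys
      simp only [h1, h2, hya, haa, Ne.symm hya, if_false]
      by_cases hxy : x = y
      · subst hxy; simp [hya]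
      · simp [hxy]
  have := ih _ (Finset.erase_ssubset ha) _ hfin
  have h3 : g = e⁻¹ * (c⁻¹ * (c * h * r) * r⁻¹) := by rw [hh]; group
  rw [h3]
  exact mul_mem (inv_mem heE) (mul_mem (mul_mem (inv_mem hc) this) (inv_mem hr))

lemma EE_eq_top_of_red (hred : RedProp d A) (g : SLd d A) : g ∈ EE d A :=
  EE_eq_top_of_red_aux hred Finset.univ g (fun b hb => absurd (Finset.mem_univ b) hb)

lemma redProp_local [IsLocalRing A] : RedProp d A := by
  intro s v ⟨w, hw⟩
  refine ⟨1, one_mem _, ?_⟩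
  rw [mx_one, one_mulVec]
  by_contra hcon
  push Not at hcon
  have : ∑ i ∈ s, w i * v i ∈ IsLocalRing.maximalIdeal A :=
    Ideal.sum_mem _ fun i hi => Ideal.mul_mem_left _ _ ((IsLocalRing.mem_maximalIdeal _).2 (hcon i hi))
  rw [hw] at this
  exact (Ideal.ne_top_iff_one _).1 (IsLocalRing.maximalIdeal.isMaximal A).ne_top this

lemma EE_local [IsLocalRing A] (g : SLd d A) : g ∈ EE d A := EE_eq_top_of_red redProp_local g

/-- weak Euclidean property -/
def IsEuc (A : Type*) [CommRing A] : Prop :=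
  ∃ φ : A → ℕ, ∀ a b : A, b ≠ 0 → ∃ q, a - q * b = 0 ∨ φ (a - q * b) < φ b

lemma redProp_euc [Nontrivial A] (hA : IsEuc A) : RedProp d A := by
  classical
  obtain ⟨φ, hφ⟩ := hA
  intro s v ⟨w, hw⟩
  -- nonzero entries in the orbit
  let S : Set ℕ := {n | ∃ g ∈ EE d A ⊓ SS s, ∃ i ∈ s, (mx g *ᵥ v) i ≠ 0 ∧ φ ((mx g *ᵥ v) i) = n}
  have hSne : S.Nonempty := by
    by_contra hcon
    have : ∀ i ∈ s, v i = 0 := by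
      intro i hi
      by_contra h
      exact hcon ⟨_, 1, one_mem _, i, hi, by rwa [mx_one, one_mulVec], rfl⟩
    rw [Finset.sum_eq_zero (fun i hi => by rw [this i hi, mul_zero])] at hw
    exact zero_ne_one hw
  obtain ⟨g, hg, i, hi, hne, hmin⟩ := Nat.sInf_mem hSne
  refine ⟨g, hg, i, hi, ?_⟩
  have hdvd : ∀ j ∈ s, (mx g *ᵥ v) i ∣ (mx g *ᵥ v) j := by
    intro j hj
    by_cases hji : j = i
    · rw [hji]
    obtain ⟨q, hq⟩ := hφ ((mx g *ᵥ v) j) ((mx g *ᵥ v) i) hne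
    rcases hq with hq | hq
    · exact ⟨q, by rw [mul_comm]; exact sub_eq_zero.1 hq⟩
    · by_cases h0 : (mx g *ᵥ v) j - q * (mx g *ᵥ v) i = 0
      · exact ⟨q, by rw [mul_comm]; exact sub_eq_zero.1 h0⟩
      exfalso
      have hcalc : (mx (elem j i hji (-q) * g) *ᵥ v) j = (mx g *ᵥ v) j - q * (mx g *ᵥ v) i := by
        rw [mx_mul, ← mulVec_mulVec, elem_mulVec, if_pos rfl]; ring
      have : φ ((mx g *ᵥ v) j - q * (mx g *ᵥ v) i) ∈ S :=
        ⟨elem j i hji (-q) * g, mul_mem ⟨elem_mem_EE _ _ _ _, elem_mem_SS _ _ hj hi⟩ hg, j, hj,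
          by rw [hcalc]; exact h0, by rw [hcalc]⟩
      have := Nat.sInf_le this
      omega
  -- v = g⁻¹ (g v)
  have hv : ∀ j ∈ s, (mx g *ᵥ v) i ∣ v j := by
    intro j hj
    have e : v = mx g⁻¹ *ᵥ (mx g *ᵥ v) := by rw [mulVec_mulVec, mx_inv_mul, one_mulVec]
    have e' : v j = ∑ k, mx g⁻¹ j k * (mx g *ᵥ v) k := congrFun e j
    rw [e']
    apply Finset.dvd_sum
    intro k _
    by_cases hk : k ∈ s
    · exact Dvd.dvd.mul_left (hdvd k hk) _
    · have : mx g⁻¹ j k = if j = k then 1 else 0 := SS_apply_right (inv_mem hg.2) hk j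
      rw [this, if_neg (fun h : j = k => hk (h ▸ hj)), zero_mul]
      exact dvd_zero _
  have : (mx g *ᵥ v) i ∣ ∑ i ∈ s, w i * v i := Finset.dvd_sum fun j hj => (hv j hj).mul_left _
  rw [hw] at this
  exact isUnit_of_dvd_one this

lemma EE_euc (hA : IsEuc A) (g : SLd d A) : g ∈ EE d A := by
  rcases subsingleton_or_nontrivial A with hsub | hnon
  · have : g = 1 := by apply mx_inj; ext; exact Subsingleton.elim _ _
    rw [this]; exact one_mem _
  · exact EE_eq_top_of_red (redProp_euc hA) g
end P1b

open Matrix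

section P2
variable {d : ℕ}

lemma common_den {C C' : Type*} [CommRing C] [CommRing C'] (f : C →+* C') (T : Submonoid C)
    (hden : ∀ x : C', ∃ s ∈ T, ∃ c, f s * x = f c) {ι : Type*} (t : Finset ι) (x : ι → C') :
    ∃ s ∈ T, ∀ i ∈ t, ∃ c, f s * x i = f c := by
  classical
  induction t using Finset.induction_on with
  | empty => exact ⟨1, T.one_mem, by simp⟩
  | insert a t _ ih =>
    obtain ⟨s, hs, h⟩ := ih
    obtain ⟨s', hs', c', h'⟩ := hden (x a)
    refine ⟨s * s', T.mul_mem hs hs', fun i hi => ?_⟩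
    rcases Finset.mem_insert.1 hi with rfl | hi
    · exact ⟨s * c', by rw [map_mul, map_mul, mul_assoc, h']⟩
    · obtain ⟨c, hc⟩ := h i hi
      exact ⟨s' * c, by rw [map_mul, map_mul, mul_comm (f s), mul_assoc, hc]⟩

lemma poly_den {C C' : Type*} [CommRing C] [CommRing C'] (f : C →+* C') (T : Submonoid C)
    (hden : ∀ x : C', ∃ s ∈ T, ∃ c, f s * x = f c) (x : Polynomial C') :
    ∃ s ∈ T.map (Polynomial.C : C →+* Polynomial C), ∃ c,
      Polynomial.mapRingHom f s * x = Polynomial.mapRingHom f c := by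
  induction x using Polynomial.induction_on' with
  | add p q hp hq =>
    obtain ⟨s, hs, c, h⟩ := hp
    obtain ⟨s', hs', c', h'⟩ := hq
    refine ⟨s * s', Submonoid.mul_mem _ hs hs', s' * c + s * c', ?_⟩
    rw [map_add, map_mul, map_mul, map_mul, ← h, ← h']; ring
  | monomial n a =>
    obtain ⟨s, hs, c, h⟩ := hden a
    refine ⟨Polynomial.C s, ⟨s, hs, rfl⟩, Polynomial.monomial n c, ?_⟩
    simp [← h, Polynomial.C_mul_monomial]

lemma pairVec_map {C C' : Type*} [CommRing C] [CommRing C'] (f : C →+* C') (u : Fin d → C)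
    (k l x : Fin d) : f (pairVec u k l x) = pairVec (fun i => f (u i)) k l x := by
  simp only [pairVec, Pi.sub_apply, Pi.single_apply, map_sub]
  split_ifs <;> simp

lemma den_lemma (hd : 3 ≤ d) {C C' : Type*} [CommRing C] [CommRing C'] (f : C →+* C')
    (T : Submonoid C) (hden : ∀ x : C', ∃ s ∈ T, ∃ c, f s * x = f c) (τ : SLd d C') :
    ∃ a ∈ T, ∀ (z : C) (i j : Fin d) (h : i ≠ j), ∃ g ∈ EE d C,
      mapSL f g = τ * elem i j h (f (a * z)) * τ⁻¹ := by
  classical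
  obtain ⟨s1, hs1, h1⟩ := common_den f T hden (Finset.univ : Finset (Fin d × Fin d))
    (fun p => mx τ p.1 p.2)
  obtain ⟨s2, hs2, h2⟩ := common_den f T hden (Finset.univ : Finset (Fin d × Fin d))
    (fun p => mx τ⁻¹ p.1 p.2)
  choose! U hU using h1
  choose! V hV using h2
  refine ⟨s1 ^ 2 * s2 ^ 2, T.mul_mem (T.pow_mem hs1 2) (T.pow_mem hs2 2), ?_⟩
  intro z i j hij
  let u0 : Fin d → C := fun k => U (k, i)
  let Y : Fin d → C := ∑ k, ∑ l, (V (j, k) * V (i, l)) • pairVec u0 k l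
  have hdot : ∀ k l, ((V (j, k) * V (i, l)) • pairVec u0 k l) ⬝ᵥ u0 = 0 := by
    intro k l; rw [smul_dotProduct, pairVec_dot]; simp
  have hTV : TV (EE d C) u0 (z • Y) := by
    rw [← TV.smul_swap]
    have hdot' : ∀ k l, ((V (j, k) * V (i, l)) • pairVec u0 k l) ⬝ᵥ (z • u0) = 0 := by
      intro k l; rw [dotProduct_smul, hdot, smul_zero]
    apply TV.sum_right
    · intro k _
      apply TV.sum_right
      · intro l _
        rw [TV.smul_swap, smul_smul]
        exact TV.pair hd RelN_top _ _ _ trivial trivial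
      · intro l _; exact hdot' k l
    · intro k _
      rw [sum_dotProduct]; simp [hdot']
  obtain ⟨g, hg, eg⟩ := hTV
  refine ⟨g, hg, mx_inj ?_⟩
  rw [mx_conj_elem, mx_map, eg]
  have hw := suslin_formula (u := fun k => mx τ k i) (w := fun k => mx τ⁻¹ j k)
    (g := fun k => mx τ⁻¹ i k) (by rw [inv_row_dot_col, if_neg hij.symm])
    (by rw [inv_row_dot_col, if_pos rfl])
  have hY : ∀ x, f (Y x) = f (s1 * s2 ^ 2) * mx τ⁻¹ j x := by
    intro x
    have hx := congrFun hw x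
    beta_reduce at hx
    rw [hx]
    simp only [Y, Finset.sum_apply, map_sum, Finset.mul_sum, Pi.smul_apply, smul_eq_mul, map_mul,
      pairVec_map]
    refine Finset.sum_congr rfl fun k _ => Finset.sum_congr rfl fun l _ => ?_
    have e1 : (fun a => f (u0 a)) = f s1 • (fun k => mx τ k i) := by
      ext a; simp only [u0, Pi.smul_apply, smul_eq_mul]
      exact (hU (a, i) (Finset.mem_univ _)).symm
    have e2 : pairVec (f s1 • (fun k => mx τ k i)) k l x =
        f s1 * pairVec (fun k => mx τ k i) k l x := by
      simp only [pairVec, Pi.sub_apply, Pi.single_apply, Pi.smul_apply, smul_eq_mul]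
      split_ifs <;> ring
    rw [e1, e2, ← hV (j, k) (Finset.mem_univ _), ← hV (i, l) (Finset.mem_univ _)]
    simp only [map_pow]
    ring
  ext a b
  simp only [map_apply, Matrix.add_apply, Matrix.one_apply, map_add, vecMulVec_apply, map_mul,
    Pi.smul_apply, smul_eq_mul, hY]
  have e3 : f (u0 a) = f s1 * mx τ a i := (hU (a, i) (Finset.mem_univ _)).symm
  rw [e3]
  congr 1
  · split_ifs <;> simp
  · simp only [map_mul, map_pow]; ring

open Polynomial in
/-- `X ↦ X + aY` -/
noncomputable def shift {R : Type*} [CommRing R] (a : R) : R[X] →+* R[X][X] :=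
  eval₂RingHom (C.comp C) (C X + C (C a) * X)

open Polynomial in
lemma shift_nat {R R' : Type*} [CommRing R] [CommRing R'] (f : R →+* R') (a : R) (p : R[X]) :
    mapRingHom (mapRingHom f) (shift a p) = shift (f a) (mapRingHom f p) := by
  have : (mapRingHom (mapRingHom f)).comp (shift a) = (shift (f a)).comp (mapRingHom f) := by
    apply Polynomial.ringHom_ext
    · intro x; simp [shift]
    · simp [shift]
  exact RingHom.congr_fun this p

open Polynomial in
lemma shift_sub {R : Type*} [CommRing R] (a : R) (p : R[X]) :
    ∃ q, shift a p - C p = C (C a) * q := by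
  have h1 : shift a p = eval (C X + C (C a) * X) (p.map (C.comp C)) := by
    simp [shift, eval₂_eq_eval_map]
  have h2 : (C p : R[X][X]) = eval (C X) (p.map (C.comp C)) := by
    rw [← eval₂_eq_eval_map, ← hom_eval₂, eval₂_C_X]
  obtain ⟨q, hq⟩ := sub_dvd_eval_sub (C X + C (C a) * X) (C X) (p.map (C.comp C) : R[X][X][X])
  rw [h1, h2, hq]
  exact ⟨X * q, by ring⟩

open Polynomial in
lemma local_step (hd : 3 ≤ d) {R R' : Type*} [CommRing R] [CommRing R'] (f : R →+* R')
    (S : Submonoid R) (hS : ∀ s ∈ S, IsUnit (f s))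
    (hden : ∀ x : R', ∃ s ∈ S, ∃ c, f s * x = f c)
    (β : SLd d R'[X]) (hβ : β ∈ EE d R'[X]) :
    ∀ τ : SLd d R'[X][X], ∃ s ∈ S, ∀ b : R, ∃ g ∈ EE d R[X][X],
      mapSL (mapRingHom (mapRingHom f)) g =
        τ * (mapSL (shift (f (s * b))) β * (mapSL C β)⁻¹) * τ⁻¹ := by
  induction hβ using Subgroup.closure_induction with
  | mem y hy =>
    obtain ⟨i, j, h, l, rfl⟩ := hy
    intro τ
    obtain ⟨s0', ⟨s0, hs0, rfl⟩, l0, hl0⟩ := poly_den f S hden l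
    obtain ⟨a', ⟨a'', ⟨s1, hs1, rfl⟩, rfl⟩, ha⟩ := den_lemma hd (mapRingHom (mapRingHom f)) _
      (poly_den (mapRingHom f) _ (poly_den f S hden)) τ
    refine ⟨s0 * s1, S.mul_mem hs0 hs1, fun b => ?_⟩
    obtain ⟨q, hq⟩ := shift_sub (s0 * s1 * b) l0
    obtain ⟨g, hg, eg⟩ := ha (C (C b) * q) i j h
    refine ⟨g, hg, ?_⟩
    rw [eg, map_elem, map_elem, ← elem_neg, ← elem_add]
    congr 3
    have hu : IsUnit (C (C (f s0)) : R'[X][X]) := (hS s0 hs0).map (C.comp C)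
    apply hu.mul_left_cancel
    have e := congrArg (mapRingHom (mapRingHom f)) hq
    rw [map_sub, shift_nat, ← hl0] at e
    simp only [map_mul, coe_mapRingHom, map_C] at e hl0 ⊢
    rw [← hl0] at e
    simp only [map_mul, map_C, coe_mapRingHom] at e
    have e' : shift (f (s0 * s1 * b)) (C (f s0)) = (C (C (f s0)) : R'[X][X]) := by simp [shift]
    simp only [map_mul] at e'
    rw [e'] at e
    linear_combination -e
  | one => 
    intro τ
    exact ⟨1, S.one_mem, fun b => ⟨1, one_mem _, by simp⟩⟩
  | mul y z _ _ hy hz =>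
    intro τ
    obtain ⟨s, hs, h⟩ := hy τ
    obtain ⟨s', hs', h'⟩ := hz (τ * mapSL C y)
    refine ⟨s * s', S.mul_mem hs hs', fun b => ?_⟩
    obtain ⟨g, hg, eg⟩ := h (s' * b)
    obtain ⟨g', hg', eg'⟩ := h' (s * b)
    refine ⟨g * g', mul_mem hg hg', ?_⟩
    rw [map_mul, eg, eg', show s * s' * b = s * (s' * b) by ring,
      show s' * (s * b) = s * (s' * b) by ring, map_mul (mapSL _) y, map_mul (mapSL _) y]
    group
  | inv y _ hy =>
    intro τ
    obtain ⟨s, hs, h⟩ := hy (τ * (mapSL C y)⁻¹)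
    refine ⟨s, hs, fun b => ?_⟩
    obtain ⟨g, hg, eg⟩ := h b
    refine ⟨g⁻¹, inv_mem hg, ?_⟩
    rw [map_inv, eg, map_inv, map_inv]
    group

open Polynomial in
/-- Suslin's local-global principle. -/
theorem local_global (hd : 3 ≤ d) {R : Type*} [CommRing R] [IsDomain R] (α : SLd d R[X])
    (hloc : ∀ (m : Ideal R) [m.IsMaximal],
      mapSL (mapRingHom (algebraMap R (Localization.AtPrime m))) α ∈
        EE d (Localization.AtPrime m)[X]) :
    α * (mapSL (C.comp (evalRingHom 0)) α)⁻¹ ∈ EE d R[X] := by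
  -- substitutions
  let sub2 : R[X][X] → R[X][X] → (R[X][X] →+* R[X][X]) := fun x y =>
    eval₂RingHom (eval₂RingHom (C.comp C) x) y
  have hsub_shift : ∀ a x y p, sub2 x y (shift a p) =
      eval₂RingHom (C.comp C : R →+* R[X][X]) (x + C (C a) * y) p := by
    intro a x y p
    have : (sub2 x y).comp (shift a) = eval₂RingHom (C.comp C : R →+* R[X][X]) (x + C (C a) * y) := by
      apply Polynomial.ringHom_ext
      · intro r; simp [sub2, shift]
      · simp [sub2, shift]
    exact RingHom.congr_fun this p
  have hsub_C : ∀ x y p, sub2 x y (C p) = eval₂RingHom (C.comp C : R →+* R[X][X]) x p := by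
    intro x y p
    simp [sub2]
  let J : Ideal R :=
    { carrier := {a | mapSL (shift a) α * (mapSL C α)⁻¹ ∈ EE d R[X][X]}
      zero_mem' := by
        have : shift (0 : R) = C := by
          apply Polynomial.ringHom_ext
          · intro r; simp [shift]
          · simp [shift]
        simp only [Set.mem_ofPred_eq]
        rw [this, mul_inv_cancel]; exact one_mem _
      add_mem' := by
        intro a b ha hb
        simp only [Set.mem_ofPred_eq] at ha hb ⊢
        have h1 := EE_map (sub2 (C X + C (C a) * X) X) hb
        have e1 : (sub2 (C X + C (C a) * X) X).comp (shift b) = shift (a + b) := by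
          refine Polynomial.ringHom_ext (fun p => ?_) ?_
          · simp [sub2, shift]
          · simp [sub2, shift]; ring
        have e2 : (sub2 (C X + C (C a) * X) X).comp C = shift a := by
          refine Polynomial.ringHom_ext (fun p => ?_) ?_
          · simp [sub2, shift]
          · simp [sub2, shift]
        rw [map_mul, map_inv, mapSL_comp, mapSL_comp, e1, e2] at h1
        have := mul_mem h1 ha
        simpa [mul_assoc] using this
      smul_mem' := by
        intro c a ha
        simp only [Set.mem_ofPred_eq, smul_eq_mul] at ha ⊢
        have h1 := EE_map (sub2 (C X) (C (C c) * X)) ha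
        have e1 : (sub2 (C X) (C (C c) * X)).comp (shift a) = shift (c * a) := by
          refine Polynomial.ringHom_ext (fun p => ?_) ?_
          · simp [sub2, shift]
          · simp [sub2, shift]; ring
        have e2 : (sub2 (C X) (C (C c) * X)).comp C = C := by
          refine Polynomial.ringHom_ext (fun p => ?_) ?_
          · simp [sub2]
          · simp [sub2]
        rw [map_mul, map_inv, mapSL_comp, mapSL_comp, e1, e2] at h1
        exact h1 }
  have hJ : J = ⊤ := by
    by_contra hne
    obtain ⟨m, hm, hJm⟩ := Ideal.exists_le_maximal J hne
    let f := algebraMap R (Localization.AtPrime m)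
    obtain ⟨s, hs, h⟩ := local_step hd f m.primeCompl
      (fun s hs => IsLocalization.map_units (Localization.AtPrime m) ⟨s, hs⟩)
      (fun x => by
        obtain ⟨⟨c, s⟩, h⟩ := IsLocalization.surj m.primeCompl x
        exact ⟨s, s.2, c, by rw [mul_comm]; exact h⟩) _ (hloc m) 1
    obtain ⟨g, hg, eg⟩ := h 1
    have hinj : Function.Injective (mapRingHom (mapRingHom f)) := by
      apply Polynomial.map_injective
      apply Polynomial.map_injective
      exact IsLocalization.injective _ m.primeCompl_le_nonZeroDivisors
    have : s ∈ J := by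
      change mapSL (shift s) α * (mapSL C α)⁻¹ ∈ EE d R[X][X]
      have e : g = mapSL (shift s) α * (mapSL C α)⁻¹ := by
        apply mapSL_inj (B := (Localization.AtPrime m)[X][X]) (f := mapRingHom (mapRingHom f)) hinj
        rw [eg, one_mul, inv_one, mul_one, mul_one s, map_mul (mapSL _), map_inv (mapSL _), mapSL_comp, mapSL_comp, mapSL_comp,
          mapSL_comp]
        congr 2
        · congr 1
          refine Polynomial.ringHom_ext (fun p => ?_) ?_
          · simp [shift, f]
          · simp [shift, f]
        · congr 2
          refine Polynomial.ringHom_ext (fun p => ?_) ?_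
          · simp [f]
          · simp
      rwa [← e]
    exact hs (hJm this)
  have h1 : (1 : R) ∈ J := by rw [hJ]; trivial
  have h2 : mapSL (shift 1) α * (mapSL C α)⁻¹ ∈ EE d R[X][X] := h1
  have h3 := EE_map (eval₂RingHom (C.comp (evalRingHom 0)) X : R[X][X] →+* R[X]) h2
  rw [map_mul, map_inv, mapSL_comp, mapSL_comp] at h3
  have e1 : (eval₂RingHom (C.comp (evalRingHom 0)) X : R[X][X] →+* R[X]).comp (shift 1) =
      RingHom.id _ := by
    refine Polynomial.ringHom_ext (fun p => ?_) ?_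
    · simp [shift]
    · simp [shift]
  have e2 : (eval₂RingHom (C.comp (evalRingHom 0)) X : R[X][X] →+* R[X]).comp C =
      C.comp (evalRingHom 0) := by
    refine Polynomial.ringHom_ext (fun p => ?_) ?_
    · simp
    · simp
  rw [e1, e2, mapSL_id] at h3
  exact h3
end P2

open Matrix

section P4
variable {d : ℕ}

lemma exists_prod {Γ K : Type*} [Group Γ] [AddCommGroup K] (s : Finset (Fin d))
    (φ : Fin d → K → Γ) (hadd : ∀ i ∈ s, ∀ a b, φ i (a + b) = φ i a * φ i b)
    (hc : ∀ i ∈ s, ∀ j ∈ s, i ≠ j → ∀ a b, φ i a * φ j b = φ j b * φ i a) :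
    ∃ l : (Fin d → K) → Γ, (∀ c c', l (c + c') = l c * l c') ∧
      (∀ i ∈ s, ∀ r, l (Pi.single i r) = φ i r) ∧ (∀ i ∉ s, ∀ r, l (Pi.single i r) = 1) := by
  classical
  let f : ∀ _ : Fin d, Multiplicative K →* Γ := fun i =>
    if h : i ∈ s then
      MonoidHom.mk' (fun a => φ i a.toAdd) (fun a b => by rw [toAdd_mul, hadd i h])
    else 1
  have hf : ∀ i ∈ s, ∀ a, f i (Multiplicative.ofAdd a) = φ i a := by
    intro i hi a; simp [f, hi]
  have hf' : ∀ i ∉ s, ∀ a, f i a = 1 := by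
    intro i hi a; simp [f, hi]
  have hcm : Pairwise fun i j => ∀ (x y : Multiplicative K), Commute ((f i) x) ((f j) y) := by
    intro i j hij x y
    by_cases hi : i ∈ s
    · by_cases hj : j ∈ s
      · have := hc i hi j hj hij x.toAdd y.toAdd
        rw [← hf i hi, ← hf j hj] at this
        exact this
      · rw [hf' j hj]; exact Commute.one_right _
    · rw [hf' i hi]; exact Commute.one_left _
  let L := MonoidHom.noncommPiCoprod f hcm
  have hs : ∀ i (r : K), L (fun j => Multiplicative.ofAdd ((Pi.single i r : Fin d → K) j)) =
      f i (Multiplicative.ofAdd r) := by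
    intro i r
    refine Eq.trans ?_ (MonoidHom.noncommPiCoprod_mulSingle (ϕ := f) (hcomm := hcm) i (Multiplicative.ofAdd r))
    congr 1
  refine ⟨fun c => L (fun i => Multiplicative.ofAdd (c i)), ?_, ?_, ?_⟩
  · intro c c'
    rw [← map_mul]; rfl
  · intro i hi r
    simp only [hs, hf i hi]
  · intro i hi r
    simp only [hs, hf' i hi]

lemma pi_ind {K : Type*} [AddCommGroup K] {p : (Fin d → K) → Prop}
    (h0 : p 0) (hs : ∀ i r, p (Pi.single i r)) (ha : ∀ c c', p c → p c' → p (c + c')) (c) : p c := by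
  rw [← Finset.univ_sum_single c]
  exact Finset.sum_induction _ p (fun a b => ha a b) h0 (fun i _ => hs i (c i))

structure SteinData (d : ℕ) (K Γ : Type*) [Field K] [Group Γ] where
  π : Γ →* SLd d K
  x : Fin d → Fin d → K → Γ
  T : Subgroup Γ
  x_add : ∀ i j, i ≠ j → ∀ a b, x i j (a + b) = x i j a * x i j b
  x_comm : ∀ i j k, i ≠ j → j ≠ k → i ≠ k → ∀ a b,
    x i j a * x j k b = x i k (a * b) * x j k b * x i j a
  x_commute : ∀ i j k l, i ≠ j → k ≠ l → j ≠ k → i ≠ l → ∀ a b,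
    x i j a * x k l b = x k l b * x i j a
  π_x : ∀ i j (h : i ≠ j) a, π (x i j a) = elem i j h a
  T_diag : ∀ t ∈ T, ∃ u : Fin d → K, (∀ i, u i ≠ 0) ∧ mx (π t) = diagonal u
  T_norm : ∀ t ∈ T, ∀ i j, i ≠ j → ∀ a, ∃ b, t * x i j a = x i j b * t
  T_inj : ∀ t ∈ T, π t = 1 → t = 1
  rank : ∀ i j, i ≠ j → ∀ b c, 1 + b * c ≠ 0 → ∃ t ∈ T, ∃ b' c',
    x i j b * x j i c = x j i c' * t * x i j b'

namespace SteinData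
variable {K Γ : Type*} [Field K] [Group Γ] (D : SteinData d K Γ)

def gen (s : Finset (Fin d)) : Submonoid Γ :=
  Submonoid.closure ({g | ∃ i ∈ s, ∃ j ∈ s, i ≠ j ∧ ∃ a, g = D.x i j a} ∪ D.T)

lemma x_zero {i j} (h : i ≠ j) : D.x i j 0 = 1 := by
  have := D.x_add i j h 0 0
  rw [add_zero] at this
  exact left_eq_mul.1 this

lemma x_mem {s : Finset (Fin d)} {i j} (hi : i ∈ s) (hj : j ∈ s) (h : i ≠ j) (a : K) :
    D.x i j a ∈ D.gen s :=
  Submonoid.subset_closure (Or.inl ⟨i, hi, j, hj, h, a, rfl⟩)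

lemma T_mem {s : Finset (Fin d)} {t} (ht : t ∈ D.T) : t ∈ D.gen s :=
  Submonoid.subset_closure (Or.inr ht)

lemma gen_diag {s : Finset (Fin d)} {a : Fin d} (ha : a ∉ s) {g} (hg : g ∈ D.gen s) :
    ∃ t : K, t ≠ 0 ∧ mx (D.π g) *ᵥ Pi.single a 1 = t • Pi.single a 1 ∧
      Pi.single a 1 ᵥ* mx (D.π g) = t • Pi.single a 1 := by
  induction hg using Submonoid.closure_induction with
  | mem g hg =>
    rcases hg with ⟨i, hi, j, hj, h, r, rfl⟩ | ht
    · rw [D.π_x i j h]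
      have := elem_mem_SS h r hi hj a ha
      exact ⟨1, one_ne_zero, by rw [this.1, one_smul], by rw [this.2, one_smul]⟩
    · obtain ⟨u, hu, e⟩ := D.T_diag g ht
      refine ⟨u a, hu a, ?_, ?_⟩
      · rw [e]; ext b; by_cases hb : b = a
        · subst hb; simp
        · simp [hb]
      · rw [e]; ext b; by_cases hb : b = a
        · subst hb; simp
        · simp [hb]
  | one => exact ⟨1, one_ne_zero, by rw [map_one, mx_one, one_mulVec, one_smul],
      by rw [map_one, mx_one, vecMul_one, one_smul]⟩
  | mul g h _ _ ihg ihh =>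
    obtain ⟨t, ht, h1, h2⟩ := ihg
    obtain ⟨t', ht', h1', h2'⟩ := ihh
    refine ⟨t' * t, mul_ne_zero ht' ht, ?_, ?_⟩
    · rw [map_mul, mx_mul, ← mulVec_mulVec, h1', mulVec_smul, h1, smul_smul]
    · rw [map_mul, mx_mul, ← vecMul_vecMul, h2, smul_vecMul, h2', smul_smul, mul_comm]

/-- support lemma: row `a ∈ s` of an element of `gen s` is supported in `s`. -/
lemma gen_row {s : Finset (Fin d)} {a b : Fin d} (ha : a ∈ s) (hb : b ∉ s) {g}
    (hg : g ∈ D.gen s) : mx (D.π g) a b = 0 := by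
  obtain ⟨t, _, h, _⟩ := D.gen_diag hb hg
  have := congrFun h a
  have hab : a ≠ b := fun e => hb (e ▸ ha)
  simpa [hab] using this

lemma inj_step [Infinite K] (s : Finset (Fin d)) (a : Fin d) (ha : a ∉ s)
    (ih : ∀ g ∈ D.gen s, D.π g = 1 → g = 1) :
    ∀ g ∈ D.gen (insert a s), D.π g = 1 → g = 1 := by
  classical
  have hne : ∀ i ∈ s, i ≠ a := fun i hi e => ha (e ▸ hi)
  obtain ⟨l, ladd, ls, ls'⟩ := exists_prod s (fun i r => D.x i a r)
    (fun i hi r r' => D.x_add i a (hne i hi) r r')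
    (fun i hi j hj hij r r' => D.x_commute i a j a (hne i hi) (hne j hj) (hne j hj).symm
      (hne i hi) r r')
  obtain ⟨u, uadd, us, us'⟩ := exists_prod s (fun i r => D.x a i r)
    (fun i hi r r' => D.x_add a i (hne i hi).symm r r')
    (fun i hi j hj hij r r' => D.x_commute a i a j (hne i hi).symm (hne j hj).symm (hne i hi)
      (hne j hj).symm r r')
  have l0 : l 0 = 1 := by have := ladd 0 0; rw [add_zero] at this; exact left_eq_mul.1 this
  have u0 : u 0 = 1 := by have := uadd 0 0; rw [add_zero] at this; exact left_eq_mul.1 this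
  let cv : (Fin d → K) → Fin d → K := fun c i => if i ∈ s then c i else 0
  have cvadd : ∀ c c', cv (c + c') = cv c + cv c' := by
    intro c c'; ext i; by_cases hi : i ∈ s <;> simp [cv, hi]
  have cvs : ∀ i ∈ s, ∀ r, cv (Pi.single i r) = Pi.single i r := by
    intro i hi r; ext j
    by_cases h : j = i
    · subst h; simp [cv, hi]
    · simp [cv, h]
  have cvs' : ∀ i ∉ s, ∀ r, cv (Pi.single i r) = 0 := by
    intro i hi r; ext j
    by_cases h : j = i
    · subst h; simp [cv, hi]
    · simp [cv, h]
  have cva : ∀ c, cv c a = 0 := fun c => by simp [cv, ha]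
  -- matrices of l and u
  have lmx : ∀ c, mx (D.π (l c)) = 1 + vecMulVec (cv c) (Pi.single a 1) := by
    refine pi_ind ?_ ?_ ?_
    · have : cv 0 = 0 := by ext i; simp [cv]
      rw [l0, map_one, mx_one, this, zero_vecMulVec, add_zero]
    · intro i r
      by_cases hi : i ∈ s
      · rw [ls i hi, D.π_x i a (hne i hi), elem_coe, cvs i hi]
        congr 1
        ext p q
        simp [vecMulVec_apply, Pi.single_apply]
      · rw [ls' i hi, map_one, mx_one, cvs' i hi, zero_vecMulVec, add_zero]
    · intro c c' h h'
      rw [ladd, map_mul, mx_mul, h, h', cvadd, add_vecMulVec, mul_add, add_mul, add_mul, mul_one,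
        vecMulVec_mul_vecMulVec]
      simp [cva]
      abel
  have umx : ∀ c, mx (D.π (u c)) = 1 + vecMulVec (Pi.single a 1) (cv c) := by
    refine pi_ind ?_ ?_ ?_
    · have : cv 0 = 0 := by ext i; simp [cv]
      rw [u0, map_one, mx_one, this, vecMulVec_zero, add_zero]
    · intro i r
      by_cases hi : i ∈ s
      · rw [us i hi, D.π_x a i (hne i hi).symm, elem_coe, cvs i hi]
      · rw [us' i hi, map_one, mx_one, cvs' i hi, vecMulVec_zero, add_zero]
    · intro c c' h h'
      rw [uadd, map_mul, mx_mul, h, h', cvadd, vecMulVec_add, mul_add, add_mul, add_mul, mul_one,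
        vecMulVec_mul_vecMulVec]
      simp [cva]
      abel
  -- normalisation
  have lnorm : ∀ z ∈ D.gen s, ∀ c, ∃ c', z * l c = l c' * z := by
    intro z hz
    induction hz using Submonoid.closure_induction with
    | one => exact fun c => ⟨c, by simp⟩
    | mul g h _ _ ihg ihh =>
      intro c
      obtain ⟨c1, e1⟩ := ihh c
      obtain ⟨c2, e2⟩ := ihg c1
      exact ⟨c2, by rw [mul_assoc, e1, ← mul_assoc, e2, mul_assoc]⟩
    | mem z hz =>
      refine pi_ind ⟨0, by simp [l0]⟩ ?_ ?_
      · intro k r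
        by_cases hk : k ∈ s
        · rw [ls k hk]
          rcases hz with ⟨i, hi, j, hj, h, b, rfl⟩ | ht
          · by_cases hjk : j = k
            · subst hjk
              refine ⟨Pi.single i (b * r) + Pi.single j r, ?_⟩
              rw [D.x_comm i j a h (hne j hj) (hne i hi), ladd, ls i hi, ls j hj]
            · refine ⟨Pi.single k r, ?_⟩
              rw [ls k hk, D.x_commute i j k a h (hne k hk) hjk (hne i hi)]
          · obtain ⟨b, hb⟩ := D.T_norm z ht k a (hne k hk) r
            exact ⟨Pi.single k b, by rw [hb, ls k hk]⟩
        · exact ⟨0, by rw [ls' k hk, l0]; simp⟩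
      · rintro c c' ⟨c1, e1⟩ ⟨c2, e2⟩
        exact ⟨c1 + c2, by rw [ladd, ladd, ← mul_assoc, e1, mul_assoc, e2, mul_assoc]⟩
  have unorm : ∀ z ∈ D.gen s, ∀ c, ∃ c', z * u c = u c' * z := by
    intro z hz
    induction hz using Submonoid.closure_induction with
    | one => exact fun c => ⟨c, by simp⟩
    | mul g h _ _ ihg ihh =>
      intro c
      obtain ⟨c1, e1⟩ := ihh c
      obtain ⟨c2, e2⟩ := ihg c1
      exact ⟨c2, by rw [mul_assoc, e1, ← mul_assoc, e2, mul_assoc]⟩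
    | mem z hz =>
      refine pi_ind ⟨0, by simp [u0]⟩ ?_ ?_
      · intro k r
        by_cases hk : k ∈ s
        · rw [us k hk]
          rcases hz with ⟨i, hi, j, hj, h, b, rfl⟩ | ht
          · by_cases hik : i = k
            · subst hik
              refine ⟨Pi.single j (-(r * b)) + Pi.single i r, ?_⟩
              have e1 := D.x_comm a i j (hne i hi).symm h (hne j hj).symm r b
              rw [uadd, us i hi, us j hj]
              have e2 : D.x a j (-(r * b)) * D.x a j (r * b) = 1 := by
                rw [← D.x_add _ _ (hne j hj).symm, neg_add_cancel, D.x_zero (hne j hj).symm]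
              have e3 := D.x_commute a j a i (hne j hj).symm (hne i hi).symm (hne j hj)
                (hne i hi).symm
              calc _ = (D.x a j (-(r * b)) * D.x a j (r * b)) * (D.x i j b * D.x a i r) := by
                    rw [e2, one_mul]
                _ = _ := by
                    rw [mul_assoc, ← mul_assoc (D.x a j (r * b)), ← e1, mul_assoc]
            · refine ⟨Pi.single k r, ?_⟩
              rw [us k hk, D.x_commute a k i j (hne k hk).symm h (Ne.symm hik) (hne j hj).symm]
          · obtain ⟨b, hb⟩ := D.T_norm z ht a k (hne k hk).symm r
            exact ⟨Pi.single k b, by rw [hb, us k hk]⟩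
        · exact ⟨0, by rw [us' k hk, u0]; simp⟩
      · rintro c c' ⟨c1, e1⟩ ⟨c2, e2⟩
        exact ⟨c1 + c2, by rw [uadd, uadd, ← mul_assoc, e1, mul_assoc, e2, mul_assoc]⟩
  -- passing x a i through l c, c i = 0
  have pass : ∀ i ∈ s, ∀ b, ∀ c : Fin d → K, c i = 0 →
      ∃ c', ∃ γ ∈ D.gen s, D.x a i b * l c = l c' * γ * D.x a i b := by
    intro i hi b
    have H : ∀ c : Fin d → K, ∃ c', ∃ γ ∈ D.gen s,
        D.x a i b * l (Function.update c i 0) = l c' * γ * D.x a i b := by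
      refine pi_ind ⟨0, 1, one_mem _, ?_⟩ ?_ ?_
      · have : Function.update (0 : Fin d → K) i 0 = 0 := by simp
        rw [this, l0]; simp
      · intro k r
        by_cases hki : k = i
        · subst hki
          refine ⟨0, 1, one_mem _, ?_⟩
          have : Function.update (Pi.single k r : Fin d → K) k 0 = 0 := by
            ext j; by_cases h : j = k
            · subst h; simp
            · simp [h]
          rw [this, l0]; simp
        · have : Function.update (Pi.single k r : Fin d → K) i 0 = Pi.single k r := by
            ext j; by_cases h : j = i
            · subst h; simp [Ne.symm hki]
            · simp [h]
          rw [this]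
          by_cases hk : k ∈ s
          · refine ⟨Pi.single k r, D.x k i (-(r * b)), D.x_mem hk hi hki _, ?_⟩
            rw [ls k hk]
            have e1 := D.x_comm k a i (hne k hk) (hne i hi).symm hki r b
            have e2 : D.x k i (-(r * b)) * D.x k i (r * b) = 1 := by
              rw [← D.x_add _ _ hki, neg_add_cancel, D.x_zero hki]
            have e3 := D.x_commute k a k i (hne k hk) hki (hne k hk).symm hki r (-(r * b))
            rw [e3, mul_assoc, e1, ← mul_assoc, ← mul_assoc, e2, one_mul]
          · refine ⟨0, 1, one_mem _, ?_⟩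
            rw [ls' k hk, l0]; simp
      · rintro c c' ⟨c1, γ1, h1, e1⟩ ⟨c2, γ2, h2, e2⟩
        have : Function.update (c + c') i 0 = Function.update c i 0 + Function.update c' i 0 := by
          ext j; by_cases h : j = i
          · subst h; simp
          · simp [h]
        obtain ⟨c3, e3⟩ := lnorm γ1 h1 c2
        refine ⟨c1 + c3, γ1 * γ2, mul_mem h1 h2, ?_⟩
        rw [this, ladd, ← mul_assoc, e1, mul_assoc, e2, ladd]
        simp only [← mul_assoc]
        rw [mul_assoc (l c1) γ1, e3]
        simp only [mul_assoc]
    intro c hc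
    have := H c
    rwa [show Function.update c i 0 = c by rw [← hc, Function.update_eq_self]] at this
  let 𝒟 : Set Γ := {y | ∃ c b, ∃ γ ∈ D.gen s, y = l c * u b * γ}
  have colD : ∀ c b, ∀ γ ∈ D.gen s, ∃ t : K, t ≠ 0 ∧
      mx (D.π (l c * u b * γ)) *ᵥ Pi.single a 1 = t • (Pi.single a 1 + cv c) := by
    intro c b γ hγ
    obtain ⟨t, ht, h1, _⟩ := D.gen_diag ha hγ
    refine ⟨t, ht, ?_⟩
    rw [map_mul, map_mul, mx_mul, mx_mul, ← mulVec_mulVec, ← mulVec_mulVec, h1, mulVec_smul,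
      mulVec_smul, umx, lmx]
    have e1 : (1 + vecMulVec (Pi.single a 1) (cv b)) *ᵥ Pi.single a 1 = Pi.single a 1 := by
      rw [add_mulVec, one_mulVec, vecMulVec_mulVec]; simp [cva]
    rw [e1, add_mulVec, one_mulVec, vecMulVec_mulVec]
    simp
  have stepD : ∀ z ∈ ({g | ∃ i ∈ insert a s, ∃ j ∈ insert a s, i ≠ j ∧ ∃ r, g = D.x i j r} ∪
      D.T : Set Γ), ∀ y ∈ 𝒟, mx (D.π (z * y)) a a ≠ 0 → z * y ∈ 𝒟 := by
    have easy : ∀ z ∈ D.gen s, ∀ y ∈ 𝒟, z * y ∈ 𝒟 := by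
      rintro z hz _ ⟨c, b, γ, hγ, rfl⟩
      obtain ⟨c', e1⟩ := lnorm z hz c
      obtain ⟨b', e2⟩ := unorm z hz b
      refine ⟨c', b', z * γ, mul_mem hz hγ, ?_⟩
      rw [← mul_assoc, ← mul_assoc, e1, mul_assoc (l c'), e2]
      simp only [mul_assoc]
    have easyl : ∀ c', ∀ y ∈ 𝒟, l c' * y ∈ 𝒟 := by
      rintro c' _ ⟨c, b, γ, hγ, rfl⟩
      exact ⟨c' + c, b, γ, hγ, by rw [ladd]; simp only [mul_assoc]⟩
    rintro z (⟨i, hi, j, hj, hij, r, rfl⟩ | hz) y hy hne0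
    · rcases Finset.mem_insert.1 hi with rfl | hi
      · rcases Finset.mem_insert.1 hj with rfl | hj
        · exact absurd rfl hij
        · obtain ⟨c, b, γ, hγ, rfl⟩ := hy
          obtain ⟨t, ht, hcol⟩ := colD c b γ hγ
          have hnz : 1 + r * c j ≠ 0 := by
            intro h0
            apply hne0
            have : mx (D.π (D.x i j r * (l c * u b * γ))) *ᵥ Pi.single i 1 =
                mx (D.π (D.x i j r)) *ᵥ (t • (Pi.single i 1 + cv c)) := by
              rw [map_mul, mx_mul, ← mulVec_mulVec, hcol]
            have := congrFun this i
            rw [D.π_x i j hij, elem_mulVec, if_pos rfl] at this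
            simp only [mulVec_single_one, col_apply] at this
            rw [this]
            simp [cva, hij.symm, cv, hj]
            linear_combination t * h0
          obtain ⟨t', ht', b', c', e⟩ := D.rank i j hij r (c j) hnz
          have hc : l c = D.x j i (c j) * l (c - Pi.single j (c j)) := by
            rw [← ls j hj, ← ladd]; congr 1; abel
          obtain ⟨c2, γ2, hγ2, e2⟩ := pass j hj b' (c - Pi.single j (c j)) (by simp)
          have : D.x i j r * (l c * u b * γ) =
              l (Pi.single j c') * (t' * (l c2 * (γ2 * (u (Pi.single j b' + b) * γ)))) := by
            rw [ls j hj, uadd, us j hj, hc]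
            calc _ = (D.x i j r * D.x j i (c j)) * l (c - Pi.single j (c j)) * u b * γ := by
                  simp only [mul_assoc]
              _ = D.x j i c' * t' * (D.x i j b' * l (c - Pi.single j (c j))) * u b * γ := by
                  rw [e]; simp only [mul_assoc]
              _ = _ := by rw [e2]; simp only [mul_assoc]
          rw [this]
          exact easyl _ _ (easy _ (D.T_mem ht') _ (easyl _ _ (easy _ hγ2 _
            ⟨0, _, γ, hγ, by rw [l0, one_mul]⟩)))
      · rcases Finset.mem_insert.1 hj with rfl | hj
        · rw [← ls i (by assumption)]; exact easyl _ _ hy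
        · exact easy _ (D.x_mem (by assumption) (by assumption) hij r) _ hy
    · exact easy _ (D.T_mem hz) _ hy
  -- generic vector
  let w : K → Fin d → K := fun τ i => τ ^ (i : ℕ) / τ ^ (a : ℕ)
  have key : ∀ g ∈ D.gen (insert a s), ∃ P : Polynomial K, P ≠ 0 ∧ ∀ τ, P.eval τ ≠ 0 →
      g * l (w τ) ∈ 𝒟 := by
    intro g hg
    have : g ∈ D.gen (insert a s) ∧ ∃ P : Polynomial K, P ≠ 0 ∧ ∀ τ, P.eval τ ≠ 0 →
      g * l (w τ) ∈ 𝒟 := by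
      unfold gen at hg
      induction hg using Submonoid.closure_induction_left with
      | one => exact ⟨one_mem _, 1, one_ne_zero, fun τ _ => ⟨w τ, 0, 1, one_mem _, by simp [u0]⟩⟩
      | mul_left z hz g hg ih =>
        obtain ⟨hgm, P, hP, hPτ⟩ := ih
        have hzg : z * g ∈ D.gen (insert a s) := mul_mem (Submonoid.subset_closure hz) hgm
        refine ⟨hzg, ?_⟩
        let M := mx (D.π (z * g))
        let Q : Polynomial K := ∑ i : Fin d, Polynomial.C (M a i) * Polynomial.X ^ (i : ℕ)
        have hQ : Q ≠ 0 := by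
          intro hQ
          have hrow : ∀ i, M a i = 0 := by
            intro i
            have := congrArg (fun p => Polynomial.coeff p (i : ℕ)) hQ
            simp only [Q, Polynomial.finset_sum_coeff, Polynomial.coeff_C_mul,
              Polynomial.coeff_X_pow, Polynomial.coeff_zero] at this
            rw [Finset.sum_eq_single i] at this
            · simpa using this
            · intro b _ hb
              have : (i : ℕ) ≠ (b : ℕ) := fun e => hb (Fin.ext e.symm)
              simp [this]
            · simp
          have hdet : M.det = 1 := mx_det _
          rw [Matrix.det_eq_zero_of_row_eq_zero a hrow] at hdet
          exact zero_ne_one hdet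
        refine ⟨P * Q * Polynomial.X, mul_ne_zero (mul_ne_zero hP hQ) Polynomial.X_ne_zero, ?_⟩
        intro τ hτ
        simp only [Polynomial.eval_mul, Polynomial.eval_X, mul_ne_zero_iff] at hτ
        obtain ⟨⟨h1, h2⟩, h3⟩ := hτ
        rw [mul_assoc]
        apply stepD z hz _ (hPτ τ h1)
        rw [← mul_assoc, map_mul, mx_mul, lmx, mul_add, mul_one, Matrix.add_apply, mul_vecMulVec,
          vecMulVec_apply, Pi.single_eq_same, mul_one]
        have hM : M a a + (M *ᵥ cv (w τ)) a = Q.eval τ / τ ^ (a : ℕ) := by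
          have : (M *ᵥ cv (w τ)) a = ∑ i, M a i * (if i = a then 0 else w τ i) := by
            simp only [mulVec, dotProduct]
            refine Finset.sum_congr rfl fun i _ => ?_
            by_cases hia : i = a
            · subst hia; simp [cva]
            · by_cases his : i ∈ s
              · simp [hia, cv, his]
              · have : M a i = 0 := D.gen_row (Finset.mem_insert_self _ _)
                  (by simp [hia, his]) hzg
                simp [this]
          rw [this, Polynomial.eval_finset_sum, Finset.sum_div,
            ← Finset.add_sum_erase _ _ (Finset.mem_univ a),
            ← Finset.add_sum_erase Finset.univ _ (Finset.mem_univ a)]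
          simp only [if_true, mul_zero, zero_add, Polynomial.eval_mul, Polynomial.eval_C,
            Polynomial.eval_pow, Polynomial.eval_X]
          congr 1
          · field_simp
          · refine Finset.sum_congr rfl fun i hi => ?_
            rw [if_neg (Finset.ne_of_mem_erase hi), mul_div_assoc]
        change M a a + (M *ᵥ cv (w τ)) a ≠ 0
        rw [hM]
        exact div_ne_zero h2 (pow_ne_zero _ h3)
    exact this.2
  -- conclusion
  intro g hg hπ
  obtain ⟨P, hP, hPτ⟩ := key g hg
  obtain ⟨τ, hτ⟩ : ∃ τ, P.eval τ ≠ 0 := by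
    by_contra hcon
    push Not at hcon
    exact hP (Polynomial.funext (by simpa using hcon))
  obtain ⟨c, b, γ, hγ, e⟩ := hPτ τ hτ
  obtain ⟨t, ht, hcol⟩ := colD c b γ hγ
  have hl : mx (D.π (l c * u b * γ)) = mx (D.π (l (w τ))) := by rw [← e, map_mul, hπ, one_mul]
  rw [hl, lmx, add_mulVec, one_mulVec, vecMulVec_mulVec] at hcol
  simp only [dotProduct_single_one, Pi.single_eq_same, MulOpposite.op_one, one_smul] at hcol
  have ht1 : t = 1 := by
    have := congrFun hcol a
    simpa [cva] using this.symm
  subst ht1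
  have hcv : cv (w τ) = cv c := by simpa using hcol
  have lcv : ∀ c, l c = l (cv c) := by
    refine pi_ind ?_ ?_ ?_
    · congr 1; ext i; simp [cv]
    · intro i r
      by_cases hi : i ∈ s
      · rw [cvs i hi]
      · rw [cvs' i hi, ls' i hi, l0]
    · intro c c' h h'; rw [cvadd, ladd, ladd, h, h']
  have ucv : ∀ c, u c = u (cv c) := by
    refine pi_ind ?_ ?_ ?_
    · congr 1; ext i; simp [cv]
    · intro i r
      by_cases hi : i ∈ s
      · rw [cvs i hi]
      · rw [cvs' i hi, us' i hi, u0]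
    · intro c c' h h'; rw [cvadd, uadd, uadd, h, h']
  have hlc : l c = l (w τ) := by rw [lcv c, ← hcv, ← lcv]
  have h1 : D.π (u b * γ) = 1 := by
    have := mx_inj hl
    rw [mul_assoc, map_mul, hlc] at this
    exact mul_eq_left.1 this
  obtain ⟨t, ht, _, h2⟩ := D.gen_diag ha hγ
  have h3 : (Pi.single a 1 + cv b) ᵥ* mx (D.π γ) = Pi.single a 1 := by
    have := congrArg (fun M => Pi.single a 1 ᵥ* mx M) h1
    simp only [map_mul, mx_mul, mx_one, vecMul_one, ← vecMul_vecMul] at this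
    rw [umx, vecMul_add, vecMul_one, vecMul_vecMulVec] at this
    simpa using this
  have h4 : Pi.single a 1 + cv b = t⁻¹ • Pi.single a (1 : K) := by
    have h5 : (t⁻¹ • Pi.single a (1 : K)) ᵥ* mx (D.π γ) = Pi.single a 1 := by
      rw [smul_vecMul, h2, smul_smul, inv_mul_cancel₀ ht, one_smul]
    have := congrArg (fun v => v ᵥ* mx (D.π γ)⁻¹) (h3.trans h5.symm)
    simpa only [vecMul_vecMul, mx_mul_inv, vecMul_one] using this
  have hb : cv b = 0 := by
    ext i
    by_cases hi : i = a
    · subst hi; exact cva b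
    · have := congrFun h4 i
      simpa [hi] using this
  have hub : u b = 1 := by rw [ucv, hb, u0]
  rw [hub, one_mul] at h1
  have hγ1 := ih γ hγ h1
  rw [hub, hγ1, mul_one, mul_one, hlc] at e
  exact mul_eq_right.1 e

theorem inj [Infinite K] (s : Finset (Fin d)) : ∀ g ∈ D.gen s, D.π g = 1 → g = 1 := by
  classical
  induction s using Finset.induction_on with
  | empty =>
    intro g hg
    have : g ∈ D.T := by
      have h : D.gen ∅ ≤ D.T.toSubmonoid := by
        refine Submonoid.closure_le.2 ?_
        rintro z (⟨i, hi, _⟩ | hz)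
        · simp at hi
        · exact hz
      exact h hg
    exact D.T_inj g this
  | insert a s ha ih => exact D.inj_step s a ha ih

end SteinData
end P4

open Matrix

section P5
variable {d : ℕ} {A : Type*} [CommRing A]

lemma mx_ext_vec {g h : SLd d A} (H : ∀ v, mx g *ᵥ v = mx h *ᵥ v) : g = h := by
  apply mx_inj
  ext i j
  have := congrFun (H (Pi.single j 1)) i
  simpa using this

/-- `diag(u at i, u⁻¹ at j)` -/
def hh (i j : Fin d) (h : i ≠ j) (u : Aˣ) : SLd d A :=
  ⟨diagonal (fun k => if k = i then (u : A) else if k = j then ((u⁻¹ : Aˣ) : A) else 1), by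
    rw [det_diagonal, Finset.prod_eq_mul i j h]
    · simp [h.symm]
    · intro c _ hc; simp [hc.1, hc.2]
    · simp
    · simp⟩

lemma hh_mulVec (i j : Fin d) (h : i ≠ j) (u : Aˣ) (v : Fin d → A) (k : Fin d) :
    (mx (hh i j h u) *ᵥ v) k =
      (if k = i then (u : A) else if k = j then ((u⁻¹ : Aˣ) : A) else 1) * v k := by
  unfold hh
  rw [mx_mk, mulVec_diagonal]

lemma rank1 (i j : Fin d) (h : i ≠ j) (B C : A) (U : Aˣ) (hU : (U : A) = 1 + B * C) :
    elem i j h B * elem j i h.symm C =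
      elem j i h.symm (C * (U⁻¹ : Aˣ)) * hh i j h U * elem i j h (B * (U⁻¹ : Aˣ)) := by
  apply mx_ext_vec
  intro v
  ext k
  simp only [mx_mul, ← mulVec_mulVec, elem_mulVec, hh_mulVec]
  have hu := U.mul_inv
  by_cases hki : k = i
  · subst hki
    simp only [if_true, h, h.symm, if_false]
    simp only [hU] at hu ⊢
    linear_combination (-B * v j) * hu
  · by_cases hkj : k = j
    · subst hkj
      simp only [if_true, h, h.symm, if_false]
      rw [hU] at hu ⊢
      linear_combination (- C * v i - C * B * (U⁻¹ : Aˣ) * v k - v k) * hu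
    · simp [hki, hkj]

lemma hh_eq (i j : Fin d) (h : i ≠ j) (u : Aˣ) :
    hh i j h u = elem i j h (u : A) * elem j i h.symm (-((u⁻¹ : Aˣ) : A)) * elem i j h (u : A) *
      elem i j h (-1) * elem j i h.symm 1 * elem i j h (-1) := by
  apply mx_ext_vec
  intro v
  ext k
  simp only [mx_mul, ← mulVec_mulVec, elem_mulVec, hh_mulVec]
  have hu := u.mul_inv
  by_cases hki : k = i
  · subst hki
    simp only [if_true, h, h.symm, if_false]
    linear_combination (u * v k - v j) * hu
  · by_cases hkj : k = j
    · subst hkj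
      simp only [if_true, h, h.symm, if_false]
      linear_combination (v i) * hu
    · simp [hki, hkj]

lemma hh_mem_EE (i j : Fin d) (h : i ≠ j) (u : Aˣ) : hh i j h u ∈ EE d A := by
  rw [hh_eq]
  exact mul_mem (mul_mem (mul_mem (mul_mem (mul_mem (elem_mem_EE _ _ _ _) (elem_mem_EE _ _ _ _))
    (elem_mem_EE _ _ _ _)) (elem_mem_EE _ _ _ _)) (elem_mem_EE _ _ _ _)) (elem_mem_EE _ _ _ _)

/-- diagonal subgroup -/
def DG (d : ℕ) (A : Type*) [CommRing A] : Subgroup (SLd d A) where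
  carrier := {g | ∃ u : Fin d → Aˣ, mx g = diagonal (fun i => (u i : A))}
  one_mem' := ⟨fun _ => 1, by rw [mx_one]; simp⟩
  mul_mem' := by
    rintro x y ⟨u, hu⟩ ⟨w, hw⟩
    exact ⟨fun i => u i * w i, by rw [mx_mul, hu, hw, diagonal_mul_diagonal]; simp⟩
  inv_mem' := by
    rintro x ⟨u, hu⟩
    refine ⟨fun i => (u i)⁻¹, ?_⟩
    have h1 : mx x * diagonal (fun i => (((u i)⁻¹ : Aˣ) : A)) = 1 := by
      rw [hu, diagonal_mul_diagonal]; simp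
    calc mx x⁻¹ = mx x⁻¹ * (mx x * diagonal (fun i => (((u i)⁻¹ : Aˣ) : A))) := by
          rw [h1, mul_one]
      _ = _ := by rw [← mul_assoc, mx_inv_mul, one_mul]

lemma hh_mem_DG (i j : Fin d) (h : i ≠ j) (u : Aˣ) : hh i j h u ∈ DG d A := by
  refine ⟨fun k => if k = i then u else if k = j then u⁻¹ else 1, ?_⟩
  unfold hh
  rw [mx_mk]
  congr 1
  ext k
  by_cases hk : k = i
  · simp [hk]
  · by_cases hk' : k = j
    · simp [hk, hk', h.symm]
    · simp [hk, hk']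

lemma diag_conj {g : SLd d A} {u : Fin d → Aˣ} (hu : mx g = diagonal (fun i => (u i : A)))
    (i j : Fin d) (h : i ≠ j) (r : A) :
    g * elem i j h r = elem i j h (u i * r * ((u j)⁻¹ : Aˣ)) * g := by
  apply mx_ext_vec
  intro v
  ext k
  simp only [mx_mul, ← mulVec_mulVec, elem_mulVec, hu, mulVec_diagonal]
  by_cases hk : k = i
  · subst hk
    simp only [if_true]
    have := (u j).inv_mul
    linear_combination (- u k * r * v j) * this
  · simp [hk]

variable {K : Type*} [Field K] [Infinite K]

set_option maxHeartbeats 1000000 in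
theorem rel_kernel (red : A →+* K) (hsurj : ∀ c, ∃ a, red a = c)
    (hunit : ∀ c, c ≠ 0 → ∃ a : Aˣ, red a = c) (N : Subgroup (SLd d A))
    (hN : RelN N (RingHom.ker red)) (hNred : ∀ x ∈ N, mapSL red x = 1)
    {ε : SLd d A} (hε : ε ∈ EE d A) (h1 : mapSL red ε = 1) : ε ∈ N := by
  classical
  let N' : Subgroup (EE d A) := N.subgroupOf (EE d A)
  haveI : N'.Normal := ⟨by
    rintro ⟨n, hn⟩ hnN ⟨g, hg⟩
    exact hN.conj g hg n hnN⟩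
  let Γ := (EE d A) ⧸ N'
  let q : EE d A →* Γ := QuotientGroup.mk' N'
  have qone : ∀ g : EE d A, q g = 1 ↔ (g : SLd d A) ∈ N := fun g => by
    rw [← MonoidHom.mem_ker, QuotientGroup.ker_mk']; rfl
  let el : ∀ i j : Fin d, i ≠ j → A → EE d A := fun i j h r => ⟨elem i j h r, elem_mem_EE i j h r⟩
  have el_add : ∀ i j h r r', el i j h (r + r') = el i j h r * el i j h r' := fun i j h r r' =>
    Subtype.ext (elem_add i j h r r')
  have qel : ∀ i j h r r', red r = red r' → q (el i j h r) = q (el i j h r') := by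
    intro i j h r r' e
    have : q (el i j h (r - r')) = 1 := by
      rw [qone]
      exact hN.mem i j h _ (by rw [RingHom.mem_ker, map_sub, e, sub_self])
    have h2 := el_add i j h (r - r') r'
    rw [sub_add_cancel] at h2
    rw [h2, map_mul, this, one_mul]
  choose sec hsec using hsurj
  let X : Fin d → Fin d → K → Γ := fun i j c => if h : i ≠ j then q (el i j h (sec c)) else 1
  have Xel : ∀ i j (h : i ≠ j) r, q (el i j h r) = X i j (red r) := by
    intro i j h r
    simp only [X, dif_pos h]
    exact qel i j h _ _ (hsec _).symm
  have hhq : ∀ i j (h : i ≠ j) (u : Aˣ), red u = 1 → hh i j h u ∈ N := by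
    intro i j h u hu
    have e : ∀ u : Aˣ, q ⟨hh i j h u, hh_mem_EE i j h u⟩ =
      X i j (red (u : A)) * X j i (red (-((u⁻¹ : Aˣ) : A))) * X i j (red (u : A)) *
      X i j (red (-1)) * X j i (red 1) * X i j (red (-1)) := by
      intro u
      rw [← Xel i j h, ← Xel j i h.symm, ← Xel i j h, ← Xel j i h.symm, ← map_mul, ← map_mul,
        ← map_mul, ← map_mul, ← map_mul]
      exact congrArg q (Subtype.ext (hh_eq i j h u))
    have hu' : red ((u⁻¹ : Aˣ) : A) = 1 := by
      have := congrArg red u.mul_inv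
      rwa [map_mul, hu, one_mul, map_one] at this
    have : q ⟨hh i j h u, hh_mem_EE i j h u⟩ = q ⟨hh i j h 1, hh_mem_EE i j h 1⟩ := by
      rw [e u, e 1, map_neg, hu', hu, Units.val_one, inv_one, Units.val_one, map_neg, map_one]
    have e2 : hh i j h (1 : Aˣ) = 1 := by
      apply mx_ext_vec; intro v; ext k; rw [hh_mulVec, mx_one, one_mulVec]; simp
    have h3 : q ⟨hh i j h 1, hh_mem_EE i j h 1⟩ = 1 := by
      rw [qone]; change hh i j h 1 ∈ N; rw [e2]; exact one_mem _
    rw [h3, qone] at this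
    exact this
  have hdiag : ∀ (s : Finset (Fin d)) (g : SLd d A) (u : Fin d → Aˣ),
      mx g = diagonal (fun i => (u i : A)) → (∀ i, red (u i) = 1) → (∀ i ∉ s, u i = 1) →
      g ∈ N := by
    intro s
    induction s using Finset.induction_on with
    | empty =>
      intro g u hu _ h
      have : g = 1 := by
        apply mx_inj; rw [hu, mx_one, ← diagonal_one]; congr 1; ext i; rw [h i (by simp)]; simp
      rw [this]; exact one_mem _
    | insert a s ha ih =>
      intro g u hu hr h
      rcases s.eq_empty_or_nonempty with rfl | ⟨b, hb⟩
      · refine ih g u hu hr fun i _ => ?_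
        by_cases hi : i = a
        · subst hi
          have hdet := mx_det g
          rw [hu, det_diagonal, Finset.prod_eq_single i] at hdet
          · exact Units.ext hdet
          · intro b _ hb; rw [h b (by simp [hb])]; simp
          · simp
        · exact h i (by simp [hi])
      · have hab : a ≠ b := fun e => ha (e ▸ hb)
        have : hh a b hab (u a)⁻¹ * g ∈ N := by
          refine ih _ (fun k => (if k = a then (u a)⁻¹ else if k = b then (u a) else 1) * u k)
            ?_ ?_ ?_
          · rw [mx_mul, hu]; unfold hh
            rw [mx_mk, diagonal_mul_diagonal]
            congr 1; ext k
            by_cases hka : k = a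
            · simp [hka]
            · by_cases hkb : k = b
              · simp [hka, hkb, hab.symm]
              · simp [hka, hkb]
          · intro k
            have hu' : red (((u a)⁻¹ : Aˣ) : A) = 1 := by
              have := congrArg red (u a).mul_inv
              rwa [map_mul, hr, one_mul, map_one] at this
            rw [Units.val_mul, map_mul, hr, mul_one]
            split_ifs
            · exact hu'
            · exact hr a
            · simp
          · intro k hk
            by_cases hka : k = a
            · subst hka; simp
            · have hkb : k ≠ b := fun e => hk (e ▸ hb)
              rw [if_neg hka, if_neg hkb, h k (by simp [hka, hk]), one_mul]
        have h2 : hh a b hab (u a)⁻¹ ∈ N := hhq a b hab _ (by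
          have := congrArg red (u a).mul_inv
          rwa [map_mul, hr, one_mul, map_one] at this)
        exact (Subgroup.mul_mem_cancel_left N h2).1 this
  let π : Γ →* SLd d K := QuotientGroup.lift N' ((mapSL red).comp (EE d A).subtype) (by
    rintro ⟨n, hn⟩ hnN
    exact hNred n hnN)
  have πq : ∀ g, π (q g) = mapSL red (g : SLd d A) := fun g => rfl
  have qsurj : ∀ y : Γ, ∃ g, q g = y := QuotientGroup.mk'_surjective N'
  let D : SteinData d K Γ :=
    { π := π
      x := X
      T := ((DG d A).subgroupOf (EE d A)).map q
      x_add := by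
        intro i j h a b
        rw [← hsec a, ← hsec b, ← map_add, ← Xel i j h, ← Xel i j h, ← Xel i j h, el_add, map_mul]
      x_comm := by
        intro i j k hij hjk hik a b
        rw [← hsec a, ← hsec b, ← map_mul, ← Xel i j hij, ← Xel j k hjk, ← Xel i k hik,
          ← map_mul, ← map_mul, ← map_mul]
        congr 1
        exact Subtype.ext (elem_comm i j k hij hjk hik _ _)
      x_commute := by
        intro i j k l hij hkl hjk hil a b
        rw [← hsec a, ← hsec b, ← Xel i j hij, ← Xel k l hkl, ← map_mul, ← map_mul]
        congr 1
        exact Subtype.ext (elem_commute i j k l hij hkl hjk hil _ _)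
      π_x := by
        intro i j h a
        rw [← hsec a, ← Xel i j h, πq, map_elem]
      T_diag := by
        rintro _ ⟨⟨g, hg⟩, ⟨u, hu⟩, rfl⟩
        refine ⟨fun i => red (u i), fun i => ((u i).isUnit.map red).ne_zero, ?_⟩
        rw [πq, mx_map]
        change (mx g).map red = _
        have hu : mx g = _ := hu
        rw [hu, diagonal_map (map_zero red)]
      T_norm := by
        rintro _ ⟨⟨g, hg⟩, ⟨u, hu⟩, rfl⟩ i j h a
        refine ⟨red (u i * sec a * ((u j)⁻¹ : Aˣ)), ?_⟩
        rw [← hsec a, ← Xel i j h, ← Xel i j h, hsec a, ← map_mul, ← map_mul]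
        congr 1
        exact Subtype.ext (diag_conj hu i j h _)
      T_inj := by
        rintro _ ⟨⟨g, hg⟩, ⟨u, hu⟩, rfl⟩ h
        rw [qone]
        have hu : mx g = _ := hu
        refine hdiag Finset.univ g u hu (fun i => ?_) (by simp)
        rw [πq] at h
        have := congrArg (fun y => mx y i i) h
        simp only [mx_map, mx_one, map_apply, one_apply_eq] at this
        rw [hu, diagonal_apply_eq] at this
        exact this
      rank := by
        intro i j h b c hbc
        by_cases hc : c = 0
        · subst hc
          refine ⟨1, one_mem _, b, 0, ?_⟩
          rw [mul_one]
          have : X j i 0 = 1 := by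
            rw [← map_zero red, ← Xel j i h.symm, qone]
            change elem j i h.symm 0 ∈ N
            rw [elem_zero]; exact one_mem _
          rw [this, one_mul, mul_one]
        · obtain ⟨U, hU⟩ := hunit _ hbc
          obtain ⟨C, hC⟩ := hunit c hc
          have hB : red (((U : A) - 1) * ((C⁻¹ : Aˣ) : A)) = b := by
            have : red ((C⁻¹ : Aˣ) : A) * c = 1 := by
              rw [← hC, ← map_mul, C.inv_mul, map_one]
            rw [map_mul, map_sub, hU, map_one]
            linear_combination b * this
          have key := rank1 i j h (((U : A) - 1) * ((C⁻¹ : Aˣ) : A)) C U (by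
            rw [mul_assoc, C.inv_mul]; ring)
          refine ⟨q ⟨hh i j h U, hh_mem_EE i j h U⟩, ⟨_, hh_mem_DG i j h U, rfl⟩,
            red (((U : A) - 1) * ((C⁻¹ : Aˣ) : A) * ((U⁻¹ : Aˣ) : A)), red (C * (U⁻¹ : Aˣ)), ?_⟩
          rw [← hC, ← hB, ← Xel i j h, ← Xel i j h, ← Xel j i h.symm, ← Xel j i h.symm,
            ← map_mul, ← map_mul, ← map_mul]
          congr 1
          exact Subtype.ext key }
  have hgen : ∀ g : EE d A, q g ∈ D.gen Finset.univ := by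
    rintro ⟨g, hg⟩
    let S0 : Set (SLd d A) := {g | ∃ (i j : Fin d) (h : i ≠ j) (r : A), g = elem i j h r}
    have hg' : g ∈ Submonoid.closure (S0 ∪ S0⁻¹) := by
      rw [← Subgroup.closure_toSubmonoid]; exact hg
    suffices this : ∃ hg : g ∈ EE d A, q ⟨g, hg⟩ ∈ D.gen Finset.univ by exact this.choose_spec
    clear hg
    have : ∃ hg : g ∈ EE d A, q ⟨g, hg⟩ ∈ D.gen Finset.univ := by
      induction hg' using Submonoid.closure_induction with
      | one => exact ⟨one_mem _, by
          have : (⟨1, one_mem _⟩ : EE d A) = 1 := rfl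
          rw [this, map_one]; exact one_mem _⟩
      | mul a b _ _ iha ihb =>
        obtain ⟨ha', h1⟩ := iha
        obtain ⟨hb', h2⟩ := ihb
        refine ⟨mul_mem ha' hb', ?_⟩
        have : (⟨a * b, mul_mem ha' hb'⟩ : EE d A) = ⟨a, ha'⟩ * ⟨b, hb'⟩ := rfl
        rw [this, map_mul]
        exact mul_mem h1 h2
      | mem a ha =>
        rcases ha with ⟨i, j, h, r, rfl⟩ | ha
        · refine ⟨elem_mem_EE _ _ _ _, ?_⟩
          have := D.x_mem (Finset.mem_univ i) (Finset.mem_univ j) h (red r)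
          exact (Xel i j h r) ▸ this
        · obtain ⟨i, j, h, r, e⟩ := ha
          have e : a = elem i j h (-r) := by rw [elem_neg, ← e, inv_inv]
          subst e
          refine ⟨elem_mem_EE _ _ _ _, ?_⟩
          have := D.x_mem (Finset.mem_univ i) (Finset.mem_univ j) h (red (-r))
          exact (Xel i j h (-r)) ▸ this
    exact this
  have := D.inj Finset.univ (q ⟨ε, hε⟩) (hgen _) (by
    change π (q ⟨ε, hε⟩) = 1
    rw [πq]; exact h1)
  rw [qone] at this
  exact this

end P5

open Matrix

namespace Lau
section basics
variable (A : Type*) [CommRing A]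

/-- power series into Laurent series -/
noncomputable def iS : PowerSeries A →+* LaurentSeries A := HahnSeries.ofPowerSeries ℤ A

/-- the unit `s⁻¹` -/
noncomputable def xi : (LaurentSeries A)ˣ where
  val := HahnSeries.single (-1) 1
  inv := HahnSeries.single 1 1
  val_inv := by simp [HahnSeries.single_mul_single]
  inv_val := by simp [HahnSeries.single_mul_single]

/-- polynomials in `s⁻¹` into Laurent series -/
noncomputable def iP : Polynomial A →+* LaurentSeries A :=
  Polynomial.eval₂RingHom ((iS A).comp (PowerSeries.C)) (xi A : LaurentSeries A)

variable {A}

lemma iS_inj : Function.Injective (iS A) := HahnSeries.ofPowerSeries_injective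

lemma iS_X : iS A PowerSeries.X = (((xi A)⁻¹ : (LaurentSeries A)ˣ) : LaurentSeries A) :=
  HahnSeries.ofPowerSeries_X

lemma iP_X : iP A Polynomial.X = (xi A : LaurentSeries A) := by simp [iP]
lemma iP_C (a : A) : iP A (Polynomial.C a) = iS A (PowerSeries.C a) := by simp [iP]

lemma exists_form (l : LaurentSeries A) :
    ∃ (N : ℕ) (f : PowerSeries A), l = (xi A : LaurentSeries A) ^ N * iS A f := by
  obtain ⟨⟨f, ⟨_, n, rfl⟩⟩, h⟩ :=
    IsLocalization.surj (M := Submonoid.powers (PowerSeries.X : PowerSeries A)) l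
  refine ⟨n, f, ?_⟩
  have h : l * (iS A (PowerSeries.X ^ n)) = iS A f := h
  rw [← h, map_pow, iS_X, mul_comm, mul_assoc, ← mul_pow]
  simp

/-- reversal of a polynomial of degree `≤ n` -/
noncomputable def revS (n : ℕ) (p : Polynomial A) : PowerSeries A :=
  ∑ i ∈ Finset.range (n+1), PowerSeries.C (p.coeff i) * PowerSeries.X ^ (n - i)

lemma iP_rev (p : Polynomial A) (n : ℕ) (hn : p.natDegree ≤ n) :
    (((xi A)⁻¹ : (LaurentSeries A)ˣ) : LaurentSeries A) ^ n * iP A p = iS A (revS n p) := by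
  conv_lhs => rw [p.as_sum_range' (n+1) (by omega)]
  rw [revS, map_sum, map_sum, Finset.mul_sum]
  refine Finset.sum_congr rfl fun i hi => ?_
  rw [← Polynomial.C_mul_X_pow_eq_monomial, map_mul, map_pow, iP_X, iP_C, map_mul, map_pow, iS_X]
  have hi : i ≤ n := by simpa [Nat.lt_succ_iff] using hi
  obtain ⟨j, rfl⟩ := Nat.exists_eq_add_of_le hi
  have : (((xi A)⁻¹ : (LaurentSeries A)ˣ) : LaurentSeries A) ^ i * (xi A : LaurentSeries A) ^ i = 1 := by
    rw [← mul_pow]; simp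
  rw [pow_add, Nat.add_sub_cancel_left]
  linear_combination (iS A (PowerSeries.C (p.coeff i)) *
    (((xi A)⁻¹ : (LaurentSeries A)ˣ) : LaurentSeries A) ^ j) * this

lemma coeff_revS (n : ℕ) (p : Polynomial A) (i : ℕ) (hi : i ≤ n) :
    PowerSeries.coeff (n - i) (revS n p) = p.coeff i := by
  rw [revS, map_sum, Finset.sum_eq_single i]
  · simp [PowerSeries.coeff_C_mul, PowerSeries.coeff_X_pow]
  · intro j hj hji
    have hj : j ≤ n := by simpa [Nat.lt_succ_iff] using hj
    rw [PowerSeries.coeff_C_mul, PowerSeries.coeff_X_pow, if_neg (by omega), mul_zero]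
  · intro h; exact absurd (by simpa [Nat.lt_succ_iff] using hi) h

lemma iP_eq_iS {p : Polynomial A} {f : PowerSeries A} (h : iP A p = iS A f) :
    p = Polynomial.C (p.coeff 0) := by
  have h1 := iP_rev p p.natDegree le_rfl
  rw [h, ← iS_X, ← map_pow, ← map_mul] at h1
  have h1 := iS_inj h1
  ext i
  rw [Polynomial.coeff_C]
  split_ifs with hi
  · rw [hi]
  · by_cases hn : i ≤ p.natDegree
    · rw [← coeff_revS p.natDegree p i hn, ← h1, PowerSeries.coeff_X_pow_mul', if_neg (by omega)]
    · exact Polynomial.coeff_eq_zero_of_natDegree_lt (by omega)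

lemma iP_inj : Function.Injective (iP A) := by
  rw [injective_iff_map_eq_zero]
  intro p hp
  have h := iP_eq_iS (p := p) (f := 0) (by rw [hp, map_zero])
  rw [h, iP_C] at hp
  have := iS_inj (hp.trans (map_zero _).symm)
  rw [h, show p.coeff 0 = 0 by simpa using congrArg (PowerSeries.coeff 0) this, Polynomial.C_0]

variable {B : Type*} [CommRing B]

/-- functoriality -/
noncomputable def mapL (f : A →+* B) : LaurentSeries A →+* LaurentSeries B :=
  IsLocalization.lift (M := Submonoid.powers (PowerSeries.X : PowerSeries A))
    (g := (iS B).comp (PowerSeries.map f)) (by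
      rintro ⟨_, n, rfl⟩
      simp only [RingHom.comp_apply, map_pow, PowerSeries.map_X, iS_X]
      exact (Units.isUnit _).pow n)

lemma mapL_iS (f : A →+* B) (g : PowerSeries A) : mapL f (iS A g) = iS B (PowerSeries.map f g) :=
  IsLocalization.lift_eq _ _

lemma mapL_xi (f : A →+* B) : mapL f (xi A : LaurentSeries A) = (xi B : LaurentSeries B) := by
  have h1 := mapL_iS f PowerSeries.X
  rw [PowerSeries.map_X, iS_X, iS_X] at h1
  have h2 : mapL f (xi A : LaurentSeries A) *
    mapL f (((xi A)⁻¹ : (LaurentSeries A)ˣ) : LaurentSeries A) = 1 := by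
    rw [← map_mul]; simp
  rw [h1] at h2
  rw [Units.mul_inv_eq_one] at h2
  exact h2

lemma mapL_iP (f : A →+* B) (p : Polynomial A) :
    mapL f (iP A p) = iP B (Polynomial.mapRingHom f p) := by
  have : (mapL f).comp (iP A) = (iP B).comp (Polynomial.mapRingHom f) := by
    refine Polynomial.ringHom_ext (fun p => ?_) ?_
    · simp [iP_C, mapL_iS]
    · simp [iP_X, mapL_xi]
  exact congrArg (fun g => g p) this

lemma mapL_surj (f : A →+* B) (hf : Function.Surjective f) : Function.Surjective (mapL f) := by
  intro l
  obtain ⟨N, g, rfl⟩ := exists_form l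
  obtain ⟨g', rfl⟩ := PowerSeries.map_surjective f hf g
  exact ⟨(xi A : LaurentSeries A) ^ N * iS A g', by rw [map_mul, map_pow, mapL_xi, mapL_iS]⟩

lemma mem_ker {f : A →+* B} {N : ℕ} {g : PowerSeries A}
    (h : mapL f ((xi A : LaurentSeries A) ^ N * iS A g) = 0) : PowerSeries.map f g = 0 := by
  rw [map_mul, map_pow, mapL_xi, mapL_iS, ← Units.val_pow_eq_pow_val, Units.mul_right_eq_zero] at h
  exact iS_inj (h.trans (map_zero _).symm)

lemma unit_lift [IsLocalRing A] (c : LaurentSeries (IsLocalRing.ResidueField A)) (hc : c ≠ 0) :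
    ∃ a : (LaurentSeries A)ˣ, mapL (IsLocalRing.residue A) (a : LaurentSeries A) = c := by
  obtain ⟨N, g, rfl⟩ := exists_form c
  have hg : g ≠ 0 := by rintro rfl; simp at hc
  obtain ⟨n, u, hu0, rfl⟩ : ∃ (n : ℕ) (u : PowerSeries (IsLocalRing.ResidueField A)),
      PowerSeries.constantCoeff u ≠ 0 ∧ g = PowerSeries.X ^ n * u := by
    refine ⟨g.order.toNat, g.divXPowOrder, ?_, PowerSeries.X_pow_order_mul_divXPowOrder.symm⟩
    exact fun h => hg (PowerSeries.constantCoeff_divXPowOrder_eq_zero_iff.1 h)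
  obtain ⟨u', rfl⟩ := PowerSeries.map_surjective _ IsLocalRing.residue_surjective u
  have hu' : IsUnit u' := by
    rw [PowerSeries.isUnit_iff_constantCoeff]
    have : IsLocalRing.residue A (PowerSeries.constantCoeff u') ≠ 0 := by
      rw [← PowerSeries.coeff_zero_eq_constantCoeff_apply] at hu0 ⊢
      rwa [PowerSeries.coeff_map] at hu0
    exact (IsLocalRing.residue_ne_zero_iff_isUnit _).1 this
  obtain ⟨u', rfl⟩ := hu'
  refine ⟨xi A ^ N * (xi A)⁻¹ ^ n * Units.map (iS A).toMonoidHom u', ?_⟩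
  simp only [Units.val_mul, Units.val_pow_eq_pow_val, map_mul, map_pow, mapL_xi, ← iS_X, mapL_iS,
    Units.coe_map, PowerSeries.map_X]
  change _ * mapL _ (iS A (u' : PowerSeries A)) = _
  rw [mapL_iS]; ring

end basics
end Lau

open Matrix

namespace Lau
lemma closure_conj {G : Type*} [Group G] (S : Set G) (c : G)
    (hS : ∀ x ∈ S, c * x * c⁻¹ ∈ Subgroup.closure S) {x : G} (hx : x ∈ Subgroup.closure S) :
    c * x * c⁻¹ ∈ Subgroup.closure S := by
  have : Subgroup.closure S ≤ (Subgroup.closure S).comap (MulAut.conj c).toMonoidHom := by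
    refine (Subgroup.closure_le _).2 fun x hx => ?_
    simpa using hS x hx
  simpa using this hx

lemma split_alg {G : Type*} [Group G] (a b y z : G) :
    a * (b * (y * z⁻¹) * b⁻¹) = a * b * y * (b * z)⁻¹ := by group

section gen
variable {d : ℕ} {A B : Type*} [CommRing A] [CommRing B]

lemma EE_ind_left {P : SLd d A → Prop} (h1 : P 1)
    (hm : ∀ i j h r y, P y → P (elem i j h r * y)) {g : SLd d A} (hg : g ∈ EE d A) : P g := by
  refine Subgroup.closure_induction_left (p := fun x _ => P x) h1 ?_ ?_ hg
  · rintro _ ⟨i, j, h, r, rfl⟩ y _ hy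
    exact hm _ _ _ _ _ hy
  · rintro _ ⟨i, j, h, r, rfl⟩ y _ hy
    rw [← elem_neg]
    exact hm _ _ _ _ _ hy

lemma lift_SL {f : A →+* B} (hf : Function.Injective f) (g : SLd d B)
    (h : ∀ a b, ∃ c, f c = mx g a b) : ∃ g' : SLd d A, mapSL f g' = g ∧ ∀ a b, f (mx g' a b) = mx g a b := by
  choose c hc using h
  have e : (Matrix.of c).map f = mx g := by ext a b; exact hc a b
  have hdet : (Matrix.of c).det = 1 := by
    apply hf
    rw [RingHom.map_det, map_one, ← mx_det g, ← e]; rfl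
  exact ⟨⟨Matrix.of c, hdet⟩, mx_inj e, hc⟩

lemma mapSL_eq_one {f : A →+* B} {g : SLd d A} :
    mapSL f g = 1 ↔ ∀ a b, f (mx g a b) = if a = b then 1 else 0 := by
  constructor
  · intro h a b
    have := congrArg (fun x => mx x a b) h
    simpa [mx_map, mx_one, Matrix.one_apply] using this
  · intro h
    apply mx_inj
    ext a b
    rw [mx_map, map_apply, h, mx_one, Matrix.one_apply]

/-- conjugation by a diagonal matrix -/
def dc (t : Fin d → Aˣ) : SLd d A →* SLd d A where
  toFun g := ⟨diagonal (fun i => (t i : A)) * mx g * diagonal (fun i => (((t i)⁻¹ : Aˣ) : A)), by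
    rw [det_mul, det_mul, mx_det, mul_one, det_diagonal, det_diagonal, ← Finset.prod_mul_distrib]
    simp⟩
  map_one' := by
    apply mx_inj
    rw [mx_mk, mx_one, mul_one, diagonal_mul_diagonal]
    simp
  map_mul' g h := by
    apply mx_inj
    change diagonal (fun i => (t i : A)) * (mx g * mx h) * _ =
      (diagonal (fun i => (t i : A)) * mx g * diagonal (fun i => (((t i)⁻¹ : Aˣ) : A))) *
      (diagonal (fun i => (t i : A)) * mx h * diagonal (fun i => (((t i)⁻¹ : Aˣ) : A)))
    have : diagonal (fun i => (((t i)⁻¹ : Aˣ) : A)) * diagonal (fun i => (t i : A)) = 1 := by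
      rw [diagonal_mul_diagonal]; simp
    calc _ = diagonal (fun i => (t i : A)) * mx g * 1 * mx h * diagonal (fun i => (((t i)⁻¹ : Aˣ) : A)) := by
          simp only [Matrix.mul_assoc, Matrix.one_mul]
      _ = _ := by rw [← this]; simp only [Matrix.mul_assoc]

lemma dc_apply (t : Fin d → Aˣ) (g : SLd d A) (a b : Fin d) :
    mx (dc t g) a b = t a * mx g a b * ((t b)⁻¹ : Aˣ) := by
  change (diagonal (fun i => (t i : A)) * mx g * diagonal (fun i => (((t i)⁻¹ : Aˣ) : A))) a b = _
  rw [mul_diagonal, diagonal_mul]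

lemma dc_mul (t t' : Fin d → Aˣ) (g : SLd d A) : dc (t * t') g = dc t (dc t' g) := by
  apply mx_inj; ext a b
  simp only [dc_apply, Pi.mul_apply, Units.val_mul, mul_inv]; ring

lemma dc_const (c : Aˣ) (g : SLd d A) : dc (fun _ => c) g = g := by
  apply mx_inj; ext a b
  simp only [dc_apply]
  rw [mul_assoc, mul_comm, mul_assoc]; simp

lemma dc_one (g : SLd d A) : dc 1 g = g := dc_const 1 g

lemma dc_elem (t : Fin d → Aˣ) (i j : Fin d) (h : i ≠ j) (r : A) :
    dc t (elem i j h r) = elem i j h (t i * r * ((t j)⁻¹ : Aˣ)) := by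
  apply mx_inj; ext a b
  rw [dc_apply, elem_apply, elem_apply]
  by_cases h1 : a = b
  · subst h1
    by_cases h2 : i = a ∧ j = a
    · exact absurd (h2.1.trans h2.2.symm) h
    · have h3 : ¬ (a = i ∧ a = j) := by rintro ⟨h3, h4⟩; exact h2 ⟨h3.symm, h4.symm⟩
      have h4 : a = i → ¬ a = j := fun x y => h3 ⟨x, y⟩
      simp [Matrix.one_apply, Matrix.single_apply, h2, h3, h4]
  · by_cases h2 : i = a ∧ j = b
    · obtain ⟨rfl, rfl⟩ := h2; simp [Matrix.one_apply, h1]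
    · have h3 : ¬ (a = i ∧ b = j) := by rintro ⟨h3, h4⟩; exact h2 ⟨h3.symm, h4.symm⟩
      have h4 : a = i → ¬ b = j := fun x y => h3 ⟨x, y⟩
      simp [Matrix.one_apply, Matrix.single_apply, h1, h2, h3, h4]

end gen

section lem2
open Polynomial
variable {d : ℕ} {A : Type*} [CommRing A]

/-- constants -/
noncomputable def cst : SLd d A →* SLd d A[X] := mapSL (C : A →+* A[X])

lemma cst_elem (i j : Fin d) (h : i ≠ j) (r : A) : cst (elem i j h r) = elem i j h (C r) := by
  rw [cst, map_elem]

/-- The group generated by `τ e_ab(Xq) τ⁻¹`. -/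
noncomputable def HX (d : ℕ) (A : Type*) [CommRing A] : Subgroup (SLd d A[X]) :=
  Subgroup.closure {g | ∃ τ ∈ EE d A, ∃ a b, ∃ h : a ≠ b, ∃ q : A[X],
    g = cst τ * elem a b h (X * q) * (cst τ)⁻¹}

lemma HX_conj {τ : SLd d A} (hτ : τ ∈ EE d A) {x : SLd d A[X]} (hx : x ∈ HX d A) :
    cst τ * x * (cst τ)⁻¹ ∈ HX d A := by
  refine closure_conj _ (cst τ) ?_ hx
  rintro _ ⟨σ, hσ, a, b, h, q, rfl⟩
  refine Subgroup.subset_closure ⟨τ * σ, mul_mem hτ hσ, a, b, h, q, ?_⟩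
  rw [map_mul]
  generalize cst τ = x
  generalize cst σ = y
  generalize elem a b h (X * q) = z
  group

lemma eval0_cst (τ : SLd d A) : mapSL (evalRingHom 0) (cst τ) = τ := by
  rw [cst, mapSL_comp]
  have : (evalRingHom (0 : A)).comp C = RingHom.id A := by ext; simp
  rw [this]; rfl

lemma HX_split {p : SLd d A[X]} (hp : p ∈ EE d A[X]) :
    p * (cst (mapSL (evalRingHom 0) p))⁻¹ ∈ HX d A := by
  refine EE_ind_left (P := fun p : SLd d A[X] => p * (cst (mapSL (evalRingHom 0) p))⁻¹ ∈ HX d A) ?_ ?_ hp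
  · rw [map_one, map_one, inv_one, mul_one]; exact one_mem _
  · intro i j h r y hy
    have hr : r = X * divX r + C (r.coeff 0) := (X_mul_divX_add r).symm
    have e1 : elem i j h r = elem i j h (X * divX r) * cst (elem i j h (r.coeff 0)) := by
      rw [cst_elem, ← elem_add, ← hr]
    have e2 : mapSL (evalRingHom 0) (elem i j h r) = elem i j h (r.coeff 0) := by
      rw [map_elem]; simp [coeff_zero_eq_eval_zero]
    rw [map_mul (mapSL _), e2, map_mul cst, e1]
    have h1 := HX_conj (elem_mem_EE i j h (r.coeff 0)) hy
    have h2 : elem i j h (X * divX r) ∈ HX d A :=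
      Subgroup.subset_closure ⟨1, one_mem _, i, j, h, divX r, by simp⟩
    have := mul_mem h2 h1
    rwa [split_alg] at this

/-- the diagonal matrix with `s⁻¹` in position `i` -/
noncomputable def dl (i : Fin d) : Fin d → (LaurentSeries A)ˣ := fun l => if l = i then xi A else 1

variable [IsLocalRing A]

lemma exists_unit_col (τ : SLd d A) (a : Fin d) : ∃ j, IsUnit (mx τ j a) := by
  by_contra hcon
  push Not at hcon
  have h := inv_row_dot_col τ a a
  rw [if_pos rfl] at h
  have : (1 : A) ∈ IsLocalRing.maximalIdeal A := by
    rw [← h]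
    refine Ideal.sum_mem _ fun k _ => Ideal.mul_mem_left _ _ ?_
    exact (IsLocalRing.mem_maximalIdeal _).2 (hcon k)
  exact (Ideal.ne_top_iff_one _).1 (IsLocalRing.maximalIdeal.isMaximal A).ne_top this

lemma TV_key (hd : 3 ≤ d) (i j : Fin d) (u w : Fin d → A[X]) (v : A[X]) (hv : u j * v = 1)
    (hwu : w ⬝ᵥ u = 0) (q : A[X]) :
    TV (EE d A[X]) (fun l => if l = i then X * u l else u l)
      (fun l => if l = i then q * w l else X * (q * w l)) := by
  by_cases hji : j = i
  · subst hji
    have e : (fun l => if l = j then q * w l else X * (q * w l)) =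
        ∑ l ∈ Finset.univ.erase j, ((Pi.single l (X * q * w l) : Fin d → A[X]) - Pi.single j (q * w l * u l * v)) := by
      refine funext fun b => ?_
      rw [Finset.sum_apply]
      simp only [Pi.sub_apply, Pi.single_apply]
      by_cases hb : b = j
      · subst hb
        have h1 : ∑ l ∈ Finset.univ.erase b, w l * u l = - (w b * u b) := by
          rw [eq_neg_iff_add_eq_zero, Finset.sum_erase_add _ _ (Finset.mem_univ _)]; exact hwu
        have h2 : ∀ l ∈ Finset.univ.erase b, ((if b = l then X * q * w l else 0)
            - if b = b then q * w l * u l * v else 0) = (- q * v) * (w l * u l) := by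
          intro l hl
          rw [if_neg (Finset.ne_of_mem_erase hl).symm, if_pos rfl]; ring
        rw [Finset.sum_congr rfl h2, ← Finset.mul_sum, h1, if_pos rfl]
        linear_combination (- q * w b) * hv
      · rw [if_neg hb, Finset.sum_eq_single b]
        · simp [hb]; ring
        · intro c _ hc; simp [hb, Ne.symm hc]
        · intro h; simp [hb] at h
    rw [e]
    refine TV.sum_right _ _ ?_ ?_
    · intro l hl
      obtain ⟨t, ht1, ht2⟩ := exists_third hd l j
      refine TV.of_zero RelN_top (t := t) (fun _ => Submodule.mem_top) ?_ ?_
      · simp [ht1, ht2]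
      · rw [sub_dotProduct, single_dotProduct, single_dotProduct, if_pos rfl,
          if_neg (Finset.ne_of_mem_erase hl)]
        linear_combination (- q * w l * u l * X) * hv
    · intro l hl
      rw [sub_dotProduct, single_dotProduct, single_dotProduct, if_pos rfl,
          if_neg (Finset.ne_of_mem_erase hl)]
      linear_combination (- q * w l * u l * X) * hv
  · set u' : Fin d → A[X] := (fun l => if l = i then X * u l else u l) with hu'
    set W : Fin d → A[X] := (fun l => if l = i then q * w l else X * (q * w l)) with hW
    have huj : u' j = u j := by simp [hu', hji]
    have hWu : W ⬝ᵥ u' = 0 := by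
      have : W ⬝ᵥ u' = X * q * (w ⬝ᵥ u) := by
        rw [dotProduct, dotProduct, Finset.mul_sum]
        refine Finset.sum_congr rfl fun l _ => ?_
        simp only [hW, hu']; split_ifs <;> ring
      rw [this, hwu, mul_zero]
    have e : W = ∑ l, (Pi.single l (W l) - Pi.single j (W l * u' l * v)) := by
      rw [Finset.sum_sub_distrib, sum_single]
      have : ∑ l, (Pi.single j (W l * u' l * v) : Fin d → A[X]) = Pi.single j ((W ⬝ᵥ u') * v) := by
        rw [dotProduct, Finset.sum_mul]
        refine funext fun b => ?_
        rw [Finset.sum_apply]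
        by_cases hb : b = j
        · subst hb; simp
        · simp [hb]
      rw [this, hWu]; simp
    have hdot : ∀ l, (Pi.single l (W l) - Pi.single j (W l * u' l * v)) ⬝ᵥ u' = 0 := by
      intro l
      rw [sub_dotProduct, single_dotProduct, single_dotProduct, huj]
      linear_combination (- W l * u' l) * hv
    rw [e]
    refine TV.sum_right _ _ ?_ (fun l _ => hdot l)
    intro l hl
    obtain ⟨t, ht1, ht2⟩ := exists_third hd l j
    refine TV.of_zero RelN_top (t := t) (fun _ => Submodule.mem_top) ?_ (hdot l)
    simp [ht1, ht2]

lemma dc_HX (hd : 3 ≤ d) (i : Fin d) {x : SLd d A[X]} (hx : x ∈ HX d A) :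
    ∃ p ∈ EE d A[X], mapSL (iP A) p = dc (dl i) (mapSL (iP A) x) := by
  have : HX d A ≤ ((EE d A[X]).map (mapSL (iP A))).comap ((dc (dl i)).comp (mapSL (iP A))) := by
    refine (Subgroup.closure_le _).2 ?_
    rintro _ ⟨τ, hτ, a, b, h, q, rfl⟩
    obtain ⟨j, v, hv⟩ := exists_unit_col τ a
    have hv' : mx (cst τ) j a * C ((v⁻¹ : Aˣ) : A) = 1 := by
      have : mx (cst τ) j a = C (mx τ j a) := rfl
      rw [this, ← hv, ← C_mul]; simp
    obtain ⟨g, hg, e⟩ := TV_key hd i j (fun k => mx (cst τ) k a) (fun k => mx (cst τ)⁻¹ b k) _ hv'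
      (by rw [inv_row_dot_col, if_neg h.symm]) q
    refine ⟨g, hg, ?_⟩
    apply mx_inj
    refine Matrix.ext fun k l => ?_
    rw [MonoidHom.comp_apply, dc_apply, mx_map, mx_map, map_apply, map_apply, e, mx_conj_elem]
    simp only [Matrix.add_apply, vecMulVec_apply, Pi.smul_apply, smul_eq_mul, map_add, map_mul, dl,
      Matrix.one_apply]
    have hxy : (xi A : LaurentSeries A) * (((xi A)⁻¹ : (LaurentSeries A)ˣ) : LaurentSeries A) = 1 := by
      simp
    by_cases hk : k = i <;> by_cases hl : l = i <;> by_cases hkl : k = l <;>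
      simp only [hk, hl, hkl, if_true, if_false, map_one, map_zero, iP_X, map_mul, inv_one,
        Units.val_one] <;> grind
  exact this hx
end lem2
end Lau

open Matrix

namespace Lau
section lem2b
open Polynomial
variable {d : ℕ} {A : Type*} [CommRing A]

lemma dc_map {A B : Type*} [CommRing A] [CommRing B] (f : A →+* B) (t : Fin d → Aˣ) (g : SLd d A) :
    mapSL f (dc t g) = dc (fun i => Units.map f.toMonoidHom (t i)) (mapSL f g) := by
  apply mx_inj
  refine Matrix.ext fun a b => ?_
  rw [dc_apply, mx_map, mx_map, map_apply, map_apply, dc_apply]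
  simp only [map_mul, ← map_inv]
  rfl

lemma red_iS {B : Type*} [CommRing B] (f : A →+* B) (h : SLd d (PowerSeries A)) :
    mapSL (mapL f) (mapSL (iS A) h) = mapSL (iS B) (mapSL (PowerSeries.map f) h) := by
  rw [mapSL_comp, mapSL_comp]
  congr 1
  congr 1
  exact RingHom.ext (mapL_iS f)

lemma red_iP {B : Type*} [CommRing B] (f : A →+* B) (h : SLd d A[X]) :
    mapSL (mapL f) (mapSL (iP A) h) = mapSL (iP B) (mapSL (mapRingHom f) h) := by
  rw [mapSL_comp, mapSL_comp]
  congr 1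
  congr 1
  exact RingHom.ext (mapL_iP f)

/-- constants in power series -/
noncomputable def cps : SLd d A →* SLd d (PowerSeries A) := mapSL (PowerSeries.C : A →+* PowerSeries A)

lemma iP_cst (τ : SLd d A) : mapSL (iP A) (cst τ) = mapSL (iS A) (cps τ) := by
  rw [cst, cps, mapSL_comp, mapSL_comp]
  congr 1
  congr 1
  exact RingHom.ext iP_C

lemma map_cps {B : Type*} [CommRing B] (f : A →+* B) (τ : SLd d A) :
    mapSL (PowerSeries.map f) (cps τ) = cps (mapSL f τ) := by
  rw [cps, cps, mapSL_comp, mapSL_comp]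
  congr 1
  congr 1
  ext; simp

lemma map_cst {B : Type*} [CommRing B] (f : A →+* B) (τ : SLd d A) :
    mapSL (mapRingHom f) (cst τ) = cst (mapSL f τ) := by
  rw [cst, cst, mapSL_comp, mapSL_comp]
  congr 1
  congr 1
  ext; simp

lemma eval0_map {B : Type*} [CommRing B] (f : A →+* B) (τ : SLd d A[X]) :
    mapSL (evalRingHom 0) (mapSL (mapRingHom f) τ) = mapSL f (mapSL (evalRingHom 0) τ) := by
  rw [mapSL_comp, mapSL_comp]
  congr 1
  congr 1
  refine Polynomial.ringHom_ext (fun p => ?_) ?_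
  · simp
  · simp

lemma cc_map {B : Type*} [CommRing B] (f : A →+* B) (τ : SLd d (PowerSeries A)) :
    mapSL PowerSeries.constantCoeff (mapSL (PowerSeries.map f) τ)
      = mapSL f (mapSL PowerSeries.constantCoeff τ) := by
  rw [mapSL_comp, mapSL_comp]
  congr 1

lemma cc_cps (τ : SLd d A) : mapSL PowerSeries.constantCoeff (cps τ) = τ := by
  rw [cps, mapSL_comp]
  have : (PowerSeries.constantCoeff (R := A)).comp (PowerSeries.C) = RingHom.id A := by ext; simp
  rw [this]; rfl

variable [IsLocalRing A]
open IsLocalRing (residue)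

/-- elementary polynomial matrices congruent to one -/
noncomputable def P1 (d : ℕ) (A : Type*) [CommRing A] [IsLocalRing A] : Subgroup (SLd d A[X]) :=
  EE d A[X] ⊓ (mapSL (mapRingHom (residue A))).ker

/-- power series matrices congruent to one -/
noncomputable def MM (d : ℕ) (A : Type*) [CommRing A] [IsLocalRing A] :
    Subgroup (SLd d (PowerSeries A)) := (mapSL (PowerSeries.map (residue A))).ker

lemma mem_P1 {p : SLd d A[X]} : p ∈ P1 d A ↔ p ∈ EE d A[X] ∧ mapSL (mapRingHom (residue A)) p = 1 :=
  Iff.rfl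
lemma mem_MM {p : SLd d (PowerSeries A)} : p ∈ MM d A ↔ mapSL (PowerSeries.map (residue A)) p = 1 :=
  Iff.rfl

/-- the set `𝒳` -/
def XX (d : ℕ) (A : Type*) [CommRing A] [IsLocalRing A] : Set (SLd d (LaurentSeries A)) :=
  {y | ∃ p ∈ P1 d A, ∃ h ∈ MM d A, y = mapSL (iP A) p * mapSL (iS A) h}

lemma red_lift_iS {g : SLd d (LaurentSeries A)} (hg : mapSL (mapL (residue A)) g = 1) (i : Fin d)
    {h : SLd d (PowerSeries A)} (hh : mapSL (iS A) h = dc (dl i) g) : h ∈ MM d A := by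
  have := congrArg (mapSL (mapL (residue A))) hh
  rw [red_iS, dc_map, hg, map_one] at this
  rw [mem_MM]
  exact mapSL_inj iS_inj (this.trans (map_one _).symm)

lemma red_lift_iP {g : SLd d (LaurentSeries A)} (hg : mapSL (mapL (residue A)) g = 1) (i : Fin d)
    {h : SLd d A[X]} (hh : mapSL (iP A) h = dc (dl i) g) :
    mapSL (mapRingHom (residue A)) h = 1 := by
  have := congrArg (mapSL (mapL (residue A))) hh
  rw [red_iP, dc_map, hg, map_one] at this
  exact mapSL_inj iP_inj (this.trans (map_one _).symm)

lemma alg1 {G : Type*} [Group G] (p c h u : G) :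
    p * h = (p * c⁻¹) * (u * (u⁻¹ * (c * h))) := by group

set_option maxHeartbeats 1600000 in
lemma XX_dl (hd : 3 ≤ d) (i : Fin d) {y : SLd d (LaurentSeries A)} (hy : y ∈ XX d A) :
    dc (dl i) y ∈ XX d A := by
  obtain ⟨p, hp, h, hh, rfl⟩ := hy
  obtain ⟨hpE, hp1⟩ := mem_P1.1 hp
  rw [mem_MM] at hh
  set c0 : SLd d A := mapSL (evalRingHom 0) p with hc0
  have hc0r : mapSL (residue A) c0 = 1 := by
    rw [hc0, ← eval0_map, hp1, map_one]
  have hp0 : p * (cst c0)⁻¹ ∈ HX d A := HX_split hpE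
  obtain ⟨p', hp'E, hp'⟩ := dc_HX hd i hp0
  have hp0r : mapSL (mapRingHom (residue A)) (p * (cst c0)⁻¹) = 1 := by
    rw [map_mul (mapSL _), map_inv (mapSL _), hp1, map_cst, hc0r, map_one, inv_one, mul_one]
  have hp'r := red_lift_iP (by rw [red_iP, hp0r, map_one]) i hp'
  set h0 : SLd d (PowerSeries A) := cps c0 * h with hh0
  have hh0r : mapSL (PowerSeries.map (residue A)) h0 = 1 := by
    rw [hh0, map_mul (mapSL _), map_cps, hc0r, map_one, hh, mul_one]
  set H : SLd d A := mapSL PowerSeries.constantCoeff h0 with hH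
  have hHr : mapSL (residue A) H = 1 := by rw [hH, ← cc_map, hh0r, map_one]
  have hHir : mapSL (residue A) H⁻¹ = 1 := by rw [map_inv, hHr, inv_one]
  have hHi := mapSL_eq_one.1 hHir
  obtain ⟨l, hl⟩ : IsUnit (mx H⁻¹ i i) := by
    rw [← IsLocalRing.residue_ne_zero_iff_isUnit, hHi]; simp
  set c : Fin d → A := fun j => if j = i then 0 else - mx H⁻¹ i j * ((l⁻¹ : Aˣ) : A) with hc
  obtain ⟨u, huE, hu⟩ := TV.row (RelN_top (d := d) (A := A)) (t := i) (y := c)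
    (fun _ => Submodule.mem_top) (by simp [hc])
  have hcr : ∀ j, residue A (c j) = 0 := by
    intro j
    simp only [hc]
    split_ifs with h
    · simp
    · rw [map_mul, map_neg, hHi, if_neg (Ne.symm h)]; simp
  have hur : mapSL (residue A) u = 1 := by
    rw [mapSL_eq_one]
    intro a b
    rw [hu, Matrix.add_apply, map_add, vecMulVec_apply, map_mul, hcr, Matrix.one_apply]
    split_ifs <;> simp
  -- the polynomial version
  obtain ⟨u'', hu''E, hu''⟩ := TV.row (RelN_top (d := d) (A := A[X])) (t := i)
    (y := fun j => X * C (c j)) (fun _ => Submodule.mem_top) (by simp [hc])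
  have hci : c i = 0 := by simp [hc]
  have hxy : (xi A : LaurentSeries A) * (((xi A)⁻¹ : (LaurentSeries A)ˣ) : LaurentSeries A) = 1 := by
      simp
  have hu''dc : mapSL (iP A) u'' = dc (dl i) (mapSL (iS A) (cps u)) := by
    rw [← iP_cst]
    apply mx_inj
    refine Matrix.ext fun a b => ?_
    rw [dc_apply, mx_map, mx_map, map_apply, map_apply, hu'']
    have : mx (cst u) a b = C (mx u a b) := rfl
    rw [this, hu]
    simp only [Matrix.add_apply, vecMulVec_apply, map_add, map_mul, dl, Matrix.one_apply,
      Pi.single_apply]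
    by_cases ha : a = i <;> by_cases hb : b = i <;> by_cases hab : a = b <;>
      simp only [ha, hb, hab, if_true, if_false, map_one, map_zero, iP_X, map_mul, inv_one, hci,
        Units.val_one] <;> grind
  have hu''r := red_lift_iP (by rw [red_iS, map_cps, hur, map_one, map_one]) i hu''dc
  set h1 : SLd d (PowerSeries A) := (cps u)⁻¹ * h0 with hh1
  have hh1r : mapSL (PowerSeries.map (residue A)) h1 = 1 := by
    rw [hh1, map_mul (mapSL _), map_inv (mapSL _), map_cps, hur, map_one, hh0r, inv_one, mul_one]
  set Z : SLd d A := u⁻¹ * H with hZ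
  have hZh : mapSL PowerSeries.constantCoeff h1 = Z := by
    rw [hh1, map_mul (mapSL _), map_inv (mapSL _), cc_cps]
  have hZi : ∀ j, mx Z⁻¹ i j = if j = i then (l : A) else 0 := by
    intro j
    have : mx Z⁻¹ i j = mx H⁻¹ i j + mx H⁻¹ i i * c j := by
      have e : Z⁻¹ = H⁻¹ * u := by rw [hZ]; group
      rw [e, mx_mul, hu, Matrix.mul_add, Matrix.mul_one, Matrix.add_apply, mul_vecMulVec,
        vecMulVec_apply]
      simp
    rw [this]
    by_cases hj : j = i
    · subst hj; rw [hci, if_pos rfl, mul_zero, add_zero, hl]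
    · simp only [hc, if_neg hj, ← hl]
      linear_combination (- mx H⁻¹ i j) * (Units.mul_inv l)
  have hZ0 : ∀ b, b ≠ i → mx Z i b = 0 := by
    intro b hb
    have := congrFun (congrFun (mx_inv_mul Z) i) b
    rw [Matrix.mul_apply, Finset.sum_eq_single i, hZi, if_pos rfl, Matrix.one_apply_ne hb.symm] at this
    · exact (Units.mul_right_eq_zero l).1 this
    · intro j _ hj; rw [hZi, if_neg hj, zero_mul]
    · simp
  obtain ⟨h2, hh2, -⟩ := lift_SL iS_inj (dc (dl i) (mapSL (iS A) h1)) (by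
    intro a b
    rw [dc_apply]
    simp only [dl]
    by_cases ha : a = i
    · by_cases hb : b = i
      · refine ⟨mx h1 a b, ?_⟩
        simp only [ha, hb, if_true]
        rw [mul_comm, ← mul_assoc, mul_comm _ (xi A : LaurentSeries A), hxy, one_mul]; rfl
      · have : PowerSeries.X ∣ mx h1 a b := by
          rw [PowerSeries.X_dvd_iff, ha, ← hZ0 b hb, ← hZh]; rfl
        obtain ⟨f, hf⟩ := this
        refine ⟨f, ?_⟩
        have e : mx (mapSL (iS A) h1) a b = iS A PowerSeries.X * iS A f := by
          rw [← map_mul, ← hf]; rfl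
        rw [e, iS_X, if_pos ha, if_neg hb, inv_one, Units.val_one, mul_one, ← mul_assoc, hxy, one_mul]
    · by_cases hb : b = i
      · refine ⟨mx h1 a b * PowerSeries.X, ?_⟩
        rw [if_neg ha, if_pos hb, map_mul, iS_X, Units.val_one, one_mul]; rfl
      · refine ⟨mx h1 a b, ?_⟩
        rw [if_neg ha, if_neg hb, inv_one, Units.val_one, one_mul, mul_one]; rfl)
  have hh2r := red_lift_iS (by rw [red_iS, hh1r, map_one]) i hh2
  refine ⟨p' * u'', mul_mem (mem_P1.2 ⟨hp'E, hp'r⟩) (mem_P1.2 ⟨hu''E, hu''r⟩), h2, hh2r, ?_⟩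
  rw [map_mul (mapSL _), hp', hu''dc, hh2, mul_assoc, ← map_mul (dc _), ← map_mul (dc _), hh1, hh0,
    map_mul (mapSL _), map_mul (mapSL _), map_mul (mapSL _), map_inv (mapSL _), map_inv (mapSL _), iP_cst]
  congr 1
  exact alg1 _ _ _ _

end lem2b
end Lau

open Matrix

namespace Lau
section lem2c
open Polynomial
open IsLocalRing (residue)
variable {d : ℕ} {A : Type*} [CommRing A] [IsLocalRing A]

lemma XX_dl_finset (hd : 3 ≤ d) (s : Finset (Fin d)) {y : SLd d (LaurentSeries A)} (hy : y ∈ XX d A) :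
    dc (fun l => if l ∈ s then xi A else 1) y ∈ XX d A := by
  induction s using Finset.induction_on with
  | empty => simpa using (dc_one y).symm ▸ hy
  | insert a s ha ih =>
    have : (fun l => if l ∈ insert a s then xi A else 1) =
        dl a * (fun l => if l ∈ s then xi A else 1) := by
      funext l
      simp only [Pi.mul_apply, dl, Finset.mem_insert]
      by_cases h : l = a
      · subst h; simp [ha]
      · simp [h]
    rw [this, dc_mul]
    exact XX_dl hd a ih

lemma XX_dl_inv (hd : 3 ≤ d) (i : Fin d) {y : SLd d (LaurentSeries A)} (hy : y ∈ XX d A) :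
    dc (dl i)⁻¹ y ∈ XX d A := by
  have h := XX_dl_finset hd (Finset.univ.erase i) hy
  have : (fun l => if l ∈ Finset.univ.erase i then xi A else 1) = (fun _ => xi A) * (dl i)⁻¹ := by
    funext l
    by_cases h : l = i <;> simp [dl, h]
  rwa [this, dc_mul, dc_const] at h

lemma XX_dl_zpow (hd : 3 ≤ d) (i : Fin d) (n : ℤ) {y : SLd d (LaurentSeries A)} (hy : y ∈ XX d A) :
    dc ((dl i) ^ n) y ∈ XX d A := by
  induction n with
  | zero => rw [zpow_zero, dc_one]; exact hy
  | succ n ih => rw [_root_.zpow_add_one, mul_comm, dc_mul]; exact XX_dl hd i ih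
  | pred n ih => rw [_root_.zpow_sub_one, mul_comm, dc_mul]; exact XX_dl_inv hd i ih

/-- monomial -/
noncomputable def mono (c : A) (n : ℤ) : LaurentSeries A :=
  ((xi A ^ n : (LaurentSeries A)ˣ) : LaurentSeries A) * iS A (PowerSeries.C c)

lemma dc_mono (i j : Fin d) (h : i ≠ j) (c : A) (n : ℤ) :
    dc ((dl i) ^ n) (elem i j h (iS A (PowerSeries.C c))) = elem i j h (mono c n) := by
  rw [dc_elem]
  congr 1
  simp [dl, h.symm, mono]

lemma P1_conj {τ p : SLd d A[X]} (hτ : τ ∈ EE d A[X]) (hp : p ∈ P1 d A) : τ * p * τ⁻¹ ∈ P1 d A := by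
  rw [mem_P1] at hp ⊢
  refine ⟨mul_mem (mul_mem hτ hp.1) (inv_mem hτ), ?_⟩
  rw [map_mul (mapSL _), map_mul (mapSL _), map_inv (mapSL _), hp.2, mul_one, mul_inv_cancel]

lemma MM_conj {τ p : SLd d (PowerSeries A)} (hp : p ∈ MM d A) : τ * p * τ⁻¹ ∈ MM d A := by
  rw [mem_MM] at hp ⊢
  rw [map_mul (mapSL _), map_mul (mapSL _), map_inv (mapSL _), hp, mul_one, mul_inv_cancel]

lemma alg2 {G : Type*} [Group G] (t p h : G) :
    t * (p * h) * t⁻¹ = (t * p * t⁻¹) * (t * h * t⁻¹) := by group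

lemma XX_conj_cst {τ : SLd d A} (hτ : τ ∈ EE d A) {y : SLd d (LaurentSeries A)} (hy : y ∈ XX d A) :
    mapSL (iP A) (cst τ) * y * (mapSL (iP A) (cst τ))⁻¹ ∈ XX d A := by
  obtain ⟨p, hp, h, hh, rfl⟩ := hy
  refine ⟨cst τ * p * (cst τ)⁻¹, P1_conj (EE_map _ hτ) hp, cps τ * h * (cps τ)⁻¹, MM_conj hh, ?_⟩
  rw [alg2, map_mul (mapSL _), map_mul (mapSL _), map_mul (mapSL _), map_mul (mapSL _),
    map_inv (mapSL _), map_inv (mapSL _), iP_cst]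

lemma XX_mul_P1 {q : SLd d A[X]} (hq : q ∈ P1 d A) {y : SLd d (LaurentSeries A)} (hy : y ∈ XX d A) :
    mapSL (iP A) q * y ∈ XX d A := by
  obtain ⟨p, hp, h, hh, rfl⟩ := hy
  exact ⟨q * p, mul_mem hq hp, h, hh, by rw [map_mul (mapSL _), mul_assoc]⟩

lemma iP_cst_elem (i j : Fin d) (h : i ≠ j) (c : A) :
    mapSL (iP A) (cst (elem i j h c)) = elem i j h (iS A (PowerSeries.C c)) := by
  rw [cst_elem, map_elem, iP_C]

lemma dc_zpow_cancel (i : Fin d) (n : ℤ) (y : SLd d (LaurentSeries A)) :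
    dc ((dl i) ^ n) (dc ((dl i) ^ (-n)) y) = y := by
  rw [← dc_mul, ← _root_.zpow_add, add_neg_cancel, zpow_zero, dc_one]

/-- conjugation by `e_ij(l)` preserves `𝒳` -/
def CP (d : ℕ) (l : LaurentSeries A) : Prop :=
  ∀ (i j : Fin d) (h : i ≠ j), ∀ y ∈ XX d A, elem i j h l * y * (elem i j h l)⁻¹ ∈ XX d A

/-- left multiplication by `e_ij(l)` preserves `𝒳` -/
def LP (d : ℕ) (l : LaurentSeries A) : Prop :=
  ∀ (i j : Fin d) (h : i ≠ j), ∀ y ∈ XX d A, elem i j h l * y ∈ XX d A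

lemma CP_mono (hd : 3 ≤ d) (c : A) (n : ℤ) : CP d (mono c n) := by
  intro i j h y hy
  rw [← dc_mono, ← dc_zpow_cancel i n y, ← map_inv (dc _), ← map_mul (dc _), ← map_mul (dc _)]
  apply XX_dl_zpow hd
  rw [← iP_cst_elem]
  exact XX_conj_cst (elem_mem_EE _ _ _ _) (XX_dl_zpow hd i _ hy)

lemma LP_mono (hd : 3 ≤ d) (c : A) (hc : residue A c = 0) (n : ℤ) : LP d (mono c n) := by
  intro i j h y hy
  rw [← dc_mono, ← dc_zpow_cancel i n y, ← map_mul (dc _)]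
  apply XX_dl_zpow hd
  rw [← iP_cst_elem]
  refine XX_mul_P1 (mem_P1.2 ⟨by rw [cst_elem]; exact elem_mem_EE _ _ _ _, ?_⟩) (XX_dl_zpow hd i _ hy)
  rw [map_cst, map_elem, hc, elem_zero, map_one]

lemma alg3 {G : Type*} [Group G] (a b y : G) :
    a * b * y * (a * b)⁻¹ = a * (b * y * b⁻¹) * a⁻¹ := by group

lemma CP_add {l l' : LaurentSeries A} (h : CP d l) (h' : CP d l') : CP d (l + l') := by
  intro i j hij y hy
  rw [elem_add, alg3]
  exact h _ _ _ _ (h' _ _ _ _ hy)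

lemma LP_add {l l' : LaurentSeries A} (h : LP d l) (h' : LP d l') : LP d (l + l') := by
  intro i j hij y hy
  rw [elem_add, mul_assoc]
  exact h _ _ _ _ (h' _ _ _ _ hy)

lemma fin_split (J : Ideal A) (P : LaurentSeries A → Prop) (h0 : P 0)
    (hadd : ∀ l l', P l → P l' → P (l + l')) (hm : ∀ c ∈ J, ∀ n, P (mono c n)) (N : ℕ)
    (f : PowerSeries A) (hf : ∀ k, PowerSeries.coeff k f ∈ J) (n : ℕ) :
    ∃ φ, P φ ∧ ∃ b : PowerSeries A, (∀ k, PowerSeries.coeff k b ∈ J) ∧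
      (xi A : LaurentSeries A) ^ N * iS A f
        = φ + ((xi A ^ ((N : ℤ) - n) : (LaurentSeries A)ˣ) : LaurentSeries A) * iS A b := by
  induction n with
  | zero => exact ⟨0, h0, f, hf, by simp⟩
  | succ n ih =>
    obtain ⟨φ, hφ, b, hb, e⟩ := ih
    refine ⟨φ + mono (PowerSeries.coeff 0 b) (N - n), hadd _ _ hφ (hm _ (hb 0) _),
      PowerSeries.mk fun p => PowerSeries.coeff (p + 1) b, ?_, ?_⟩
    · intro k; rw [PowerSeries.coeff_mk]; exact hb _
    · rw [e, add_assoc]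
      congr 1
      conv_lhs => rw [PowerSeries.eq_X_mul_shift_add_const b]
      rw [map_add, map_mul, iS_X, mono]
      have : (N : ℤ) - ((n + 1 : ℕ) : ℤ) = N - n - 1 := by push_cast; ring
      rw [this, _root_.zpow_sub_one (xi A), Units.val_mul]
      simp only [PowerSeries.coeff_zero_eq_constantCoeff_apply]
      ring

lemma alg4 {G : Type*} [Group G] (e p h : G) :
    e * (p * h) * e⁻¹ = p * ((p⁻¹ * e * p) * h * e⁻¹) := by group
lemma alg5 {G : Type*} [Group G] (e p h : G) :
    e * (p * h) = p * ((p⁻¹ * e * p) * h) := by group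

set_option maxHeartbeats 800000 in
lemma tail {y : SLd d (LaurentSeries A)} (hy : y ∈ XX d A) (i j : Fin d) (hij : i ≠ j) :
    ∃ n : ℕ, ∀ b : PowerSeries A,
      (elem i j hij (iS A (PowerSeries.X ^ n * b)) * y * (elem i j hij (iS A (PowerSeries.X ^ n * b)))⁻¹
        ∈ XX d A) ∧
      (PowerSeries.map (residue A) b = 0 → elem i j hij (iS A (PowerSeries.X ^ n * b)) * y ∈ XX d A) := by
  obtain ⟨p, hp, h, hh, rfl⟩ := hy
  obtain ⟨n, hn⟩ : ∃ n, ∀ a b, (mx p a b).natDegree ≤ n ∧ (mx p⁻¹ a b).natDegree ≤ n := by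
    refine ⟨∑ a, ∑ b, ((mx p a b).natDegree + (mx p⁻¹ a b).natDegree), fun a b => ?_⟩
    have h1 : (mx p a b).natDegree + (mx p⁻¹ a b).natDegree ≤
        ∑ b, ((mx p a b).natDegree + (mx p⁻¹ a b).natDegree) :=
      Finset.single_le_sum (f := fun b => (mx p a b).natDegree + (mx p⁻¹ a b).natDegree)
        (fun _ _ => Nat.zero_le _) (Finset.mem_univ b)
    have h2 := Finset.single_le_sum (f := fun a => ∑ b, ((mx p a b).natDegree + (mx p⁻¹ a b).natDegree))
        (fun _ _ => Nat.zero_le _) (Finset.mem_univ a)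
    have h3 := h1.trans h2
    exact ⟨(Nat.le_add_right _ _).trans h3, (Nat.le_add_left _ _).trans h3⟩
  refine ⟨n + n, fun b => ?_⟩
  obtain ⟨w, hw, -⟩ := lift_SL iS_inj ((mapSL (iP A) p)⁻¹ * elem i j hij (iS A (PowerSeries.X ^ (n+n) * b)) *
      mapSL (iP A) p) (by
    intro r s
    have e := mx_conj_elem (mapSL (iP A) p)⁻¹ i j hij (iS A (PowerSeries.X ^ (n+n) * b))
    rw [inv_inv] at e
    rw [e]
    have e1 := iP_rev (mx p⁻¹ r i) n (hn _ _).2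
    have e2 := iP_rev (mx p j s) n (hn _ _).1
    refine ⟨(if r = s then 1 else 0) + revS n (mx p⁻¹ r i) * (b * revS n (mx p j s)), ?_⟩
    rw [map_add, map_mul, map_mul, ← e1, ← e2, Matrix.add_apply, vecMulVec_apply, ← map_inv (mapSL _)]
    simp only [Pi.smul_apply, smul_eq_mul, Matrix.one_apply, map_mul, map_pow, iS_X, pow_add]
    congr 1
    · split_ifs <;> simp
    · have h1 : mx (mapSL (iP A) p⁻¹) r i = iP A (mx p⁻¹ r i) := rfl
      have h2 : mx (mapSL (iP A) p) j s = iP A (mx p j s) := rfl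
      rw [h1, h2]; ring)
  obtain ⟨hpE, hpr⟩ := mem_P1.1 hp
  have hwr : mapSL (PowerSeries.map (residue A)) w =
      mapSL (PowerSeries.map (residue A)) (elem i j hij (PowerSeries.X ^ (n+n) * b)) := by
    apply mapSL_inj iS_inj
    rw [← red_iS, hw, map_mul (mapSL _), map_mul (mapSL _), map_inv (mapSL _), red_iP, hpr, map_one,
      inv_one, one_mul, mul_one, ← map_elem (iS A), red_iS]
  rw [mem_MM] at hh
  constructor
  · rw [alg4, ← hw, ← map_elem (iS A), ← map_inv (mapSL _), ← map_mul (mapSL _), ← map_mul (mapSL _)]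
    refine ⟨p, hp, _, ?_, rfl⟩
    rw [mem_MM, map_mul (mapSL _), map_mul (mapSL _), map_inv (mapSL _), hwr, hh, mul_one, mul_inv_cancel]
  · intro hb
    rw [alg5, ← hw, ← map_mul (mapSL _)]
    refine ⟨p, hp, _, ?_, rfl⟩
    rw [mem_MM, map_mul (mapSL _), hwr, hh, mul_one, map_elem, map_mul, hb, mul_zero, elem_zero]

lemma pow_conv (N n : ℕ) (b : PowerSeries A) :
    ((xi A ^ ((N : ℤ) - ((N + n : ℕ) : ℤ)) : (LaurentSeries A)ˣ) : LaurentSeries A) * iS A b =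
      iS A (PowerSeries.X ^ n * b) := by
  have : (N : ℤ) - ((N + n : ℕ) : ℤ) = - (n : ℤ) := by push_cast; ring
  rw [this, map_mul, map_pow, iS_X, _root_.zpow_neg, zpow_natCast, ← inv_pow, Units.val_pow_eq_pow_val]

lemma CP_all (hd : 3 ≤ d) (l : LaurentSeries A) : CP d l := by
  obtain ⟨N, f, rfl⟩ := exists_form l
  intro i j h y hy
  obtain ⟨n, hn⟩ := tail hy i j h
  obtain ⟨φ, hφ, b, -, e⟩ := fin_split ⊤ (CP (A := A) d) (by
    intro i j h y hy; rw [elem_zero]; simpa using hy) (fun _ _ => CP_add)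
    (fun c _ n => CP_mono hd c n) N f (fun _ => Submodule.mem_top) (N + n)
  rw [e, pow_conv, elem_add, alg3]
  exact hφ _ _ _ _ (hn b).1

lemma LP_all (hd : 3 ≤ d) (l : LaurentSeries A) (hl : mapL (residue A) l = 0) : LP d l := by
  obtain ⟨N, f, rfl⟩ := exists_form l
  have hf := mem_ker hl
  intro i j h y hy
  obtain ⟨n, hn⟩ := tail hy i j h
  obtain ⟨φ, hφ, b, hb, e⟩ := fin_split (RingHom.ker (residue A)) (LP (A := A) d) (by
    intro i j h y hy; rw [elem_zero]; simpa using hy) (fun _ _ => LP_add)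
    (fun c hc n => LP_mono hd c hc n) N f (fun k => by
      rw [RingHom.mem_ker, ← PowerSeries.coeff_map, hf]; simp) (N + n)
  rw [e, pow_conv, elem_add, mul_assoc]
  refine hφ _ _ _ _ ((hn b).2 ?_)
  ext k
  rw [PowerSeries.coeff_map, hb k]; simp

/-- relative elementary group -/
noncomputable def N1 (d : ℕ) (A : Type*) [CommRing A] [IsLocalRing A] : Subgroup (SLd d (LaurentSeries A)) :=
  Subgroup.closure {x | ∃ g ∈ EE d (LaurentSeries A), ∃ i j, ∃ h : i ≠ j, ∃ μ,
    mapL (residue A) μ = 0 ∧ x = g * elem i j h μ * g⁻¹}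

lemma XX_conj (hd : 3 ≤ d) {g : SLd d (LaurentSeries A)} (hg : g ∈ EE d (LaurentSeries A)) :
    ∀ y ∈ XX d A, g * y * g⁻¹ ∈ XX d A := by
  refine EE_ind_left (P := fun g : SLd d (LaurentSeries A) => ∀ y ∈ XX d A, g * y * g⁻¹ ∈ XX d A) ?_ ?_ hg
  · intro y hy; simpa using hy
  · intro i j h r g ih y hy
    rw [alg3]
    exact CP_all hd r _ _ _ _ (ih y hy)

lemma alg6 {G : Type*} [Group G] (g e y : G) :
    g * e * g⁻¹ * y = g * (e * (g⁻¹ * y * (g⁻¹)⁻¹)) * g⁻¹ := by group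
lemma alg7 {G : Type*} [Group G] (g e : G) : (g * e * g⁻¹)⁻¹ = g * e⁻¹ * g⁻¹ := by group

lemma gen_XX (hd : 3 ≤ d) {g : SLd d (LaurentSeries A)} (hg : g ∈ EE d (LaurentSeries A))
    (i j : Fin d) (h : i ≠ j) (μ : LaurentSeries A) (hμ : mapL (residue A) μ = 0) :
    ∀ y ∈ XX d A, (g * elem i j h μ * g⁻¹) * y ∈ XX d A := by
  intro y hy
  rw [alg6]
  exact XX_conj hd hg _ (LP_all hd μ hμ _ _ _ _ (XX_conj hd (inv_mem hg) _ hy))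

lemma N1_XX (hd : 3 ≤ d) {x : SLd d (LaurentSeries A)} (hx : x ∈ N1 d A) : x ∈ XX d A := by
  refine Subgroup.closure_induction_left (p := fun x _ => x ∈ XX d A) ?_ ?_ ?_ hx
  · exact ⟨1, one_mem _, 1, one_mem _, by simp⟩
  · rintro _ ⟨g, hg, i, j, h, μ, hμ, rfl⟩ y _ hy
    exact gen_XX hd hg i j h μ hμ y hy
  · rintro _ ⟨g, hg, i, j, h, μ, hμ, rfl⟩ y _ hy
    rw [alg7, ← elem_neg]
    exact gen_XX hd hg i j h (-μ) (by rw [map_neg, hμ, neg_zero]) y hy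

lemma N1_rel : RelN (N1 d A) (RingHom.ker (mapL (residue A))) := by
  refine ⟨fun i j h r hr => Subgroup.subset_closure ⟨1, one_mem _, i, j, h, r, hr, by simp⟩, ?_⟩
  intro g hg x hx
  refine closure_conj _ g ?_ hx
  rintro _ ⟨σ, hσ, a, b, h, q, hq, rfl⟩
  refine Subgroup.subset_closure ⟨g * σ, mul_mem hg hσ, a, b, h, q, hq, ?_⟩
  rw [alg3]

lemma N1_red {x : SLd d (LaurentSeries A)} (hx : x ∈ N1 d A) : mapSL (mapL (residue A)) x = 1 := by
  have : N1 d A ≤ (mapSL (mapL (residue A))).ker := by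
    refine (Subgroup.closure_le _).2 ?_
    rintro _ ⟨σ, hσ, a, b, h, q, hq, rfl⟩
    change mapSL (mapL (residue A)) _ = 1
    rw [map_mul (mapSL _), map_mul (mapSL _), map_elem, hq, elem_zero, map_inv (mapSL _), mul_one,
      mul_inv_cancel]
  exact this hx

lemma isEuc_poly (K : Type*) [Field K] : IsEuc K[X] := by
  refine ⟨fun p => p.natDegree, fun a b hb => ⟨a / b, ?_⟩⟩
  by_cases h0 : a - a / b * b = 0
  · exact Or.inl h0
  · right
    have e : a - a / b * b = a % b := by
      rw [EuclideanDomain.mod_eq_sub_mul_div, mul_comm b]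
    rw [e] at h0 ⊢
    exact Polynomial.natDegree_lt_natDegree h0 (EuclideanDomain.mod_lt a hb)

instance (K : Type*) [Field K] : Infinite (LaurentSeries K) :=
  Infinite.of_injective (fun n : ℕ => (HahnSeries.single (n : ℤ) (1 : K) : LaurentSeries K)) (by
    intro a b h
    have := congrArg (fun f : LaurentSeries K => f.coeff (a : ℤ)) h
    simp only [HahnSeries.coeff_single_same] at this
    by_contra hab
    rw [HahnSeries.coeff_single_of_ne (by exact_mod_cast hab)] at this
    exact one_ne_zero this)

theorem MI_local (hd : 3 ≤ d) (g : SLd d A[X]) (hg : mapSL (iP A) g ∈ EE d (LaurentSeries A)) :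
    g ∈ EE d A[X] := by
  obtain ⟨ε, hεE, hε⟩ := EE_lift (mapRingHom (residue A))
    (Polynomial.map_surjective _ IsLocalRing.residue_surjective)
    (EE_euc (isEuc_poly _) (mapSL (mapRingHom (residue A)) g))
  set g' := ε⁻¹ * g with hg'
  have hg'r : mapSL (mapRingHom (residue A)) g' = 1 := by
    rw [hg', map_mul (mapSL _), map_inv (mapSL _), hε, inv_mul_cancel]
  have hg'E : mapSL (iP A) g' ∈ EE d (LaurentSeries A) := by
    rw [hg', map_mul (mapSL _)]
    exact mul_mem (EE_map _ (inv_mem hεE)) hg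
  have hN : mapSL (iP A) g' ∈ N1 d A := by
    refine rel_kernel (mapL (residue A)) (mapL_surj _ IsLocalRing.residue_surjective)
      unit_lift (N1 d A) N1_rel (fun x hx => N1_red hx) hg'E ?_
    rw [red_iP, hg'r, map_one]
  obtain ⟨p, hp, h, -, e⟩ := N1_XX hd hN
  set q := p⁻¹ * g' with hq
  have e' : mapSL (iP A) q = mapSL (iS A) h := by
    rw [hq, map_mul (mapSL _), map_inv (mapSL _), e, inv_mul_cancel_left]
  have hqc : q = cst (mapSL (evalRingHom 0) q) := by
    apply mx_inj
    refine Matrix.ext fun a b => ?_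
    have := iP_eq_iS (p := mx q a b) (f := mx h a b) (congrArg (fun x => mx x a b) e')
    rw [this, coeff_zero_eq_eval_zero]; rfl
  have hqE : q ∈ EE d A[X] := by
    rw [hqc]; exact EE_map _ (EE_local _)
  have : g = ε * (p * q) := by rw [hq, hg']; group
  rw [this]
  exact mul_mem hεE (mul_mem (mem_P1.1 hp).1 hqE)

end lem2c
end Lau

open Matrix

namespace Lau
section euc
variable {B : Type*} [CommRing B]

/-- recursive quotient coefficients -/
noncomputable def qco (D : B → B) (f b : ℕ → B) : ℕ → B
  | n => D (f n - ∑ i : Fin n, qco D f b i * b (n - i))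
termination_by n => n
decreasing_by exact i.2

lemma ps_div (φ : B → ℕ) (f b : PowerSeries B) (c : B) (hc : PowerSeries.constantCoeff b = c)
    (hφ : ∀ a : B, ∃ q, a - q * c = 0 ∨ φ (a - q * c) < φ c) :
    ∃ q : PowerSeries B, f - q * b = 0 ∨ ∃ (n : ℕ) (h : PowerSeries B), f - q * b = PowerSeries.X ^ n * h ∧
      PowerSeries.constantCoeff h ≠ 0 ∧ φ (PowerSeries.constantCoeff h) < φ c := by
  classical
  choose D hD using hφ
  set qq := qco D (fun n => PowerSeries.coeff n f) (fun n => PowerSeries.coeff n b) with hqq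
  set q : PowerSeries B := PowerSeries.mk qq with hq
  have key : ∀ n, PowerSeries.coeff n (f - q * b) = 0 ∨ φ (PowerSeries.coeff n (f - q * b)) < φ c := by
    intro n
    set x := PowerSeries.coeff n f - ∑ i : Fin n, qq i * PowerSeries.coeff (n - i) b with hx
    have e1 : qq n = D x := by rw [hqq, qco]
    have e2 : PowerSeries.coeff n (f - q * b) = x - D x * c := by
      rw [map_sub, PowerSeries.coeff_mul, Finset.Nat.sum_antidiagonal_eq_sum_range_succ_mk,
        Finset.sum_range_succ, hx, ← Fin.sum_univ_eq_sum_range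
          (fun i => PowerSeries.coeff i q * PowerSeries.coeff (n - i) b)]
      simp only [hq, PowerSeries.coeff_mk, Nat.sub_self, PowerSeries.coeff_zero_eq_constantCoeff_apply,
        hc, e1]
      rw [← hx]; ring
    rw [e2]; exact hD x
  refine ⟨q, ?_⟩
  by_cases h0 : f - q * b = 0
  · exact Or.inl h0
  · right
    refine ⟨(f - q * b).order.toNat, (f - q * b).divXPowOrder,
      PowerSeries.X_pow_order_mul_divXPowOrder.symm, ?_, ?_⟩
    · exact fun h => h0 (PowerSeries.constantCoeff_divXPowOrder_eq_zero_iff.1 h)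
    · have h1 : PowerSeries.constantCoeff (f - q * b).divXPowOrder =
          PowerSeries.coeff (f - q * b).order.toNat (f - q * b) := by
        rw [PowerSeries.constantCoeff_divXPowOrder]
      have h2 : PowerSeries.constantCoeff (f - q * b).divXPowOrder ≠ 0 :=
        fun h => h0 (PowerSeries.constantCoeff_divXPowOrder_eq_zero_iff.1 h)
      rw [h1] at h2 ⊢
      exact (key _).resolve_left h2

lemma isEuc_laurent (hB : IsEuc B) : IsEuc (LaurentSeries B) := by
  obtain ⟨φ, hφ⟩ := hB
  let S : LaurentSeries B → Set ℕ := fun l => {k | ∃ (z : ℤ) (h : PowerSeries B),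
    PowerSeries.constantCoeff h ≠ 0 ∧ k = φ (PowerSeries.constantCoeff h) ∧
    l = ((xi B ^ z : (LaurentSeries B)ˣ) : LaurentSeries B) * iS B h}
  refine ⟨fun l => sInf (S l), fun a b hb => ?_⟩
  have hne : (S b).Nonempty := by
    obtain ⟨N, g, rfl⟩ := exists_form b
    have hg : g ≠ 0 := by rintro rfl; simp at hb
    refine ⟨_, (N : ℤ) - (g.order.toNat : ℤ), g.divXPowOrder,
      fun h => hg (PowerSeries.constantCoeff_divXPowOrder_eq_zero_iff.1 h), rfl, ?_⟩
    conv_lhs => rw [← PowerSeries.X_pow_order_mul_divXPowOrder (f := g)]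
    rw [map_mul, map_pow, iS_X, _root_.zpow_sub, zpow_natCast, zpow_natCast, Units.val_mul,
      Units.val_pow_eq_pow_val, ← inv_pow, Units.val_pow_eq_pow_val]
    ring
  obtain ⟨z, b1, hb1, e, rfl⟩ := Nat.sInf_mem hne
  obtain ⟨N, f, rfl⟩ := exists_form a
  obtain ⟨q, hq⟩ := ps_div φ f b1 _ rfl (fun a => hφ a _ hb1)
  refine ⟨(xi B : LaurentSeries B) ^ N * (((xi B ^ z)⁻¹ : (LaurentSeries B)ˣ) : LaurentSeries B) * iS B q, ?_⟩
  have hz := Units.inv_mul (xi B ^ z)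
  have e3 : (xi B : LaurentSeries B) ^ N * iS B f - (xi B : LaurentSeries B) ^ N *
      (((xi B ^ z)⁻¹ : (LaurentSeries B)ˣ) : LaurentSeries B) * iS B q *
      (((xi B ^ z : (LaurentSeries B)ˣ) : LaurentSeries B) * iS B b1) =
      (xi B : LaurentSeries B) ^ N * iS B (f - q * b1) := by
    rw [map_sub, map_mul]
    linear_combination (- (xi B : LaurentSeries B) ^ N * iS B q * iS B b1) * hz
  rw [e3]
  rcases hq with hq | ⟨n, h, hq, h0, h1⟩
  · left; rw [hq, map_zero, mul_zero]
  · right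
    change sInf (S _) < sInf (S _)
    rw [e]
    refine lt_of_le_of_lt (Nat.sInf_le ?_) h1
    refine ⟨(N : ℤ) - n, h, h0, rfl, ?_⟩
    rw [hq, map_mul, map_pow, iS_X, _root_.zpow_sub, zpow_natCast, zpow_natCast, Units.val_mul,
      Units.val_pow_eq_pow_val, ← inv_pow, Units.val_pow_eq_pow_val]
    ring

end euc

theorem suslin {d : ℕ} (hd : 3 ≤ d) (m : ℕ) : ∀ (B : Type) [CommRing B] [IsDomain B], IsEuc B →
    ∀ g : SLd d (MvPolynomial (Fin m) B), g ∈ EE d (MvPolynomial (Fin m) B) := by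
  induction m with
  | zero =>
    intro B _ _ hB g
    let e := MvPolynomial.isEmptyRingEquiv B (Fin 0)
    have h1 := EE_map e.symm.toRingHom (EE_euc hB (mapSL e.toRingHom g))
    rw [mapSL_comp] at h1
    have : e.symm.toRingHom.comp e.toRingHom = RingHom.id _ := by ext <;> simp
    rwa [this, mapSL_id] at h1
  | succ m ih =>
    intro B _ _ hB g
    let e := (MvPolynomial.finSuccEquiv B m).toRingEquiv
    suffices h : ∀ g1 : SLd d (Polynomial (MvPolynomial (Fin m) B)), g1 ∈ EE d _ by
      have h1 := EE_map e.symm.toRingHom (h (mapSL e.toRingHom g))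
      rw [mapSL_comp] at h1
      have : e.symm.toRingHom.comp e.toRingHom = RingHom.id _ := by
        refine RingHom.ext fun x => ?_
        simp
      rwa [this, mapSL_id] at h1
    intro g1
    let θ : Polynomial (MvPolynomial (Fin m) B) →+* MvPolynomial (Fin m) (LaurentSeries B) :=
      Polynomial.eval₂RingHom (MvPolynomial.map ((iS B).comp PowerSeries.C))
        (MvPolynomial.C (xi B : LaurentSeries B))
    let ψ : MvPolynomial (Fin m) (LaurentSeries B) →+* LaurentSeries (MvPolynomial (Fin m) B) :=
      MvPolynomial.eval₂Hom (mapL (MvPolynomial.C))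
        (fun n => iS _ (PowerSeries.C (MvPolynomial.X n)))
    have hψθ : ψ.comp θ = iP _ := by
      refine Polynomial.ringHom_ext' ?_ ?_
      · refine MvPolynomial.ringHom_ext (fun b => ?_) (fun n => ?_)
        · simp [ψ, θ, iP_C, mapL_iS]
        · simp [ψ, θ, iP_C]
      · simp [ψ, θ, iP_X, mapL_xi]
    have h1 : mapSL (iP _) g1 ∈ EE d (LaurentSeries (MvPolynomial (Fin m) B)) := by
      rw [← hψθ, ← mapSL_comp]
      exact EE_map _ (ih (LaurentSeries B) (isEuc_laurent hB) _)
    have h2 := local_global hd g1 (by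
      intro M hM
      apply MI_local hd
      rw [← red_iP]
      exact EE_map _ h1)
    have h3 : mapSL (Polynomial.C.comp (Polynomial.evalRingHom 0)) g1 ∈
        EE d (Polynomial (MvPolynomial (Fin m) B)) := by
      rw [← mapSL_comp]
      exact EE_map _ (ih B hB _)
    have := mul_mem h2 h3
    rwa [inv_mul_cancel_right] at this

lemma isEuc_int : IsEuc ℤ := by
  refine ⟨Int.natAbs, fun a b hb => ⟨a / b, Or.inr ?_⟩⟩
  have : a - a / b * b = a % b := by rw [Int.emod_def, mul_comm b]
  rw [this]
  have h1 := Int.emod_nonneg a hb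
  have h2 := Int.emod_lt_abs a hb
  rw [Int.abs_eq_natAbs] at h2
  omega

theorem EE_top {d : ℕ} (hd : 3 ≤ d) (k : ℕ) (g : SLd d (MvPolynomial (Fin k) ℤ)) :
    g ∈ EE d (MvPolynomial (Fin k) ℤ) := suslin hd k ℤ isEuc_int g
end Lau

open Matrix
namespace Fou
open scoped ComplexConjugate
variable {M : Type*} [AddCommGroup M] [Fintype M]
variable {H : Type*} [NormedAddCommGroup H] [InnerProductSpace ℂ H] [CompleteSpace H]

noncomputable abbrev UU (H : Type*) [NormedAddCommGroup H] [InnerProductSpace ℂ H] [CompleteSpace H] :=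
  unitary (H →L[ℂ] H)

/-- apply a unitary to a vector -/
def ap (u : UU H) (v : H) : H := (u : H →L[ℂ] H) v

lemma ap_mul (u w : UU H) (v : H) : ap (u * w) v = ap u (ap w v) := rfl
lemma ap_one (v : H) : ap (1 : UU H) v = v := rfl
lemma ap_add (u : UU H) (v w : H) : ap u (v + w) = ap u v + ap u w := map_add _ _ _
lemma ap_sub (u : UU H) (v w : H) : ap u (v - w) = ap u v - ap u w := map_sub _ _ _
lemma ap_smul (u : UU H) (c : ℂ) (v : H) : ap u (c • v) = c • ap u v := map_smul _ _ _
lemma ap_zero (u : UU H) : ap u 0 = 0 := map_zero _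
lemma ap_sum (u : UU H) {ι : Type*} (s : Finset ι) (f : ι → H) :
    ap u (∑ i ∈ s, f i) = ∑ i ∈ s, ap u (f i) := map_sum _ _ _
lemma ap_inner (u : UU H) (v w : H) : inner ℂ (ap u v) (ap u w) = inner ℂ v w := by
  exact Unitary.inner_map_map u v w
lemma ap_norm (u : UU H) (v : H) : ‖ap u v‖ = ‖v‖ := by
  exact Unitary.norm_map u v
lemma ap_inv_ap (u : UU H) (v : H) : ap u⁻¹ (ap u v) = v := by
  rw [← ap_mul, inv_mul_cancel, ap_one]
lemma ap_ap_inv (u : UU H) (v : H) : ap u (ap u⁻¹ v) = v := by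
  rw [← ap_mul, mul_inv_cancel, ap_one]
lemma ap_inner_left (u : UU H) (v w : H) : inner ℂ (ap u v) w = inner ℂ v (ap u⁻¹ w) := by
  rw [← ap_inner u v, ap_ap_inv]
lemma ap_inv_disp (u : UU H) (v : H) : ‖ap u⁻¹ v - v‖ = ‖ap u v - v‖ := by
  rw [← ap_norm u, ap_sub, ap_ap_inv, norm_sub_rev]

variable (V : Multiplicative M →* UU H)

/-- spectral projections -/
noncomputable def P (χ : AddChar M ℂ) (v : H) : H :=
  ((Fintype.card M : ℂ))⁻¹ • ∑ m, (conj (χ m)) • ap (V (Multiplicative.ofAdd m)) v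

lemma V_P (χ : AddChar M ℂ) (v : H) (m : M) :
    ap (V (Multiplicative.ofAdd m)) (P V χ v) = χ m • P V χ v := by
  unfold P
  rw [ap_smul, ap_sum, smul_comm (χ m)]
  congr 1
  rw [Finset.smul_sum]
  rw [← Equiv.sum_comp (Equiv.addLeft m) (fun n => χ m • (conj (χ n)) • ap (V (Multiplicative.ofAdd n)) v)]
  refine Finset.sum_congr rfl fun n _ => ?_
  rw [ap_smul, ← ap_mul, ← map_mul, ← ofAdd_add, Equiv.coe_addLeft, AddChar.map_add_eq_mul, map_mul,
    smul_smul, ← mul_assoc, Complex.mul_conj, Complex.normSq_eq_norm_sq, AddChar.norm_apply]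
  simp

lemma P_orth {χ ψ : AddChar M ℂ} (h : χ ≠ ψ) (v w : H) : inner ℂ (P V χ v) (P V ψ w) = 0 := by
  obtain ⟨m, hm⟩ := DFunLike.ne_iff.1 h
  have h1 := ap_inner (V (Multiplicative.ofAdd m)) (P V χ v) (P V ψ w)
  rw [V_P, V_P, inner_smul_left, inner_smul_right] at h1
  have h2 : χ m * conj (χ m) = 1 := by
    rw [Complex.mul_conj, Complex.normSq_eq_norm_sq, AddChar.norm_apply]; simp
  by_contra h0
  have h3 : conj (χ m) * ψ m = 1 := by
    apply mul_right_cancel₀ h0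
    rw [one_mul, mul_assoc, h1]
  apply hm
  linear_combination (-χ m) * h3 + ψ m * h2

lemma P_sum (v : H) : ∑ χ : AddChar M ℂ, P V χ v = v := by
  classical
  unfold P
  rw [← Finset.smul_sum, Finset.sum_comm]
  have : ∀ m : M, ∑ χ : AddChar M ℂ, conj (χ m) • ap (V (Multiplicative.ofAdd m)) v =
      if m = 0 then (Fintype.card M : ℂ) • v else 0 := by
    intro m
    rw [← Finset.sum_smul, ← map_sum, AddChar.sum_apply_eq_ite]
    split_ifs with h
    · subst h; simp [ap_one]
    · simp
  rw [Finset.sum_congr rfl fun m _ => this m, Finset.sum_ite_eq' Finset.univ (0:M), if_pos (Finset.mem_univ _), smul_smul,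
    inv_mul_cancel₀ (by exact_mod_cast Fintype.card_ne_zero), one_smul]

lemma pyth {ι : Type*} (s : Finset ι) (f : ι → H)
    (h : ∀ i j, i ≠ j → inner ℂ (f i) (f j) = 0) :
    ‖∑ i ∈ s, f i‖ ^ 2 = ∑ i ∈ s, ‖f i‖ ^ 2 := by
  classical
  induction s using Finset.induction_on with
  | empty => simp
  | insert a s ha ih =>
    rw [Finset.sum_insert ha, Finset.sum_insert ha, ← ih, sq, sq, sq]
    apply norm_add_sq_eq_norm_sq_add_norm_sq_of_inner_eq_zero (𝕜 := ℂ)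
    rw [inner_sum]
    exact Finset.sum_eq_zero fun i hi => h _ _ (by rintro rfl; exact ha hi)

/-- spectral measure -/
noncomputable def mu (v : H) (χ : AddChar M ℂ) : ℝ := ‖P V χ v‖ ^ 2

lemma mu_nonneg (v : H) (χ : AddChar M ℂ) : 0 ≤ mu V v χ := sq_nonneg _

lemma mu_sum (v : H) (B : Finset (AddChar M ℂ)) : ‖∑ χ ∈ B, P V χ v‖ ^ 2 = ∑ χ ∈ B, mu V v χ :=
  pyth B _ fun _ _ h => P_orth V h _ _

lemma mu_disp (v : H) (m : M) : ‖ap (V (Multiplicative.ofAdd m)) v - v‖ ^ 2 =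
    ∑ χ, ‖χ m - 1‖ ^ 2 * mu V v χ := by
  have : ap (V (Multiplicative.ofAdd m)) v - v = ∑ χ : AddChar M ℂ, (χ m - 1) • P V χ v := by
    conv_lhs => rw [← P_sum V v]
    rw [ap_sum, ← Finset.sum_sub_distrib]
    refine Finset.sum_congr rfl fun χ _ => ?_
    rw [V_P, sub_smul, one_smul]
  rw [this, pyth]
  · refine Finset.sum_congr rfl fun χ _ => ?_
    rw [norm_smul, mul_pow]; rfl
  · intro i j hij
    rw [inner_smul_left, inner_smul_right, P_orth V hij]; simp

lemma P_intertwine (g : UU H) (σ : M ≃+ M)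
    (h : ∀ m, g * V (Multiplicative.ofAdd m) = V (Multiplicative.ofAdd (σ m)) * g)
    (χ : AddChar M ℂ) (v : H) :
    P V χ (ap g v) = ap g (P V (χ.compAddMonoidHom σ.toAddMonoidHom) v) := by
  unfold P
  rw [ap_smul, ap_sum]
  congr 1
  rw [← Equiv.sum_comp σ.toEquiv]
  refine Finset.sum_congr rfl fun n _ => ?_
  rw [ap_smul, ← ap_mul, ← ap_mul, h]
  rfl

lemma mu_qi (g : UU H) (σ : M ≃+ M)
    (h : ∀ m, g * V (Multiplicative.ofAdd m) = V (Multiplicative.ofAdd (σ m)) * g)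
    (v : H) (B : Finset (AddChar M ℂ)) :
    √(∑ χ ∈ B, mu V v χ) ≤
      √(∑ χ ∈ B, mu V v (χ.compAddMonoidHom σ.toAddMonoidHom)) + ‖ap g v - v‖ := by
  have e1 : √(∑ χ ∈ B, mu V v χ) = ‖∑ χ ∈ B, P V χ v‖ := by
    rw [← mu_sum, Real.sqrt_sq (norm_nonneg _)]
  have e2 : √(∑ χ ∈ B, mu V v (χ.compAddMonoidHom σ.toAddMonoidHom)) =
      ‖∑ χ ∈ B, P V χ (ap g v)‖ := by
    rw [← Real.sqrt_sq (norm_nonneg _), mu_sum]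
    congr 1
    refine Finset.sum_congr rfl fun χ _ => ?_
    unfold mu
    rw [P_intertwine V g σ h, ap_norm]
  have e3 : ‖∑ χ ∈ B, P V χ (v - ap g v)‖ ≤ ‖v - ap g v‖ := by
    apply le_of_sq_le_sq _ (norm_nonneg _)
    rw [mu_sum]
    conv_rhs => rw [← P_sum V (v - ap g v), mu_sum]
    exact Finset.sum_le_sum_of_subset_of_nonneg (Finset.subset_univ _) fun _ _ _ => mu_nonneg _ _ _
  have e4 : ∑ χ ∈ B, P V χ v = ∑ χ ∈ B, P V χ (v - ap g v) + ∑ χ ∈ B, P V χ (ap g v) := by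
    rw [← Finset.sum_add_distrib]
    refine Finset.sum_congr rfl fun χ _ => ?_
    unfold P
    rw [← smul_add, ← Finset.sum_add_distrib]
    congr 1
    refine Finset.sum_congr rfl fun m _ => ?_
    rw [← smul_add, ← ap_add, sub_add_cancel]
  rw [e1, e2, e4, add_comm]
  refine (norm_add_le _ _).trans ?_
  rw [norm_sub_rev (ap g v)]
  linarith

lemma P_one_fixed (v : H) (m : M) : ap (V (Multiplicative.ofAdd m)) (P V 1 v) = P V 1 v := by
  rw [V_P]; simp

lemma mu_rest (v : H) : ‖v - P V 1 v‖ ^ 2 = ∑ χ ∈ Finset.univ.filter (fun χ : AddChar M ℂ => χ ≠ 1), mu V v χ := by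
  classical
  rw [← mu_sum]
  congr 2
  rw [sub_eq_iff_eq_add]
  conv_lhs => rw [← P_sum V v]
  rw [← Finset.sum_filter_add_sum_filter_not Finset.univ (fun χ : AddChar M ℂ => χ ≠ 1)]
  congr 1
  simp [Finset.filter_eq']
end Fou

open Matrix
namespace Fou
section comb
open Classical
variable {Ω : Type*} [Fintype Ω]

/-- mass of a set -/
noncomputable def ms (μ : Ω → ℝ) (p : Ω → Prop) : ℝ := ∑ ω ∈ Finset.univ.filter p, μ ω

/-- quasi-invariance -/
def Qi (μ : Ω → ℝ) (τ : Ω → Ω) (e : ℝ) : Prop :=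
  Function.Injective τ ∧ ∀ B : Finset Ω, √(∑ ω ∈ B, μ ω) ≤ √(∑ ω ∈ B, μ (τ ω)) + e

variable {μ : Ω → ℝ}

lemma ms_nonneg (hμ : ∀ ω, 0 ≤ μ ω) (p : Ω → Prop) : 0 ≤ ms μ p := Finset.sum_nonneg fun _ _ => hμ _

lemma ms_mono (hμ : ∀ ω, 0 ≤ μ ω) {p q : Ω → Prop} (h : ∀ ω, p ω → q ω) : ms μ p ≤ ms μ q :=
  Finset.sum_le_sum_of_subset_of_nonneg
    (fun ω hω => by simp only [Finset.mem_filter] at hω ⊢; exact ⟨hω.1, h _ hω.2⟩)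
    fun _ _ _ => hμ _

lemma ms_split (p q : Ω → Prop) : ms μ p = ms μ (fun ω => p ω ∧ q ω) + ms μ (fun ω => p ω ∧ ¬ q ω) := by
  unfold ms
  rw [← Finset.sum_filter_add_sum_filter_not (Finset.univ.filter p) q, Finset.filter_filter, Finset.filter_filter]
  congr!

lemma ms_disj (hμ : ∀ ω, 0 ≤ μ ω) {p q r : Ω → Prop} (h1 : ∀ ω, p ω → r ω) (h2 : ∀ ω, q ω → r ω)
    (h : ∀ ω, p ω → ¬ q ω) : ms μ p + ms μ q ≤ ms μ r := by
  rw [ms_split r p]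
  exact add_le_add (ms_mono hμ fun ω hω => ⟨h1 _ hω, hω⟩) (ms_mono hμ fun ω hω => ⟨h2 _ hω, fun hp => h _ hp hω⟩)

lemma ms_or (hμ : ∀ ω, 0 ≤ μ ω) {p q r : Ω → Prop} (h1 : ∀ ω, r ω → p ω ∨ q ω) : ms μ r ≤ ms μ p + ms μ q := by
  rw [ms_split r p]
  refine add_le_add (ms_mono hμ fun ω hω => hω.2) (ms_mono hμ fun ω hω => ?_)
  exact (h1 _ hω.1).resolve_left hω.2

lemma img_le (hμ : ∀ ω, 0 ≤ μ ω) {τ : Ω → Ω} (hτ : Function.Injective τ) {p q : Ω → Prop}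
    (h : ∀ ω, p ω → q (τ ω)) : ∑ ω ∈ Finset.univ.filter p, μ (τ ω) ≤ ms μ q := by
  have : ∑ ω ∈ Finset.univ.filter p, μ (τ ω) = ∑ ω ∈ (Finset.univ.filter p).map ⟨τ, hτ⟩, μ ω := by
    rw [Finset.sum_map]; rfl
  rw [this]
  refine Finset.sum_le_sum_of_subset_of_nonneg (fun ω hω => ?_) fun _ _ _ => hμ _
  simp only [Finset.mem_map, Finset.mem_filter, Finset.mem_univ, true_and] at hω ⊢
  obtain ⟨a, ha, rfl⟩ := hω
  exact h a ha

lemma qi_set (hμ : ∀ ω, 0 ≤ μ ω) {τ : Ω → Ω} {e : ℝ} (hτ : Qi μ τ e) {p q : Ω → Prop}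
    (h : ∀ ω, p ω → q (τ ω)) : √(ms μ p) ≤ √(ms μ q) + e :=
  (hτ.2 _).trans (by gcongr; exact img_le hμ hτ.1 h)

/-- the sector estimate -/
lemma sector (hμ : ∀ ω, 0 ≤ μ ω) (X Y : Ω → ℝ) (τp τq : Ω → Ω) (hp : Qi μ τp 1) (hq : Qi μ τq 1)
    (h1 : ∀ ω, |X ω| + |Y ω| < Real.pi → X (τp ω) = X ω ∧ Y (τp ω) = X ω + Y ω)
    (h2 : ∀ ω, |X ω| + |Y ω| < Real.pi → X (τq ω) = X ω + Y ω ∧ Y (τq ω) = Y ω) :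
    let s := ms μ (fun ω => 0 < X ω * Y ω ∨ (Y ω = 0 ∧ X ω ≠ 0))
    let o := ms μ (fun ω => (0 < X ω * Y ω ∨ (Y ω = 0 ∧ X ω ≠ 0)) ∧ ¬ (|X ω| + |Y ω| < Real.pi))
    s ≤ 2 * √2 * √s + 2 + 2 * o := by
  intro s o
  set q := ms μ (fun ω => (0 < X ω * Y ω ∨ (Y ω = 0 ∧ X ω ≠ 0)) ∧ (|X ω| + |Y ω| < Real.pi)) with hq'
  have e0 : s = q + o := ms_split _ _
  have hα := qi_set hμ hp (p := fun ω => (0 < X ω * Y ω ∨ (Y ω = 0 ∧ X ω ≠ 0)) ∧ (|X ω| + |Y ω| < Real.pi))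
    (q := fun ω => 0 < X ω * Y ω ∧ |X ω| ≤ |Y ω|) (by
      intro ω ⟨hω, hD⟩
      simp only [(h1 ω hD).1, (h1 ω hD).2]
      have hx : X ω ≠ 0 := by rcases hω with h | h; (rintro h0; simp [h0] at h); exact h.2
      have hxy : 0 ≤ X ω * Y ω := by rcases hω with h | h; exact h.le; simp [h.1]
      have : 0 < X ω ^ 2 := by positivity
      refine ⟨by nlinarith, ?_⟩
      rw [← sq_le_sq]; nlinarith [sq_nonneg (Y ω)])
  have hβ := qi_set hμ hq (p := fun ω => (0 < X ω * Y ω ∨ (Y ω = 0 ∧ X ω ≠ 0)) ∧ (|X ω| + |Y ω| < Real.pi))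
    (q := fun ω => 0 ≤ X ω * Y ω ∧ |Y ω| < |X ω|) (by
      intro ω ⟨hω, hD⟩
      simp only [(h2 ω hD).1, (h2 ω hD).2]
      have hx : X ω ≠ 0 := by rcases hω with h | h; (rintro h0; simp [h0] at h); exact h.2
      have hxy : 0 ≤ X ω * Y ω := by rcases hω with h | h; exact h.le; simp [h.1]
      have : 0 < X ω ^ 2 := by positivity
      refine ⟨by nlinarith [sq_nonneg (Y ω)], ?_⟩
      rw [← sq_lt_sq]; nlinarith [sq_nonneg (Y ω)])
  have hab := ms_disj hμ (p := fun ω => 0 < X ω * Y ω ∧ |X ω| ≤ |Y ω|)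
    (q := fun ω => 0 ≤ X ω * Y ω ∧ |Y ω| < |X ω|)
    (r := fun ω => 0 < X ω * Y ω ∨ (Y ω = 0 ∧ X ω ≠ 0)) (fun ω h => Or.inl h.1)
    (fun ω h => by
      rcases h.1.lt_or_eq with h' | h'
      · exact Or.inl h'
      · right
        have hx : X ω ≠ 0 := by
          intro h0
          have := h.2
          rw [h0, abs_zero] at this
          exact absurd this (not_lt.2 (abs_nonneg _))
        refine ⟨?_, hx⟩
        rcases mul_eq_zero.1 h'.symm with h0 | h0
        · exact absurd h0 hx
        · exact h0) (fun ω h h' => absurd h.2 (not_le.2 h'.2))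
  set a := ms μ (fun ω => 0 < X ω * Y ω ∧ |X ω| ≤ |Y ω|)
  set b := ms μ (fun ω => 0 ≤ X ω * Y ω ∧ |Y ω| < |X ω|)
  change a + b ≤ s at hab
  change √q ≤ √a + 1 at hα
  change √q ≤ √b + 1 at hβ
  have sa := Real.sq_sqrt (ms_nonneg hμ _ : 0 ≤ a)
  have sb := Real.sq_sqrt (ms_nonneg hμ _ : 0 ≤ b)
  have sq' := Real.sq_sqrt (ms_nonneg hμ _ : 0 ≤ q)
  have ss := Real.sq_sqrt (ms_nonneg hμ _ : 0 ≤ s)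
  have s2 := Real.sq_sqrt (by norm_num : (0:ℝ) ≤ 2)
  have na := Real.sqrt_nonneg a
  have nb := Real.sqrt_nonneg b
  have nq := Real.sqrt_nonneg q
  have ns := Real.sqrt_nonneg s
  have h3 : √a + √b ≤ √2 * √s := by
    apply le_of_sq_le_sq _ (by positivity)
    rw [mul_pow, s2, ss]
    nlinarith [sq_nonneg (√a - √b)]
  nlinarith

/-- planar estimate -/
lemma planar (hμ : ∀ ω, 0 ≤ μ ω) (X Y : Ω → ℝ) (τ1 τ2 τ3 τ4 : Ω → Ω)
    (hq1 : Qi μ τ1 1) (hq2 : Qi μ τ2 1) (hq3 : Qi μ τ3 1) (hq4 : Qi μ τ4 1)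
    (h1 : ∀ ω, |X ω| + |Y ω| < Real.pi → X (τ1 ω) = X ω ∧ Y (τ1 ω) = X ω + Y ω)
    (h2 : ∀ ω, |X ω| + |Y ω| < Real.pi → X (τ2 ω) = X ω + Y ω ∧ Y (τ2 ω) = Y ω)
    (h3 : ∀ ω, |X ω| + |Y ω| < Real.pi → X (τ3 ω) = X ω - Y ω ∧ Y (τ3 ω) = Y ω)
    (h4 : ∀ ω, |X ω| + |Y ω| < Real.pi → X (τ4 ω) = X ω ∧ Y (τ4 ω) = Y ω - X ω)
    (ho : ms μ (fun ω => ¬ (|X ω| + |Y ω| < Real.pi)) ≤ 1 / 2) :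
    ms μ (fun ω => X ω ≠ 0 ∨ Y ω ≠ 0) ≤ 25 := by
  have A := sector hμ X Y τ1 τ2 hq1 hq2 h1 h2
  have B := sector hμ Y (fun ω => - X ω) τ3 τ4 hq3 hq4
    (fun ω h => by
      have := h3 ω (by simpa [add_comm] using h)
      exact ⟨this.2, by linarith [this.1]⟩)
    (fun ω h => by
      have := h4 ω (by simpa [add_comm] using h)
      exact ⟨by linarith [this.2], by linarith [this.1]⟩)
  dsimp only at A B
  set s := ms μ (fun ω => 0 < X ω * Y ω ∨ (Y ω = 0 ∧ X ω ≠ 0))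
  set t := ms μ (fun ω => 0 < Y ω * -X ω ∨ (- X ω = 0 ∧ Y ω ≠ 0))
  have h5 : ms μ (fun ω => X ω ≠ 0 ∨ Y ω ≠ 0) ≤ s + t := ms_or hμ (by
    intro ω h
    by_cases hx : X ω = 0
    · right; right; simp [hx] at h ⊢; exact h
    · by_cases hy : Y ω = 0
      · left; right; exact ⟨hy, hx⟩
      · rcases lt_or_gt_of_ne (mul_ne_zero hx hy) with h | h
        · right; left; linarith
        · left; left; exact h)
  have h6 := ms_disj hμ
    (p := fun ω => (0 < X ω * Y ω ∨ (Y ω = 0 ∧ X ω ≠ 0)) ∧ ¬ (|X ω| + |Y ω| < Real.pi))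
    (q := fun ω => (0 < Y ω * - X ω ∨ (- X ω = 0 ∧ Y ω ≠ 0)) ∧ ¬ (|Y ω| + |-X ω| < Real.pi))
    (r := fun ω => ¬ (|X ω| + |Y ω| < Real.pi)) (fun ω h => h.2)
    (fun ω h => by have := h.2; rwa [abs_neg, add_comm] at this)
    (fun ω h h' => by
      rcases h.1 with a | a <;> rcases h'.1 with b | b
      · nlinarith
      · have : X ω = 0 := by linarith [b.1]
        simp [this] at a
      · simp [a.1] at b
      · exact b.2 a.1)
  have ns : 0 ≤ s := ms_nonneg hμ _
  have nt : 0 ≤ t := ms_nonneg hμ _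
  have ss := Real.sq_sqrt ns
  have st := Real.sq_sqrt nt
  have h7 : √2 * (√s + √t) ≤ 2 * √(s + t) := by
    apply le_of_sq_le_sq _ (by positivity)
    rw [mul_pow, mul_pow, Real.sq_sqrt (by norm_num : (0:ℝ) ≤ 2), Real.sq_sqrt (by positivity)]
    nlinarith [sq_nonneg (√s - √t)]
  have h8 : s + t ≤ 4 * √(s + t) + 5 := by nlinarith
  have h9 := Real.sq_sqrt (by positivity : 0 ≤ s + t)
  have h10 := Real.sqrt_nonneg (s + t)
  have h11 : √(s + t) ≤ 5 := by nlinarith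
  nlinarith

lemma mink {ι : Type*} (s : Finset ι) (f g : ι → ℝ) (hf : ∀ i, 0 ≤ f i)
    (hg : ∀ i, 0 ≤ g i) (h : ∀ i ∈ s, √(f i) ≤ √(g i) + 1) (k : ℝ) (hk : (s.card : ℝ) ≤ k) :
    ∑ i ∈ s, f i ≤ ∑ i ∈ s, g i + 2 * √k * √(∑ i ∈ s, g i) + k := by
  have h1 : ∀ i ∈ s, f i ≤ g i + 2 * √(g i) + 1 := by
    intro i hi
    have := h i hi
    have a := Real.sq_sqrt (hf i)
    have b := Real.sq_sqrt (hg i)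
    nlinarith [Real.sqrt_nonneg (f i), Real.sqrt_nonneg (g i)]
  have h2 : ∑ i ∈ s, √(g i) ≤ √k * √(∑ i ∈ s, g i) := by
    have k0 : 0 ≤ k := le_trans (by positivity) hk
    apply le_of_sq_le_sq _ (by positivity)
    have := sq_sum_le_card_mul_sum_sq (s := s) (f := fun i => √(g i))
    rw [mul_pow, Real.sq_sqrt k0, Real.sq_sqrt (Finset.sum_nonneg fun i _ => hg i)]
    refine this.trans ?_
    rw [Finset.sum_congr rfl fun i _ => Real.sq_sqrt (hg i)]
    gcongr
    exact Finset.sum_nonneg fun i _ => hg i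
  refine (Finset.sum_le_sum h1).trans ?_
  rw [Finset.sum_add_distrib, Finset.sum_add_distrib, ← Finset.mul_sum]
  simp
  nlinarith

end comb
end Fou

open Matrix
namespace Fou
section comb
open Classical
variable {Ω : Type*} [Fintype Ω] {μ : Ω → ℝ}
variable {Λ : Type*} [AddCommMonoid Λ] [LinearOrder Λ] [IsOrderedCancelAddMonoid Λ]

lemma ms_sum_le (hμ : ∀ ω, 0 ≤ μ ω) {k : ℕ} (p : Fin k → Ω → Prop) (q : Ω → Prop)
    (h1 : ∀ i ω, p i ω → q ω) (h2 : ∀ i j ω, p i ω → p j ω → i = j) :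
    ∑ i, ms μ (p i) ≤ ms μ q := by
  unfold ms
  rw [← Finset.sum_biUnion]
  · refine Finset.sum_le_sum_of_subset_of_nonneg (fun ω hω => ?_) fun _ _ _ => hμ _
    simp only [Finset.mem_biUnion, Finset.mem_filter, Finset.mem_univ, true_and] at hω ⊢
    obtain ⟨i, hi⟩ := hω
    exact h1 i ω hi
  · intro i _ j _ hij
    rw [Function.onFun, Finset.disjoint_left]
    intro ω h h'
    simp only [Finset.mem_filter, Finset.mem_univ, true_and] at h h'
    exact hij (h2 _ _ _ h h')

lemma ms_le_sum (hμ : ∀ ω, 0 ≤ μ ω) {k : ℕ} (p : Fin k → Ω → Prop) (q : Ω → Prop)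
    (h1 : ∀ ω, q ω → ∃ i, p i ω) :
    ms μ q ≤ ∑ i, ms μ (p i) := by
  have h : ms μ q ≤ ∑ i, ms μ (fun ω => q ω ∧ p i ω) := by
    unfold ms
    simp only [Finset.sum_filter]
    rw [Finset.sum_comm]
    refine Finset.sum_le_sum fun ω _ => ?_
    split_ifs with hq
    · obtain ⟨i, hi⟩ := h1 ω hq
      refine le_trans ?_ (Finset.single_le_sum (fun i _ => ?_) (Finset.mem_univ i))
      · rw [if_pos ⟨hq, hi⟩]
      · split_ifs; exact hμ _; exact le_rfl
    · refine Finset.sum_nonneg (fun i _ => ?_)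
      split_ifs; exact hμ _; exact le_rfl
  exact h.trans (Finset.sum_le_sum fun i _ => ms_mono hμ fun ω h => h.2)

lemma ms_empty {p : Ω → Prop} (h : ∀ ω, ¬ p ω) : ms μ p = 0 := by
  unfold ms
  rw [Finset.filter_false_of_mem fun ω _ => h ω, Finset.sum_empty]

lemma sqrt_add_le' {a b : ℝ} (ha : 0 ≤ a) (hb : 0 ≤ b) : √(a + b) ≤ √a + √b := by
  rw [Real.sqrt_le_left (by positivity)]
  nlinarith [Real.sq_sqrt ha, Real.sq_sqrt hb, Real.sqrt_nonneg a, Real.sqrt_nonneg b]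

lemma final_num {k q b x0 x1 x2 : ℝ} (hk1 : 1 ≤ k) (hq : 4 * k ≤ q) (a0 : 0 ≤ b) (sx0 : b ^ 2 = x0)
    (main : 2 * x0 ≤ 25 + 2 * k + 4 * (k * (b + 6))) (u1 : x1 ≤ (b + 1) ^ 2) (u2 : x2 ≤ (b + 1) ^ 2) :
    25 + (x0 + (x1 + x2)) ≤ 25 * (q * q) := by
  have hb : b ≤ 2 * q := by
    by_contra hc
    push Not at hc
    have w1 : 4 * (k * (b + 6)) ≤ q * (b + 6) := by nlinarith
    have w2 : q * b ≤ b ^ 2 / 2 := by nlinarith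
    have w3 : 16 * q ≤ b ^ 2 := by nlinarith
    nlinarith
  have w4 : b ^ 2 ≤ 4 * (q * q) := by nlinarith
  nlinarith

lemma half (hμ : ∀ ω, 0 ≤ μ ω) {k : ℕ} (l1 l2 : Ω → WithTop Λ) (e : Fin k → Λ)
    (he : Function.Injective e) (he0 : ∀ i, 0 < e i) (hex : ∀ n : Λ, n ≠ 0 → ∃ i n', n = n' + e i)
    (τ : Fin k → Ω → Ω) (hτ : ∀ i, Qi μ (τ i) 1)
    (h : ∀ i ω (n : Λ), l1 ω ≤ l2 ω → l1 ω = ((n + e i : Λ) : WithTop Λ) →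
      l1 (τ i ω) = ((n + e i : Λ) : WithTop Λ) ∧ l2 (τ i ω) = (n : WithTop Λ)) :
    ms μ (fun ω => l1 ω ≤ l2 ω ∧ l1 ω ≠ 0 ∧ l1 ω ≠ ⊤) ≤
      ms μ (fun ω => l2 ω < l1 ω) + 2 * √k * √(ms μ (fun ω => l2 ω < l1 ω)) + k := by
  rcases isEmpty_or_nonempty (Fin k) with hE | ⟨⟨i0⟩⟩
  · have e0 : ms μ (fun ω => l1 ω ≤ l2 ω ∧ l1 ω ≠ 0 ∧ l1 ω ≠ ⊤) = 0 := by
      apply ms_empty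
      rintro ω ⟨-, h2, h3⟩
      obtain ⟨n, hn⟩ := WithTop.ne_top_iff_exists.1 h3
      obtain ⟨i, -⟩ := hex n (by rintro rfl; exact h2 hn.symm)
      exact hE.elim i
    rw [e0]
    have := ms_nonneg hμ (fun ω => l2 ω < l1 ω)
    positivity
  have hex' : ∀ n : Λ, ∃ i n', n ≠ 0 → n = n' + e i := by
    intro n
    by_cases hn : n = 0
    · exact ⟨i0, 0, fun h => absurd hn h⟩
    · obtain ⟨i, n', h⟩ := hex n hn
      exact ⟨i, n', fun _ => h⟩
  choose ι pr hι using hex'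
  let F : Fin k → Ω → Prop := fun i ω => l1 ω ≤ l2 ω ∧ ∃ n : Λ, n ≠ 0 ∧ l1 ω = (n : WithTop Λ) ∧ ι n = i
  let G : Fin k → Ω → Prop := fun i ω => ∃ n : Λ, l1 ω = ((n + e i : Λ) : WithTop Λ) ∧ l2 ω = (n : WithTop Λ)
  have h1 : ∑ i, ms μ (G i) ≤ ms μ (fun ω => l2 ω < l1 ω) := by
    apply ms_sum_le hμ
    · rintro i ω ⟨n, h1, h2⟩
      rw [h1, h2, WithTop.coe_lt_coe]
      exact lt_add_of_pos_right n (he0 i)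
    · rintro i j ω ⟨n, h1, h2⟩ ⟨n', h1', h2'⟩
      rw [h2, WithTop.coe_inj] at h2'
      subst h2'
      rw [h1, WithTop.coe_inj] at h1'
      exact he (add_left_cancel h1')
  have h2 : ms μ (fun ω => l1 ω ≤ l2 ω ∧ l1 ω ≠ 0 ∧ l1 ω ≠ ⊤) ≤ ∑ i, ms μ (F i) := by
    apply ms_le_sum hμ
    rintro ω ⟨h1, h2, h3⟩
    obtain ⟨n, hn⟩ := WithTop.ne_top_iff_exists.1 h3
    exact ⟨ι n, h1, n, by rintro rfl; exact h2 hn.symm, hn.symm, rfl⟩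
  have h3 := mink Finset.univ (fun i => ms μ (F i)) (fun i => ms μ (G i))
    (fun i => ms_nonneg hμ _) (fun i => ms_nonneg hμ _) (fun i _ => qi_set hμ (hτ i) (by
      rintro ω ⟨h1, n, h2, h3, rfl⟩
      have := h (ι n) ω (pr n) h1 (by rw [← hι n h2, h3])
      exact ⟨_, this⟩)) k (by simp)
  refine (h2.trans h3).trans ?_
  gcongr

lemma leads (hμ : ∀ ω, 0 ≤ μ ω) {k : ℕ} (l1 l2 : Ω → WithTop Λ) (e : Fin k → Λ)
    (he : Function.Injective e) (he0 : ∀ i, 0 < e i) (hex : ∀ n : Λ, n ≠ 0 → ∃ i n', n = n' + e i)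
    (τ τ' : Fin k → Ω → Ω) (hτ : ∀ i, Qi μ (τ i) 1) (hτ' : ∀ i, Qi μ (τ' i) 1)
    (h : ∀ i ω (n : Λ), l1 ω ≤ l2 ω → l1 ω = ((n + e i : Λ) : WithTop Λ) →
      l1 (τ i ω) = ((n + e i : Λ) : WithTop Λ) ∧ l2 (τ i ω) = (n : WithTop Λ))
    (h' : ∀ i ω (n : Λ), l2 ω ≤ l1 ω → l2 ω = ((n + e i : Λ) : WithTop Λ) →
      l2 (τ' i ω) = ((n + e i : Λ) : WithTop Λ) ∧ l1 (τ' i ω) = (n : WithTop Λ))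
    (σ σ' : Ω → Ω) (hσ : Qi μ σ 1) (hσ' : Qi μ σ' 1)
    (g : ∀ ω, l1 ω < l2 ω → l1 (σ ω) = l1 ω ∧ l2 (σ ω) = l1 ω)
    (g' : ∀ ω, l2 ω < l1 ω → l1 (σ' ω) = l2 ω ∧ l2 (σ' ω) = l2 ω)
    (hz : ms μ (fun ω => l1 ω = 0 ∨ l2 ω = 0) ≤ 25) :
    ms μ (fun ω => l1 ω ≠ ⊤ ∨ l2 ω ≠ ⊤) ≤ 25 * 16 ^ k := by
  rcases Nat.eq_zero_or_pos k with rfl | hk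
  · refine (ms_mono hμ ?_).trans (hz.trans (by norm_num))
    have key : ∀ x : WithTop Λ, x ≠ ⊤ → x = 0 := by
      intro x hx
      obtain ⟨n, rfl⟩ := WithTop.ne_top_iff_exists.1 hx
      by_contra hn
      obtain ⟨i, -⟩ := hex n (by rintro rfl; exact hn rfl)
      exact i.elim0
    exact fun ω h => h.imp (key _) (key _)
  have A := half hμ l1 l2 e he he0 hex τ hτ h
  have B := half hμ l2 l1 e he he0 hex τ' hτ' h'
  set x0 := ms μ (fun ω => l1 ω = l2 ω ∧ l1 ω ≠ 0 ∧ l1 ω ≠ ⊤) with hx0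
  set x1 := ms μ (fun ω => l1 ω < l2 ω ∧ l1 ω ≠ 0 ∧ l2 ω ≠ 0) with hx1
  set x2 := ms μ (fun ω => l2 ω < l1 ω ∧ l1 ω ≠ 0 ∧ l2 ω ≠ 0) with hx2
  set z1 := ms μ (fun ω => l1 ω < l2 ω ∧ (l1 ω = 0 ∨ l2 ω = 0)) with hz1
  set z2 := ms μ (fun ω => l2 ω < l1 ω ∧ (l1 ω = 0 ∨ l2 ω = 0)) with hz2
  have n0 : 0 ≤ x0 := ms_nonneg hμ _
  have n1 : 0 ≤ x1 := ms_nonneg hμ _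
  have n2 : 0 ≤ x2 := ms_nonneg hμ _
  have m1 : 0 ≤ z1 := ms_nonneg hμ _
  have m2 : 0 ≤ z2 := ms_nonneg hμ _
  have hzz : z1 + z2 ≤ ms μ (fun ω => l1 ω = 0 ∨ l2 ω = 0) :=
    ms_disj hμ (fun ω h => h.2) (fun ω h => h.2) (fun ω h h' => lt_asymm h.1 h'.1)
  have s1 : √x1 ≤ √x0 + 1 := qi_set hμ hσ (by
    rintro ω ⟨h1, h2, h3⟩
    rw [(g ω h1).1, (g ω h1).2]
    exact ⟨rfl, h2, (lt_top_of_lt h1).ne⟩)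
  have s2 : √x2 ≤ √x0 + 1 := qi_set hμ hσ' (by
    rintro ω ⟨h1, h2, h3⟩
    rw [(g' ω h1).1, (g' ω h1).2]
    exact ⟨rfl, h3, (lt_top_of_lt h1).ne⟩)
  have f1 : x1 + x0 ≤ ms μ (fun ω => l1 ω ≤ l2 ω ∧ l1 ω ≠ 0 ∧ l1 ω ≠ ⊤) :=
    ms_disj hμ (fun ω h => ⟨h.1.le, h.2.1, (lt_top_of_lt h.1).ne⟩) (fun ω h => ⟨h.1.le, h.2⟩)
      (fun ω h h' => h.1.ne h'.1)
  have f2 : x2 + x0 ≤ ms μ (fun ω => l2 ω ≤ l1 ω ∧ l2 ω ≠ 0 ∧ l2 ω ≠ ⊤) :=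
    ms_disj hμ (fun ω h => ⟨h.1.le, h.2.2, (lt_top_of_lt h.1).ne⟩)
      (fun ω h => ⟨h.1.ge, h.1 ▸ h.2.1, h.1 ▸ h.2.2⟩)
      (fun ω h h' => h.1.ne h'.1.symm)
  have g1 : ms μ (fun ω => l1 ω < l2 ω) ≤ x1 + z1 := ms_or hμ (by
    intro ω h; by_cases a : l1 ω = 0 <;> by_cases b : l2 ω = 0 <;> tauto)
  have g2 : ms μ (fun ω => l2 ω < l1 ω) ≤ x2 + z2 := ms_or hμ (by
    intro ω h; by_cases a : l1 ω = 0 <;> by_cases b : l2 ω = 0 <;> tauto)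
  have tot : ms μ (fun ω => l1 ω ≠ ⊤ ∨ l2 ω ≠ ⊤) ≤ 25 + (x0 + (x1 + x2)) := by
    refine (ms_or hμ (q := fun ω => (l1 ω = l2 ω ∧ l1 ω ≠ 0 ∧ l1 ω ≠ ⊤) ∨
      ((l1 ω < l2 ω ∧ l1 ω ≠ 0 ∧ l2 ω ≠ 0) ∨ (l2 ω < l1 ω ∧ l1 ω ≠ 0 ∧ l2 ω ≠ 0))) ?_).trans
      (add_le_add hz ((ms_or hμ fun ω h => h).trans (add_le_add le_rfl (ms_or hμ fun ω h => h))))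
    intro ω h
    by_cases a : l1 ω = 0
    · simp [a]
    by_cases b : l2 ω = 0
    · simp [b]
    rcases lt_trichotomy (l1 ω) (l2 ω) with c | c | c
    · right; right; left; exact ⟨c, a, b⟩
    · right; left
      refine ⟨c, a, ?_⟩
      rcases h with h | h
      · exact h
      · rwa [c]
    · right; right; right; exact ⟨c, a, b⟩
  refine tot.trans ?_
  have z1' : √z1 ≤ 5 := Real.sqrt_le_iff.2 ⟨by norm_num, by linarith⟩
  have z2' : √z2 ≤ 5 := Real.sqrt_le_iff.2 ⟨by norm_num, by linarith⟩
  have r1 : √(ms μ (fun ω => l1 ω < l2 ω)) ≤ √x0 + 6 := by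
    have := (Real.sqrt_le_sqrt g1).trans (sqrt_add_le' n1 m1)
    linarith
  have r2 : √(ms μ (fun ω => l2 ω < l1 ω)) ≤ √x0 + 6 := by
    have := (Real.sqrt_le_sqrt g2).trans (sqrt_add_le' n2 m2)
    linarith
  have hk1 : (1:ℝ) ≤ k := by exact_mod_cast hk
  have hsk : √(k:ℝ) ≤ k := Real.sqrt_le_iff.2 ⟨by linarith, by nlinarith⟩
  have hsk0 := Real.sqrt_nonneg (k:ℝ)
  have hq : (4:ℝ) * k ≤ 4 ^ k := by
    have : ∀ n : ℕ, 1 ≤ n → (4:ℝ) * n ≤ 4 ^ n := by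
      intro n hn
      induction n, hn using Nat.le_induction with
      | base => norm_num
      | succ n hn ih =>
        have : (1:ℝ) ≤ n := by exact_mod_cast hn
        rw [pow_succ]; push_cast; linarith
    exact this k hk
  have h16 : (16:ℝ) ^ k = 4 ^ k * 4 ^ k := by rw [← mul_pow]; norm_num
  set q : ℝ := 4 ^ k
  have a0 := Real.sqrt_nonneg x0
  have sx0 := Real.sq_sqrt n0
  have sx1 := Real.sq_sqrt n1
  have sx2 := Real.sq_sqrt n2
  have a1 := Real.sqrt_nonneg x1
  have a2 := Real.sqrt_nonneg x2
  set b := √x0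
  have t1 : √(k:ℝ) * √(ms μ (fun ω => l1 ω < l2 ω)) ≤ k * (b + 6) := by gcongr
  have t2 : √(k:ℝ) * √(ms μ (fun ω => l2 ω < l1 ω)) ≤ k * (b + 6) := by gcongr
  have main : 2 * x0 ≤ 25 + 2 * k + 4 * (k * (b + 6)) := by linarith
  have u1 : x1 ≤ (b + 1) ^ 2 := by rw [← sx1]; gcongr
  have u2 : x2 ≤ (b + 1) ^ 2 := by rw [← sx2]; gcongr
  rw [h16]
  exact final_num hk1 hq a0 sx0 main u1 u2
end comb
end Fou

open Matrix
namespace Fou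

section lead
open Classical
variable {Λ : Type*} [LinearOrder Λ] [WellFoundedLT Λ]

/-- least index with the property -/
noncomputable def lead (c : Λ → Prop) : WithTop Λ :=
  if h : ∃ n, c n then ((WellFounded.min (wellFounded_lt (α := Λ)) {n | c n} h : Λ) : WithTop Λ) else ⊤

lemma lead_eq_top {c : Λ → Prop} : lead c = ⊤ ↔ ∀ n, ¬ c n := by
  unfold lead
  split_ifs with h
  · simpa using h
  · simpa using h

lemma lead_eq_coe {c : Λ → Prop} {n : Λ} : lead c = (n : WithTop Λ) ↔ c n ∧ ∀ m < n, ¬ c m := by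
  unfold lead
  split_ifs with h
  · rw [WithTop.coe_inj]
    have h1 : c (WellFounded.min (wellFounded_lt (α := Λ)) {n | c n} h) :=
      WellFounded.min_mem (wellFounded_lt (α := Λ)) {n | c n} h
    have h2 : ∀ m, c m → ¬ m < (WellFounded.min (wellFounded_lt (α := Λ)) {n | c n} h) :=
      fun m hm => WellFounded.not_lt_min (wellFounded_lt (α := Λ)) {n | c n} hm
    constructor
    · rintro rfl
      exact ⟨h1, fun m hm hc => h2 m hc hm⟩
    · rintro ⟨h3, h4⟩
      exact le_antisymm (not_lt.1 (h2 n h3)) (not_lt.1 fun hh => h4 _ hh h1)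
  · simp only [WithTop.top_ne_coe, false_iff, not_and]
    intro hc; exact absurd ⟨n, hc⟩ h

lemma coe_le_lead {c : Λ → Prop} {n : Λ} : (n : WithTop Λ) ≤ lead c ↔ ∀ m < n, ¬ c m := by
  rcases h : lead c with _ | l
  · have := lead_eq_top.1 h
    exact ⟨fun _ m _ => this m, fun _ => le_top⟩
  · have := lead_eq_coe.1 h
    change ((n : WithTop Λ) ≤ (l : WithTop Λ)) ↔ _
    rw [WithTop.coe_le_coe]
    exact ⟨fun hl m hm => this.2 m (lt_of_lt_of_le hm hl), fun hc => not_lt.1 fun hl => hc _ hl this.1⟩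

lemma coe_lt_lead {c : Λ → Prop} {n : Λ} : (n : WithTop Λ) < lead c ↔ ∀ m ≤ n, ¬ c m := by
  rcases h : lead c with _ | l
  · have := lead_eq_top.1 h
    exact ⟨fun _ m _ => this m, fun _ => WithTop.coe_lt_top n⟩
  · have := lead_eq_coe.1 h
    change ((n : WithTop Λ) < (l : WithTop Λ)) ↔ _
    rw [WithTop.coe_lt_coe]
    exact ⟨fun hl m hm => this.2 m (lt_of_le_of_lt hm hl), fun hc => not_le.1 fun hl => hc _ hl this.1⟩
end lead

section arg
lemma arg_add {z w : ℂ} (hz : z ≠ 0) (hw : w ≠ 0) (h : |z.arg| + |w.arg| < Real.pi) :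
    (z * w).arg = z.arg + w.arg := by
  rw [Complex.arg_mul_eq_add_arg_iff hz hw]
  have := abs_le.1 (abs_add_le z.arg w.arg)
  constructor <;> linarith

lemma arg_inv' {z : ℂ} (h : |z.arg| < Real.pi) : (z⁻¹).arg = - z.arg := by
  rw [Complex.arg_inv, if_neg]
  intro h'
  rw [h', abs_of_pos Real.pi_pos] at h
  exact lt_irrefl _ h

lemma arg_ne {z : ℂ} (hz : ‖z‖ = 1) : z.arg ≠ 0 ↔ z ≠ 1 := by
  rw [not_iff_not]
  constructor
  · intro h
    rw [← Complex.norm_mul_exp_arg_mul_I z, hz, h]; simp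
  · rintro rfl; simp

lemma norm_sub_one {z : ℂ} (hz : ‖z‖ = 1) : ‖z - 1‖ ^ 2 = 2 - 2 * Real.cos z.arg := by
  have h1 := Complex.norm_mul_cos_arg z
  rw [hz, one_mul] at h1
  rw [h1, ← Complex.normSq_eq_norm_sq, Complex.normSq_apply]
  have h2 : ‖z‖ ^ 2 = 1 := by rw [hz]; norm_num
  rw [← Complex.normSq_eq_norm_sq, Complex.normSq_apply] at h2
  simp
  linarith

lemma outside {z w : ℂ} (hz : ‖z‖ = 1) (hw : ‖w‖ = 1) (h : ¬ (|z.arg| + |w.arg| < Real.pi)) :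
    4 ≤ ‖z - 1‖ ^ 2 + ‖w - 1‖ ^ 2 := by
  rw [norm_sub_one hz, norm_sub_one hw]
  have h1 := Complex.abs_arg_le_pi z
  have h2 := Complex.abs_arg_le_pi w
  have h3 := Real.cos_le_cos_of_nonneg_of_le_pi (x := Real.pi - |w.arg|) (y := |z.arg|)
    (by linarith) h1 (by linarith)
  rw [Real.cos_pi_sub, Real.cos_abs, Real.cos_abs] at h3
  linarith
end arg

variable {A : Type*} [CommRing A] [Fintype A]
variable {H : Type*} [NormedAddCommGroup H] [InnerProductSpace ℂ H] [CompleteSpace H]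

/-- shear -/
def sp (r : A) : A × A ≃+ A × A where
  toFun x := (x.1 + r * x.2, x.2)
  invFun x := (x.1 - r * x.2, x.2)
  left_inv x := by simp
  right_inv x := by simp
  map_add' x y := by ext <;> simp; ring
/-- shear -/
def sq (r : A) : A × A ≃+ A × A where
  toFun x := (x.1, x.2 + r * x.1)
  invFun x := (x.1, x.2 - r * x.1)
  left_inv x := by simp
  right_inv x := by simp
  map_add' x y := by ext <;> simp; ring

lemma chi_pair (χ : AddChar (A × A) ℂ) (a b : A) : χ (a, b) = χ (a, 0) * χ (0, b) := by
  rw [← AddChar.map_add_eq_mul]; simp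

lemma chi_norm (χ : AddChar (A × A) ℂ) (a : A × A) : ‖χ a‖ = 1 := AddChar.norm_apply _ _
lemma chi_ne (χ : AddChar (A × A) ℂ) (a : A × A) : χ a ≠ 0 := by
  intro h; have := chi_norm χ a; rw [h] at this; simp at this

/-- induced maps on characters -/
noncomputable def tp (r : A) (χ : AddChar (A × A) ℂ) : AddChar (A × A) ℂ :=
  χ.compAddMonoidHom (sp r).toAddMonoidHom
/-- induced maps on characters -/
noncomputable def tq (r : A) (χ : AddChar (A × A) ℂ) : AddChar (A × A) ℂ :=
  χ.compAddMonoidHom (sq r).toAddMonoidHom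

lemma tp1 (r : A) (χ : AddChar (A × A) ℂ) (a : A) : tp r χ (a, 0) = χ (a, 0) := by
  change χ (a + r * 0, 0) = _; simp
lemma tp2 (r : A) (χ : AddChar (A × A) ℂ) (a : A) : tp r χ (0, a) = χ (r * a, 0) * χ (0, a) := by
  change χ (0 + r * a, a) = _; rw [zero_add, chi_pair]
lemma tq1 (r : A) (χ : AddChar (A × A) ℂ) (a : A) : tq r χ (a, 0) = χ (a, 0) * χ (0, r * a) := by
  change χ (a, 0 + r * a) = _; rw [zero_add, chi_pair]
lemma tq2 (r : A) (χ : AddChar (A × A) ℂ) (a : A) : tq r χ (0, a) = χ (0, a) := by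
  change χ (0, a + r * 0) = _; simp

lemma chi_neg1 (χ : AddChar (A × A) ℂ) (a : A) : χ (-a, 0) = (χ (a, 0))⁻¹ := by
  rw [← AddChar.map_neg_eq_inv]; simp
lemma chi_neg2 (χ : AddChar (A × A) ℂ) (a : A) : χ (0, -a) = (χ (0, a))⁻¹ := by
  rw [← AddChar.map_neg_eq_inv]; simp

section
variable (V : Multiplicative (A × A) →* UU H) (g : UU H) (v : H)

lemma qi_p (r : A) (h : ∀ m, g * V (Multiplicative.ofAdd m) = V (Multiplicative.ofAdd (sp r m)) * g)
    (hv : ‖ap g v - v‖ ≤ 1) : Qi (mu V v) (tp r) 1 :=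
  ⟨AddChar.compAddMonoidHom_injective_left _ (sp r).surjective, fun B =>
    (mu_qi V g (sp r) h v B).trans (by gcongr; exact le_rfl)⟩
lemma qi_q (r : A) (h : ∀ m, g * V (Multiplicative.ofAdd m) = V (Multiplicative.ofAdd (sq r m)) * g)
    (hv : ‖ap g v - v‖ ≤ 1) : Qi (mu V v) (tq r) 1 :=
  ⟨AddChar.compAddMonoidHom_injective_left _ (sq r).surjective, fun B =>
    (mu_qi V g (sq r) h v B).trans (by gcongr; exact le_rfl)⟩
end

lemma lead_shift {Λ : Type*} [AddCommMonoid Λ] [LinearOrder Λ] [IsOrderedCancelAddMonoid Λ]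
    [WellFoundedLT Λ] (mon : Λ → A) (hmon : ∀ m n, mon (m + n) = mon m * mon n)
    (f g : A → ℂ) (e n : Λ) (he : 0 < e)
    (h1 : lead (fun m => f (mon m) ≠ 1) ≤ lead (fun m => g (mon m) ≠ 1))
    (h2 : lead (fun m => f (mon m) ≠ 1) = ((n + e : Λ) : WithTop Λ)) :
    lead (fun m => f (mon e * mon m) * g (mon m) ≠ 1) = (n : WithTop Λ) := by
  rw [h2, coe_le_lead] at h1
  rw [lead_eq_coe] at h2 ⊢
  constructor
  · have := h1 n (lt_add_of_pos_right n he)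
    rw [not_not] at this
    rw [this, mul_one, mul_comm, ← hmon]
    exact h2.1
  · intro m hm
    have a1 := h1 m (hm.trans (lt_add_of_pos_right n he))
    have a2 := h2.2 (m + e) (by gcongr)
    rw [not_not] at a1 a2 ⊢
    rw [a1, mul_one, mul_comm, ← hmon, a2]

lemma lead_copy {Λ : Type*} [LinearOrder Λ]
    [WellFoundedLT Λ] (f g : Λ → ℂ) (h1 : lead (fun m => f m ≠ 1) < lead (fun m => g m ≠ 1)) :
    lead (fun m => f m * g m ≠ 1) = lead (fun m => f m ≠ 1) := by
  obtain ⟨n, hn⟩ := WithTop.ne_top_iff_exists.1 (lt_top_of_lt h1).ne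
  rw [← hn] at h1 ⊢
  have h2 := lead_eq_coe.1 hn.symm
  rw [coe_lt_lead] at h1
  rw [lead_eq_coe]
  constructor
  · have := h1 n le_rfl
    rw [not_not] at this
    rw [this, mul_one]; exact h2.1
  · intro m hm
    have a1 := h1 m hm.le
    have a2 := h2.2 m hm
    rw [not_not] at a1 a2 ⊢
    rw [a1, a2, mul_one]

lemma ms_weight {Ω : Type*} [Fintype Ω] {μ : Ω → ℝ} (hμ : ∀ ω, 0 ≤ μ ω) {p : Ω → Prop} {c : ℝ}
    {f : Ω → ℝ} (h : ∀ ω, p ω → c ≤ f ω) (hf : ∀ ω, 0 ≤ f ω) : c * ms μ p ≤ ∑ ω, f ω * μ ω := by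
  classical
  unfold ms
  rw [Finset.mul_sum]
  refine le_trans (Finset.sum_le_sum (g := fun ω => f ω * μ ω) fun ω hω => ?_)
    (Finset.sum_le_sum_of_subset_of_nonneg (Finset.subset_univ _) fun ω _ _ => mul_nonneg (hf ω) (hμ ω))
  exact mul_le_mul_of_nonneg_right (h ω (by simpa using hω)) (hμ ω)

lemma char_gen {k : ℕ} (t : Fin k → A) (hgen : ∀ a : A, ∃ Q : MvPolynomial (Fin k) ℤ, MvPolynomial.aeval t Q = a)
    (f : A → ℂ) (h0 : f 0 = 1) (hadd : ∀ a b, f (a + b) = f a * f b)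
    (h : ∀ m : Fin k →₀ ℕ, f (∏ i, t i ^ m i) = 1) (a : A) : f a = 1 := by
  have hneg : ∀ a, f a = 1 → f (-a) = 1 := by
    intro a ha
    have := hadd a (-a)
    rw [add_neg_cancel, h0, ha, one_mul] at this
    exact this.symm
  let S : AddSubgroup A :=
    { carrier := {a | f a = 1}
      zero_mem' := h0
      add_mem' := fun {a b} ha hb => by
        change f (a + b) = 1
        rw [hadd, show f a = 1 from ha, show f b = 1 from hb, one_mul]
      neg_mem' := fun {a} ha => hneg a ha }
  change a ∈ S
  obtain ⟨Q, rfl⟩ := hgen a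
  induction Q using MvPolynomial.induction_on' with
  | monomial m c =>
    rw [MvPolynomial.aeval_monomial]
    rw [Finsupp.prod_fintype _ _ (fun i => pow_zero _)]
    rw [show (algebraMap ℤ A) c = (c : A) from rfl, ← zsmul_eq_mul]
    exact S.zsmul_mem (h m) c
  | add p q hp hq => rw [map_add]; exact S.add_mem hp hq

theorem relT {k : ℕ} (t : Fin k → A) (hgen : ∀ a : A, ∃ Q : MvPolynomial (Fin k) ℤ, MvPolynomial.aeval t Q = a)
    (V : Multiplicative (A × A) →* UU H) (v : H) (p q : A → UU H)
    (hp : ∀ r m, p r * V (Multiplicative.ofAdd m) = V (Multiplicative.ofAdd (sp r m)) * p r)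
    (hq : ∀ r m, q r * V (Multiplicative.ofAdd m) = V (Multiplicative.ofAdd (sq r m)) * q r)
    (p1 : ‖ap (p 1) v - v‖ ≤ 1) (p2 : ‖ap (p (-1)) v - v‖ ≤ 1) (p3 : ∀ n, ‖ap (p (t n)) v - v‖ ≤ 1)
    (q1 : ‖ap (q 1) v - v‖ ≤ 1) (q2 : ‖ap (q (-1)) v - v‖ ≤ 1) (q3 : ∀ n, ‖ap (q (t n)) v - v‖ ≤ 1)
    (x1 : ‖ap (V (Multiplicative.ofAdd (1, 0))) v - v‖ ≤ 1)
    (y1 : ‖ap (V (Multiplicative.ofAdd (0, 1))) v - v‖ ≤ 1) :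
    ∃ w : H, (∀ m, ap (V m) w = w) ∧ ‖v - w‖ ^ 2 ≤ 25 * 16 ^ k := by
  classical
  refine ⟨P V 1 v, fun m => P_one_fixed V v m.toAdd, ?_⟩
  have hμ := mu_nonneg V v
  have Q1 := qi_p V _ v 1 (hp 1) p1
  have Q2 := qi_p V _ v (-1) (hp (-1)) p2
  have Q3 := qi_q V _ v 1 (hq 1) q1
  have Q4 := qi_q V _ v (-1) (hq (-1)) q2
  have pl := planar hμ (fun χ => (χ (1, 0)).arg) (fun χ => (χ (0, 1)).arg) (tp 1) (tq 1) (tq (-1)) (tp (-1))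
    Q1 Q3 Q4 Q2
    (fun χ h => by
      rw [tp1, tp2, one_mul, arg_add (chi_ne _ _) (chi_ne _ _) h]
      exact ⟨rfl, rfl⟩)
    (fun χ h => by
      rw [tq1, tq2, one_mul, arg_add (chi_ne _ _) (chi_ne _ _) h]
      exact ⟨rfl, rfl⟩)
    (fun χ h => by
      have h' : |(χ (0, 1)).arg| < Real.pi := lt_of_le_of_lt (le_add_of_nonneg_left (abs_nonneg _)) h
      rw [tq1, tq2, neg_one_mul, chi_neg2, arg_add (chi_ne _ _) (inv_ne_zero (chi_ne _ _)), arg_inv' h']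
      · exact ⟨by ring, rfl⟩
      · rwa [arg_inv' h', abs_neg])
    (fun χ h => by
      have h' : |(χ (1, 0)).arg| < Real.pi := lt_of_le_of_lt (le_add_of_nonneg_right (abs_nonneg _)) h
      rw [tp1, tp2, neg_one_mul, chi_neg1, arg_add (inv_ne_zero (chi_ne _ _)) (chi_ne _ _), arg_inv' h']
      · exact ⟨rfl, by ring⟩
      · rwa [arg_inv' h', abs_neg])
    (by
      have e1 := mu_disp V v (1, 0)
      have e2 := mu_disp V v (0, 1)
      have e3 : 4 * ms (mu V v) (fun χ => ¬ (|(χ (1, 0)).arg| + |(χ (0, 1)).arg| < Real.pi)) ≤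
          ∑ χ, ‖χ (1, 0) - 1‖ ^ 2 * mu V v χ + ∑ χ, ‖χ (0, 1) - 1‖ ^ 2 * mu V v χ := by
        rw [← Finset.sum_add_distrib]
        simp only [← add_mul]
        exact ms_weight hμ (fun χ h => outside (chi_norm χ (1, 0)) (chi_norm χ (0, 1)) h)
          (fun χ => by positivity)
      rw [← e1, ← e2] at e3
      have e4 := norm_nonneg (ap (V (Multiplicative.ofAdd (1, 0))) v - v)
      have e5 := norm_nonneg (ap (V (Multiplicative.ofAdd (0, 1))) v - v)
      nlinarith)
  let mo : MonomialOrder (Fin k) := MonomialOrder.lex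
  let mon : mo.syn → A := fun s => ∏ i, t i ^ (mo.toSyn.symm s i)
  have hmon : ∀ m n, mon (m + n) = mon m * mon n := by
    intro m n
    simp only [mon, map_add, Finsupp.add_apply, pow_add, Finset.prod_mul_distrib]
  have hmon0 : mon 0 = 1 := by simp [mon]
  let e : Fin k → mo.syn := fun i => mo.toSyn (Finsupp.single i 1)
  have hmone : ∀ i, mon (e i) = t i := by
    intro i
    simp only [mon, e, AddEquiv.symm_apply_apply]
    rw [Finset.prod_eq_single i]
    · simp
    · intro j _ hj; simp [Finsupp.single_eq_of_ne hj]
    · simp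
  let l1 : AddChar (A × A) ℂ → WithTop mo.syn := fun χ => lead (fun m => χ (mon m, 0) ≠ 1)
  let l2 : AddChar (A × A) ℂ → WithTop mo.syn := fun χ => lead (fun m => χ (0, mon m) ≠ 1)
  have he0 : ∀ i, 0 < e i := by
    intro i
    rw [mo.toSyn_lt_iff_ne_zero, Ne, mo.toSyn_eq_zero_iff]
    simp
  have hzero : ∀ c : mo.syn → Prop, lead c = 0 → c 0 := by
    intro c hc
    exact (lead_eq_coe (n := (0 : mo.syn)).1 hc).1
  have ld := leads hμ l1 l2 e
    (fun i j hij => by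
      have := mo.toSyn.injective hij
      exact (Finsupp.single_left_inj one_ne_zero).1 this) he0
    (fun n hn => by
      have : mo.toSyn.symm n ≠ 0 := by
        intro h; apply hn; rw [← mo.toSyn.apply_symm_apply n, h, map_zero]
      obtain ⟨i, hi⟩ := Finsupp.ne_iff.1 this
      refine ⟨i, mo.toSyn (mo.toSyn.symm n - Finsupp.single i 1), ?_⟩
      simp only [e]
      rw [← map_add, tsub_add_cancel_of_le, AddEquiv.apply_symm_apply]
      rw [Finsupp.single_le_iff]
      exact Nat.one_le_iff_ne_zero.2 hi)
    (fun i => tp (t i)) (fun i => tq (t i)) (fun i => qi_p V _ v _ (hp _) (p3 i))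
    (fun i => qi_q V _ v _ (hq _) (q3 i))
    (fun i χ n h1 h2 => by
      simp only [l1, l2, tp1, tp2]
      refine ⟨h2, ?_⟩
      have := lead_shift mon hmon (fun a => χ (a, 0)) (fun a => χ (0, a)) (e i) n (he0 i) h1 h2
      rwa [hmone] at this)
    (fun i χ n h1 h2 => by
      simp only [l1, l2, tq1, tq2]
      refine ⟨h2, ?_⟩
      have := lead_shift mon hmon (fun a => χ (0, a)) (fun a => χ (a, 0)) (e i) n (he0 i) h1 h2
      rw [hmone] at this
      simp only [mul_comm (χ (0, _))] at this
      exact this)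
    (tp 1) (tq 1) Q1 Q3
    (fun χ h1 => by
      simp only [l1, l2, tp1, tp2, one_mul]
      exact ⟨trivial, lead_copy (fun m => χ (mon m, 0)) (fun m => χ (0, mon m)) h1⟩)
    (fun χ h1 => by
      simp only [l1, l2, tq1, tq2, one_mul]
      have := lead_copy (fun m => χ (0, mon m)) (fun m => χ (mon m, 0)) h1
      simp only [mul_comm (χ (0, _))] at this
      exact ⟨this, trivial⟩)
    ((ms_mono hμ (by
      intro χ h
      rw [arg_ne (chi_norm _ _), arg_ne (chi_norm _ _)]
      rcases h with h | h
      · left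
        have := hzero _ h
        rwa [hmon0] at this
      · right
        have := hzero _ h
        rwa [hmon0] at this)).trans pl)
  rw [mu_rest]
  refine le_trans ?_ ld
  have : ∑ χ with χ ≠ 1, mu V v χ = ms (mu V v) (fun χ => χ ≠ 1) := by
    unfold ms; congr!
  rw [this]
  refine ms_mono hμ fun χ hχ => ?_
  by_contra hc
  push Not at hc
  have c1 := lead_eq_top.1 hc.1
  have c2 := lead_eq_top.1 hc.2
  apply hχ
  ext ⟨a, b⟩
  have hsyn : ∀ m : Fin k →₀ ℕ, mon (mo.toSyn m) = ∏ i, t i ^ m i := by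
    intro m; simp [mon]
  rw [chi_pair, char_gen t hgen (fun a => χ (a, 0)) (AddChar.map_zero_eq_one χ) (fun a b => by
      rw [← AddChar.map_add_eq_mul]; simp) (fun m => by
        have := c1 (mo.toSyn m); rw [not_not, hsyn] at this; exact this) a,
    char_gen t hgen (fun a => χ (0, a)) (AddChar.map_zero_eq_one χ) (fun a b => by
      rw [← AddChar.map_add_eq_mul]; simp) (fun m => by
        have := c2 (mo.toSyn m); rw [not_not, hsyn] at this; exact this) b]
  simp
end Fou

open Matrix
namespace BG

lemma sr1 {A : Type*} [CommRing A] [Finite A] (r s x y : A) (h : x * r + y * s = 1) :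
    ∃ w, IsUnit (r + w * s) := by
  obtain ⟨a, b, hab, e⟩ := Finite.exists_ne_map_eq_of_infinite (fun n : ℕ => r ^ n)
  wlog hlt : a < b generalizing a b
  · exact this b a hab.symm e.symm (lt_of_le_of_ne (not_lt.1 hlt) hab.symm)
  obtain ⟨p, rfl⟩ := Nat.exists_eq_add_of_lt hlt
  refine ⟨(1 - r ^ (p + 1)) * y, ?_⟩
  by_contra hu
  obtain ⟨m, hm, hmem⟩ := exists_max_ideal_of_mem_nonunits hu
  by_cases hr : r ∈ m
  · apply hm.ne_top
    rw [Ideal.eq_top_iff_one]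
    have e1 : (1 : A) = (r + (1 - r ^ (p + 1)) * y * s) + r * (x - 1 + r ^ p * y * s) := by
      rw [pow_succ]
      linear_combination -h
    rw [e1]
    exact m.add_mem hmem (m.mul_mem_right _ hr)
  · have h1 : r ^ a * (1 - r ^ (p + 1)) ∈ m := by
      have : r ^ a * (1 - r ^ (p + 1)) = 0 := by
        rw [mul_sub, mul_one, ← pow_add, e]; ring_nf
      rw [this]; exact m.zero_mem
    have h2 := (hm.isPrime.mem_or_mem h1).resolve_left fun h' => hr (hm.isPrime.mem_of_pow_mem _ h')
    apply hr
    have := m.sub_mem hmem (m.mul_mem_right (y * s) h2)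
    rwa [← mul_assoc, add_sub_cancel_right] at this

section grp
variable {Γ : Type*} [Group Γ]

/-- products of four factors -/
def Y4 (U L : Set Γ) : Set Γ := {g | ∃ a ∈ U, ∃ b ∈ L, ∃ c ∈ U, ∃ e ∈ L, g = a * b * c * e}

lemma tav_alg (s u1 x1 l1 y1 u2 x2 l2 y2 p q r t : Γ)
    (h : s * x1 * y1 * x2 * y2 = p * q * r * t) :
    s * (u1 * x1 * (l1 * y1) * (u2 * x2) * (l2 * y2)) =
      ((s * u1 * s⁻¹) * p) * ((p⁻¹ * s * x1 * l1 * (p⁻¹ * s * x1)⁻¹) * q) *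
      (((p * q)⁻¹ * (s * x1 * y1) * u2 * ((p * q)⁻¹ * (s * x1 * y1))⁻¹) * r) *
      (((p * q * r)⁻¹ * (s * x1 * y1 * x2) * l2 * ((p * q * r)⁻¹ * (s * x1 * y1 * x2))⁻¹) * t) := by
  have ht : t = (p * q * r)⁻¹ * (s * x1 * y1 * x2 * y2) := by rw [h]; group
  rw [ht]; group

lemma tavgen (U0 L0 X X' U L : Set Γ) (S : Subgroup Γ) (hX : X ⊆ S) (hX' : X' ⊆ S)
    (hU0 : ∀ s ∈ S, ∀ u ∈ U0, s * u * s⁻¹ ∈ U0) (hL0 : ∀ s ∈ S, ∀ u ∈ L0, s * u * s⁻¹ ∈ L0)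
    (hS : ∀ s ∈ S, s ∈ Y4 X X')
    (hU : ∀ u, u ∈ U ↔ ∃ a ∈ U0, ∃ x ∈ X, u = a * x) (hL : ∀ u, u ∈ L ↔ ∃ a ∈ L0, ∃ x ∈ X', u = a * x)
    (s : Γ) (hs : s ∈ S) (y : Γ) (hy : y ∈ Y4 U L) : s * y ∈ Y4 U L := by
  obtain ⟨a, ha, b, hb, c, hc, e, he, rfl⟩ := hy
  obtain ⟨u1, hu1, x1, hx1, rfl⟩ := (hU a).1 ha
  obtain ⟨l1, hl1, y1, hy1, rfl⟩ := (hL b).1 hb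
  obtain ⟨u2, hu2, x2, hx2, rfl⟩ := (hU c).1 hc
  obtain ⟨l2, hl2, y2, hy2, rfl⟩ := (hL e).1 he
  replace hx1 := And.intro hx1 (hX hx1)
  replace hx2 := And.intro hx2 (hX hx2)
  replace hy1 := And.intro hy1 (hX' hy1)
  replace hy2 := And.intro hy2 (hX' hy2)
  obtain ⟨p, hp, q, hq, r, hr, t, ht, e⟩ := hS (s * x1 * y1 * x2 * y2)
    (S.mul_mem (S.mul_mem (S.mul_mem (S.mul_mem hs hx1.2) hy1.2) hx2.2) hy2.2)
  rw [tav_alg s u1 x1 l1 y1 u2 x2 l2 y2 p q r t e]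
  have m1 : p⁻¹ * s * x1 ∈ S := S.mul_mem (S.mul_mem (S.inv_mem (hX hp)) hs) hx1.2
  have m2 : (p * q)⁻¹ * (s * x1 * y1) ∈ S := S.mul_mem (S.inv_mem (S.mul_mem (hX hp) (hX' hq)))
    (S.mul_mem (S.mul_mem hs hx1.2) hy1.2)
  have m3 : (p * q * r)⁻¹ * (s * x1 * y1 * x2) ∈ S :=
    S.mul_mem (S.inv_mem (S.mul_mem (S.mul_mem (hX hp) (hX' hq)) (hX hr)))
    (S.mul_mem (S.mul_mem (S.mul_mem hs hx1.2) hy1.2) hx2.2)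
  exact ⟨_, (hU _).2 ⟨_, hU0 _ hs _ hu1, p, hp, rfl⟩, _, (hL _).2 ⟨_, hL0 _ m1 _ hl1, q, hq, rfl⟩,
    _, (hU _).2 ⟨_, hU0 _ m2 _ hu2, r, hr, rfl⟩, _, (hL _).2 ⟨_, hL0 _ m3 _ hl2, t, ht, rfl⟩, rfl⟩
end grp

variable {d : ℕ} {A : Type*} [CommRing A]

/-- subgroup generated by the elementary matrices with `f` increasing -/
def NG (d : ℕ) (A : Type*) [CommRing A] (f : Fin d → ℤ) : Subgroup (SLd d A) :=
  Subgroup.closure {g | ∃ (a b : Fin d) (h : a ≠ b) (r : A), f a < f b ∧ g = elem a b h r}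

lemma elem_mem_NG {f : Fin d → ℤ} {a b : Fin d} (h : a ≠ b) (r : A) (hf : f a < f b) :
    elem a b h r ∈ NG d A f := Subgroup.subset_closure ⟨a, b, h, r, hf, rfl⟩

lemma NG_mono {f g : Fin d → ℤ} (h : ∀ a b, f a < f b → g a < g b) : NG d A f ≤ NG d A g := by
  refine Subgroup.closure_mono ?_
  rintro _ ⟨a, b, hab, r, hf, rfl⟩
  exact ⟨a, b, hab, r, h _ _ hf, rfl⟩

lemma conj_alg1 {Γ : Type*} [Group Γ] {x y z : Γ} (h : x * y = z * y * x) : x * y * x⁻¹ = z * y := by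
  rw [h, mul_assoc, mul_inv_cancel, mul_one]
lemma conj_alg2 {Γ : Type*} [Group Γ] {x y : Γ} (h : x * y = y * x) : x * y * x⁻¹ = y := by
  rw [h, mul_assoc, mul_inv_cancel, mul_one]
lemma conj_alg3 {Γ : Type*} [Group Γ] {x y z : Γ} (h : y * x = z * x * y) :
    x * y * x⁻¹ = z⁻¹ * y := by
  rw [mul_inv_eq_iff_eq_mul, mul_assoc, h]; group

lemma conj_alg4 {Γ : Type*} [Group Γ] (x y z : Γ) : x * (y * z) = x * y * x⁻¹ * (x * z) := by group

lemma NG_conj_elem {f : Fin d → ℤ} {i j : Fin d} (hij : i ≠ j) (hf : f i = f j) (r : A) {u : SLd d A}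
    (hu : u ∈ NG d A f) : elem i j hij r * u * (elem i j hij r)⁻¹ ∈ NG d A f := by
  induction hu using Subgroup.closure_induction with
  | mem u hu =>
    obtain ⟨a, b, hab, s, hlt, rfl⟩ := hu
    by_cases h1 : j = a
    · subst h1
      have hib : i ≠ b := by rintro rfl; exact hlt.ne hf.symm
      rw [conj_alg1 (elem_comm i j b hij hab hib r s)]
      exact mul_mem (elem_mem_NG _ _ (hf ▸ hlt)) (elem_mem_NG _ _ hlt)
    · by_cases h2 : i = b
      · subst h2
        have haj : a ≠ j := Ne.symm h1
        rw [conj_alg3 (elem_comm a i j hab hij haj s r)]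
        exact mul_mem (inv_mem (elem_mem_NG _ _ (hf ▸ hlt))) (elem_mem_NG _ _ hlt)
      · rw [conj_alg2 (elem_commute i j a b hij hab h1 h2 r s)]
        exact elem_mem_NG _ _ hlt
  | one => rw [mul_one, mul_inv_cancel]; exact one_mem _
  | mul x y _ _ hx hy =>
    rw [show ∀ e : SLd d A, e * (x * y) * e⁻¹ = (e * x * e⁻¹) * (e * y * e⁻¹) from fun e => (conj_mul).symm]
    exact mul_mem hx hy
  | inv x _ hx =>
    rw [← conj_inv]; exact inv_mem hx

/-- root subgroup set -/
def XS (A : Type*) [CommRing A] (i j : Fin d) (h : i ≠ j) : Set (SLd d A) := Set.range (elem i j h)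

lemma NG_split {f g : Fin d → ℤ} {i j : Fin d} (hij : i ≠ j) (hf : f i = f j) (hg : g i < g j)
    (h1 : ∀ a b, f a < f b → g a < g b) (h2 : ∀ a b, g a < g b → f a < f b ∨ (a = i ∧ b = j))
    (u : SLd d A) : u ∈ NG d A g ↔ ∃ a ∈ NG d A f, ∃ x ∈ XS A i j hij, u = a * x := by
  constructor
  · intro hu
    have key : ∀ (a b : Fin d) (hab : a ≠ b) (r : A), g a < g b → ∀ y : SLd d A,
          (∃ u ∈ NG d A f, ∃ x ∈ XS A i j hij, y = u * x) →
          (∃ u ∈ NG d A f, ∃ x ∈ XS A i j hij, elem a b hab r * y = u * x) := by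
      rintro a b hab r hlt _ ⟨u, hu, _, ⟨s, rfl⟩, rfl⟩
      rcases h2 a b hlt with h | ⟨rfl, rfl⟩
      · exact ⟨_, mul_mem (elem_mem_NG hab r h) hu, _, ⟨s, rfl⟩, (mul_assoc _ _ _).symm⟩
      · refine ⟨_, NG_conj_elem hij hf r hu, _, ⟨r + s, rfl⟩, ?_⟩
        rw [elem_add]
        exact conj_alg4 _ _ _
    refine Subgroup.closure_induction_left (p := fun x _ => ∃ a ∈ NG d A f, ∃ y ∈ XS A i j hij, x = a * y)
      ⟨1, one_mem _, 1, ⟨0, elem_zero _ _ _⟩, (one_mul 1).symm⟩ ?_ ?_ hu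
    · rintro _ ⟨a, b, hab, r, hlt, rfl⟩ y _ hy
      exact key a b hab r hlt y hy
    · rintro _ ⟨a, b, hab, r, hlt, rfl⟩ y _ hy
      rw [← elem_neg]
      exact key a b hab _ hlt y hy
  · rintro ⟨a, ha, _, ⟨r, rfl⟩, rfl⟩
    exact mul_mem (NG_mono h1 ha) (elem_mem_NG hij r hg)

/-- the embedded 2x2 matrix -/
def emb (i j : Fin d) (p q r s : A) : Matrix (Fin d) (Fin d) A := fun a b =>
  if a = i then (if b = i then p else if b = j then q else 0) else
  if a = j then (if b = i then r else if b = j then s else 0) else if a = b then 1 else 0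

lemma emb_one {i j : Fin d} (hij : i ≠ j) : emb i j (1 : A) 0 0 1 = 1 := by
  refine Matrix.ext fun a b => ?_
  unfold emb
  rw [Matrix.one_apply]
  grind

lemma elem_mul_apply {i j : Fin d} (hij : i ≠ j) (x : A) (M : Matrix (Fin d) (Fin d) A) (a b : Fin d) :
    (mx (elem i j hij x) * M) a b = M a b + if a = i then x * M j b else 0 := by
  have := elem_mulVec i j hij x (fun c => M c b) a
  rw [← this]; rfl

lemma emb_left1 {i j : Fin d} (hij : i ≠ j) (x p q r s : A) :
    mx (elem i j hij x) * emb i j p q r s = emb i j (p + x * r) (q + x * s) r s := by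
  refine Matrix.ext fun a b => ?_
  rw [elem_mul_apply]
  unfold emb
  grind

lemma emb_left2 {i j : Fin d} (hij : i ≠ j) (x p q r s : A) :
    mx (elem j i hij.symm x) * emb i j p q r s = emb i j p q (r + x * p) (s + x * q) := by
  refine Matrix.ext fun a b => ?_
  rw [elem_mul_apply]
  unfold emb
  grind

/-- SL2 -/
def S2 (A : Type*) [CommRing A] (i j : Fin d) (hij : i ≠ j) : Subgroup (SLd d A) :=
  Subgroup.closure (XS A i j hij ∪ XS A j i hij.symm)

lemma S2_emb {i j : Fin d} (hij : i ≠ j) {g : SLd d A} (hg : g ∈ S2 A i j hij) :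
    ∃ p q r s : A, p * s - q * r = 1 ∧ mx g = emb i j p q r s := by
  have key : ∀ x, x ∈ XS A i j hij ∪ XS A j i hij.symm → ∀ y : SLd d A,
      (∃ p q r s : A, p * s - q * r = 1 ∧ mx y = emb i j p q r s) →
      ∃ p q r s : A, p * s - q * r = 1 ∧ mx (x * y) = emb i j p q r s := by
    rintro _ (⟨x, rfl⟩ | ⟨x, rfl⟩) y ⟨p, q, r, s, h, e⟩
    · rw [mx_mul, e, emb_left1]
      exact ⟨_, _, _, _, by linear_combination h, rfl⟩
    · rw [mx_mul, e, emb_left2 hij]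
      exact ⟨_, _, _, _, by linear_combination h, rfl⟩
  refine Subgroup.closure_induction_left (p := fun x _ => ∃ p q r s : A, p * s - q * r = 1 ∧ mx x = emb i j p q r s)
    ⟨1, 0, 0, 1, by ring, by rw [mx_one, emb_one hij]⟩ (fun x hx y _ hy => key x hx y hy) (fun x hx y _ hy => ?_) hg
  refine key _ ?_ y hy
  rcases hx with ⟨x, rfl⟩ | ⟨x, rfl⟩
  · exact Or.inl ⟨-x, elem_neg _ _ _ _⟩
  · exact Or.inr ⟨-x, elem_neg _ _ _ _⟩

lemma S2_Y4 [Finite A] {i j : Fin d} (hij : i ≠ j) {g : SLd d A} (hg : g ∈ S2 A i j hij) :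
    g ∈ Y4 (XS A i j hij) (XS A j i hij.symm) := by
  obtain ⟨p, q, r, s, h, e⟩ := S2_emb hij hg
  obtain ⟨w, ⟨u, hu⟩⟩ := sr1 r s (-q) p (by linear_combination h)
  have hi := u.mul_inv
  rw [hu] at hi
  set v : A := ((u⁻¹ : Aˣ) : A)
  -- g * e21(w) has lower-left u
  refine ⟨_, ⟨(p + w * q - 1) * v, rfl⟩, _, ⟨r + w * s, rfl⟩, _, ⟨q - (p + w * q - 1) * v * s, rfl⟩, _, ⟨-w, rfl⟩, ?_⟩
  apply mx_inj
  rw [mx_mul, mx_mul, mx_mul, e, mul_assoc, mul_assoc, ← mul_one (mx (elem j i _ (-w))), ← emb_one hij,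
    emb_left2 hij, emb_left1, emb_left2 hij, emb_left1]
  congr 1
  · grind
  · grind
  · grind
  · grind

/-- collapse `i` and `i+1` -/
def col (i : Fin d) (a : Fin d) : ℤ := if (a : ℤ) ≤ i then a else a - 1

/-- upper -/
abbrev UG (d : ℕ) (A : Type*) [CommRing A] : Subgroup (SLd d A) := NG d A (fun a => (a : ℤ))
/-- lower -/
abbrev LG (d : ℕ) (A : Type*) [CommRing A] : Subgroup (SLd d A) := NG d A (fun a => -(a : ℤ))

lemma S2_conj {f : Fin d → ℤ} {i j : Fin d} (hij : i ≠ j) (hf : f i = f j) {s : SLd d A} (hs : s ∈ S2 A i j hij) :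
    ∀ u ∈ NG d A f, s * u * s⁻¹ ∈ NG d A f := by
  have h0 : ∀ s, s ∈ XS A i j hij ∪ XS A j i hij.symm → ∀ u ∈ NG d A f, s * u * s⁻¹ ∈ NG d A f := by
    rintro _ (⟨x, rfl⟩ | ⟨x, rfl⟩) u hu
    · exact NG_conj_elem hij hf x hu
    · exact NG_conj_elem hij.symm hf.symm x hu
  have h1 : ∀ (x y u : SLd d A), x * y * u * (x * y)⁻¹ = x * (y * u * y⁻¹) * x⁻¹ := by intros; group
  refine Subgroup.closure_induction_left (p := fun s _ => ∀ u ∈ NG d A f, s * u * s⁻¹ ∈ NG d A f) ?_ ?_ ?_ hs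
  · intro u hu; rwa [one_mul, inv_one, mul_one]
  · intro x hx y _ hy u hu
    rw [h1]; exact h0 x hx _ (hy u hu)
  · intro x hx y _ hy u hu
    rw [h1]; refine h0 _ ?_ _ (hy u hu)
    rcases hx with ⟨x, rfl⟩ | ⟨x, rfl⟩
    · exact Or.inl ⟨-x, elem_neg _ _ _ _⟩
    · exact Or.inr ⟨-x, elem_neg _ _ _ _⟩

lemma Y_S2 [Finite A] {i j : Fin d} (hij : i ≠ j) (h : (i : ℕ) + 1 = j) {s : SLd d A} (hs : s ∈ S2 A i j hij)
    (y : SLd d A) (hy : y ∈ Y4 (UG d A : Set (SLd d A)) (LG d A)) :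
    s * y ∈ Y4 (UG d A : Set (SLd d A)) (LG d A) := by
  have hc : col i i = col i j := by unfold col; grind
  refine tavgen (NG d A (col i)) (NG d A (fun a => - col i a)) (XS A i j hij) (XS A j i hij.symm) _ _ (S2 A i j hij)
    (fun x hx => Subgroup.subset_closure (Or.inl hx)) (fun x hx => Subgroup.subset_closure (Or.inr hx))
    (fun s hs => S2_conj hij hc hs) (fun s hs => S2_conj hij (by rw [hc]) hs) (fun s hs => S2_Y4 hij hs) ?_ ?_ s hs y hy
  · intro u
    refine NG_split hij hc (by omega) ?_ ?_ u
    · intro a b; unfold col; grind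
    · intro a b hab; unfold col; grind
  · intro u
    refine NG_split hij.symm (by rw [hc]) (by omega) ?_ ?_ u
    · intro a b; unfold col; grind
    · intro a b hab; unfold col; grind

lemma comm_alg {Γ : Type*} [Group Γ] {x y z : Γ} (h : x * y = z * y * x) : z = x * y * x⁻¹ * y⁻¹ := by
  rw [h]; group

theorem EE_Y4 [Finite A] {g : SLd d A} (hg : g ∈ EE d A) : g ∈ Y4 (UG d A : Set (SLd d A)) (LG d A) := by
  let T : SLd d A → Prop := fun s => ∀ y ∈ Y4 (UG d A : Set (SLd d A)) (LG d A),
    s * y ∈ Y4 (UG d A : Set (SLd d A)) (LG d A)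
  have hT : ∀ n : ℕ, ∀ (i j : Fin d) (h : i ≠ j), ((i : ℕ) + n + 1 = j ∨ (j : ℕ) + n + 1 = i) → ∀ r : A, T (elem i j h r) := by
    intro n
    induction n with
    | zero =>
      rintro i j h (h1 | h1) r
      · exact Y_S2 h (by omega) (Subgroup.subset_closure (Or.inl ⟨r, rfl⟩))
      · exact Y_S2 h.symm (by omega) (Subgroup.subset_closure (Or.inr ⟨r, rfl⟩))
    | succ n ih =>
      intro i j h hd r
      have : ∃ k : Fin d, i ≠ k ∧ k ≠ j ∧ ((i : ℕ) + n + 1 = k ∨ (k : ℕ) + n + 1 = i) ∧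
          ((k : ℕ) + 0 + 1 = j ∨ (j : ℕ) + 0 + 1 = k) := by
        rcases hd with hd | hd
        · exact ⟨⟨i + n + 1, by omega⟩, by grind, by grind, by grind, by grind⟩
        · exact ⟨⟨j + 1, by omega⟩, by grind, by grind, by grind, by grind⟩
      obtain ⟨k, h1, h2, h3, h4⟩ := this
      have h5 : ∀ r : A, T (elem k j h2 r) := by
        rcases h4 with h4 | h4
        · exact fun r => Y_S2 h2 (by omega) (Subgroup.subset_closure (Or.inl ⟨r, rfl⟩))
        · exact fun r => Y_S2 h2.symm (by omega) (Subgroup.subset_closure (Or.inr ⟨r, rfl⟩))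
      have e := comm_alg (elem_comm i k j h1 h2 h r 1)
      rw [mul_one, ← elem_neg, ← elem_neg] at e
      rw [e]
      intro y hy
      rw [mul_assoc, mul_assoc, mul_assoc]
      exact ih i k h1 h3 r _ (h5 1 _ (ih i k h1 h3 _ _ (h5 _ _ hy)))
  refine Lau.EE_ind_left (P := fun g : SLd d A => g ∈ Y4 (UG d A : Set (SLd d A)) (LG d A)) ?_ ?_ hg
  · exact ⟨1, one_mem _, 1, one_mem _, 1, one_mem _, 1, one_mem _, by simp⟩
  · intro i j h r y hy
    rcases lt_or_gt_of_ne (fun hh : (i : ℕ) = j => h (Fin.ext hh)) with h1 | h1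
    · exact hT (j - i - 1) i j h (by omega) r y hy
    · exact hT (i - j - 1) i j h (by omega) r y hy

lemma NG_lift {B : Type*} [CommRing B] (f : Fin d → ℤ) (φ : A →+* B) (hφ : Function.Surjective φ) {g : SLd d B}
    (hg : g ∈ NG d B f) : ∃ g' ∈ NG d A f, mapSL φ g' = g := by
  have : NG d B f ≤ (NG d A f).map (mapSL φ) := by
    refine (Subgroup.closure_le _).2 ?_
    rintro _ ⟨i, j, h, r, hf, rfl⟩
    obtain ⟨r', rfl⟩ := hφ r
    exact ⟨_, elem_mem_NG h r' hf, map_elem _ _ _ _ _⟩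
  exact this hg

theorem Y4_lift {B : Type*} [CommRing B] [Finite B] (φ : A →+* B) (hφ : Function.Surjective φ) {g : SLd d A}
    (hg : g ∈ EE d A) : ∃ y ∈ Y4 (UG d A : Set (SLd d A)) (LG d A), mapSL φ (y⁻¹ * g) = 1 := by
  obtain ⟨a, ha, b, hb, c, hc, e, he, h⟩ := EE_Y4 (EE_map φ hg)
  obtain ⟨a', ha', rfl⟩ := NG_lift _ φ hφ ha
  obtain ⟨b', hb', rfl⟩ := NG_lift _ φ hφ hb
  obtain ⟨c', hc', rfl⟩ := NG_lift _ φ hφ hc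
  obtain ⟨e', he', rfl⟩ := NG_lift _ φ hφ he
  refine ⟨a' * b' * c' * e', ⟨a', ha', b', hb', c', hc', e', he', rfl⟩, ?_⟩
  rw [map_mul (mapSL _), map_inv (mapSL _), h, map_mul (mapSL _), map_mul (mapSL _), map_mul (mapSL _), inv_mul_cancel]
end BG

open Matrix
namespace Fou
variable {H : Type*} [NormedAddCommGroup H] [InnerProductSpace ℂ H] [CompleteSpace H]
variable {G : Type*} [Group G]

/-- `v` is close to the `K`-fixed vectors -/
def D2 (ρ : G →* UU H) (v : H) (K : Subgroup G) (δ : ℝ) : Prop :=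
  ∃ w, (∀ g ∈ K, ap (ρ g) w = w) ∧ ‖v - w‖ ^ 2 ≤ δ

lemma D2.mono {ρ : G →* UU H} {v : H} {K K' : Subgroup G} {δ δ' : ℝ} (h : D2 ρ v K δ) (hK : K' ≤ K)
    (hδ : δ ≤ δ') : D2 ρ v K' δ' := by
  obtain ⟨w, h1, h2⟩ := h
  exact ⟨w, fun g hg => h1 g (hK hg), h2.trans hδ⟩

lemma D2.bot (ρ : G →* UU H) (v : H) : D2 ρ v ⊥ 0 := by
  refine ⟨v, fun g hg => ?_, by simp⟩
  rw [Subgroup.mem_bot.1 hg, map_one, ap_one]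

/-- average over a finite group of unitaries -/
noncomputable def av (C : Subgroup (UU H)) [Fintype C] (v : H) : H :=
  ((Fintype.card C : ℂ))⁻¹ • ∑ c : C, ap (c : UU H) v

lemma av_fixed (C : Subgroup (UU H)) [Fintype C] (v : H) {c : UU H} (hc : c ∈ C) : ap c (av C v) = av C v := by
  unfold av
  rw [ap_smul, ap_sum]
  congr 1
  exact Fintype.sum_equiv (Equiv.mulLeft (⟨c, hc⟩ : C)) _ _ fun x => rfl

lemma av_of_fixed (C : Subgroup (UU H)) [Fintype C] (v : H) (h : ∀ c ∈ C, ap c v = v) : av C v = v := by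
  unfold av
  rw [Finset.sum_congr rfl fun (c : C) _ => h c c.2]
  rw [Finset.sum_const, Finset.card_univ, ← Nat.cast_smul_eq_nsmul ℂ, smul_smul, inv_mul_cancel₀, one_smul]
  exact_mod_cast Fintype.card_ne_zero

lemma av_sub (C : Subgroup (UU H)) [Fintype C] (v w : H) : av C (v - w) = av C v - av C w := by
  unfold av
  simp only [ap_sub, Finset.sum_sub_distrib, smul_sub]

lemma av_inner (C : Subgroup (UU H)) [Fintype C] (v z : H) (h : ∀ c ∈ C, ap c z = z) :
    inner ℂ (v - av C v) z = 0 := by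
  rw [inner_sub_left, sub_eq_zero]
  unfold av
  rw [inner_smul_left, sum_inner]
  have : ∀ c : C, inner ℂ (ap (c : UU H) v) z = inner ℂ v z := fun c => by
    rw [← ap_inner (c : UU H) v z, h c c.2]
  rw [Finset.sum_congr rfl fun c _ => this c, Finset.sum_const, Finset.card_univ, nsmul_eq_mul, ← mul_assoc]
  have hc : (Fintype.card C : ℂ) ≠ 0 := by exact_mod_cast Fintype.card_ne_zero
  simp [hc]

lemma pyth2 (a b : H) (h : inner ℂ a b = 0) : ‖a + b‖ ^ 2 = ‖a‖ ^ 2 + ‖b‖ ^ 2 := by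
  have := norm_add_sq_eq_norm_sq_add_norm_sq_of_inner_eq_zero a b h
  nlinarith

/-- stabiliser of a vector -/
def stab (ρ : G →* UU H) (w : H) : Subgroup G where
  carrier := {g | ap (ρ g) w = w}
  mul_mem' := by
    intro x y hx hy
    simp only [Set.mem_ofPred_eq] at *
    rw [map_mul, ap_mul, hy, hx]
  one_mem' := by simp only [Set.mem_ofPred_eq, map_one, ap_one]
  inv_mem' := by
    intro x hx
    simp only [Set.mem_ofPred_eq] at *
    conv_lhs => rw [← hx]
    rw [map_inv, ap_inv_ap]

lemma mem_stab {ρ : G →* UU H} {w : H} {g : G} : g ∈ stab ρ w ↔ ap (ρ g) w = w := Iff.rfl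

lemma D2.sup {ρ : G →* UU H} (hρ : Finite ρ.range) {v : H} {B C : Subgroup G} {δ δ' : ℝ}
    (hB : D2 ρ v B δ) (hC : D2 ρ v C δ') (hn : C ≤ Subgroup.normalizer (B : Set G)) : D2 ρ v (B ⊔ C) (δ + δ') := by
  classical
  obtain ⟨b, b1, b2⟩ := hB
  obtain ⟨c, c1, c2⟩ := hC
  have : Finite (C.map ρ) := by
    refine Set.Finite.subset (s := (ρ.range : Set (UU H))) (Set.toFinite _) ?_
    rintro _ ⟨x, _, rfl⟩
    exact ⟨x, rfl⟩
  have := Fintype.ofFinite (C.map ρ)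
  have hmem : ∀ g ∈ C, ρ g ∈ C.map ρ := fun g hg => ⟨g, hg, rfl⟩
  refine ⟨av (C.map ρ) b, ?_, ?_⟩
  · have hs : B ⊔ C ≤ stab ρ (av (C.map ρ) b) := by
      refine sup_le (fun g hg => ?_) (fun g hg => av_fixed _ _ (hmem g hg))
      change ap (ρ g) (av (C.map ρ) b) = av (C.map ρ) b
      unfold av
      rw [ap_smul, ap_sum]
      congr 1
      refine Finset.sum_congr rfl ?_
      rintro ⟨_, x, hx, rfl⟩ _
      change ap (ρ g) (ap (ρ x) b) = ap (ρ x) b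
      have h1 : x⁻¹ * g * x ∈ B := by
        have := (Subgroup.mem_normalizer_iff.1 (hn (C.inv_mem hx)) g).1 hg
        rwa [inv_inv] at this
      have h2 := b1 _ h1
      have h3 : ρ g * ρ x = ρ x * ρ (x⁻¹ * g * x) := by
        rw [← map_mul, ← map_mul]; congr 1; group
      rw [← ap_mul, h3, ap_mul, h2]
    intro g hg; exact hs hg
  · have hc : ∀ x ∈ C.map ρ, ap x c = c := by
      rintro _ ⟨x, hx, rfl⟩; exact c1 x hx
    have e1 : v - av (C.map ρ) b = (v - av (C.map ρ) v) + av (C.map ρ) (v - b) := by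
      rw [av_sub]; abel
    have e2 : v - c = (v - av (C.map ρ) v) + av (C.map ρ) (v - c) := by
      rw [av_sub, av_of_fixed _ c hc]; abel
    have e3 : v - b = ((v - b) - av (C.map ρ) (v - b)) + av (C.map ρ) (v - b) := by abel
    have f1 := pyth2 (v - av (C.map ρ) v) (av (C.map ρ) (v - b)) (av_inner _ _ _ fun x hx => av_fixed _ _ hx)
    have f2 := pyth2 (v - av (C.map ρ) v) (av (C.map ρ) (v - c)) (av_inner _ _ _ fun x hx => av_fixed _ _ hx)
    have f3 := pyth2 ((v - b) - av (C.map ρ) (v - b)) (av (C.map ρ) (v - b)) (av_inner _ _ _ fun x hx => av_fixed _ _ hx)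
    rw [← e1] at f1
    rw [← e2] at f2
    rw [← e3] at f3
    nlinarith [sq_nonneg ‖(v - b) - av (C.map ρ) (v - b)‖, sq_nonneg ‖av (C.map ρ) (v - c)‖]

/-! ### triangular groups from root groups -/

lemma le_norm {B C : Subgroup G} (h : ∀ x ∈ C, ∀ y ∈ B, x * y * x⁻¹ ∈ B) : C ≤ Subgroup.normalizer (B : Set G) := by
  intro x hx
  rw [Subgroup.mem_normalizer_iff]
  intro y
  refine ⟨h x hx y, fun hy => ?_⟩
  have := h _ (C.inv_mem hx) _ hy
  have e : x⁻¹ * (x * y * x⁻¹) * x⁻¹⁻¹ = y := by group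
  rwa [e] at this

/-- column groups -/
def CG (K : ℕ → ℕ → Subgroup G) (j : ℕ) : ℕ → Subgroup G
  | 0 => ⊥
  | m + 1 => CG K j m ⊔ K m j

/-- triangular groups -/
def TG (K : ℕ → ℕ → Subgroup G) : ℕ → Subgroup G
  | 0 => ⊥
  | n + 1 => CG K n n ⊔ TG K n

lemma K_le_CG (K : ℕ → ℕ → Subgroup G) (j : ℕ) {i m : ℕ} (h : i < m) : K i j ≤ CG K j m := by
  induction m with
  | zero => omega
  | succ m ih =>
    rcases Nat.lt_succ_iff_lt_or_eq.1 h with h | rfl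
    · exact (ih h).trans le_sup_left
    · exact le_sup_right

lemma K_le_TG (K : ℕ → ℕ → Subgroup G) {i j n : ℕ} (h : i < j) (hn : j < n) : K i j ≤ TG K n := by
  induction n with
  | zero => omega
  | succ n ih =>
    rcases Nat.lt_succ_iff_lt_or_eq.1 hn with hn | rfl
    · exact (ih hn).trans le_sup_right
    · exact (K_le_CG K j h).trans le_sup_left

lemma CG_le {K : ℕ → ℕ → Subgroup G} {j m : ℕ} {B : Subgroup G} (h : ∀ i < m, K i j ≤ B) : CG K j m ≤ B := by
  induction m with
  | zero => exact bot_le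
  | succ m ih => exact sup_le (ih fun i hi => h i (by omega)) (h m (by omega))

lemma TG_le {K : ℕ → ℕ → Subgroup G} {n : ℕ} {B : Subgroup G} (h : ∀ i j, i < j → j < n → K i j ≤ B) : TG K n ≤ B := by
  induction n with
  | zero => exact bot_le
  | succ n ih => exact sup_le (CG_le fun i hi => h i n hi (by omega)) (ih fun i j h1 h2 => h i j h1 (by omega))

lemma le_norm_gen {B C : Subgroup G} (S : Subgroup G → Prop) (hB : ∀ T : Subgroup G, (∀ L, S L → L ≤ T) → B ≤ T)
    (h : ∀ x ∈ C, ∀ L, S L → ∀ y ∈ L, x * y * x⁻¹ ∈ B) : C ≤ Subgroup.normalizer (B : Set G) := by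
  refine le_norm fun x hx => ?_
  have := hB (B.comap (MulAut.conj x).toMonoidHom) fun L hL y hy => by
    rw [Subgroup.mem_comap]; exact h x hx L hL y hy
  intro y hy
  exact this hy

section tri
variable {d : ℕ} (hd : 3 ≤ d) {ρ : G →* UU H} (hρ : Finite ρ.range) {v : H} {K : ℕ → ℕ → Subgroup G} {δ : ℝ} (hδ : 0 ≤ δ)
  (c1 : ∀ i j, i + 1 < j → j < d → D2 ρ v (K i j ⊔ K (i + 1) j) δ)
  (c2 : D2 ρ v (K 0 1 ⊔ K 0 2) δ)
  (n1 : ∀ i i' j, i < j → i' < j → ∀ x ∈ K i j, ∀ y ∈ K i' j, x * y * x⁻¹ = y)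
  (n2 : ∀ a b i j, a < b → b < j → i < j → b ≠ i → ∀ x ∈ K a b, ∀ y ∈ K i j, x * y * x⁻¹ = y)
  (n3 : ∀ a b j, a < b → b < j → ∀ x ∈ K a b, ∀ y ∈ K b j, x * y * x⁻¹ ∈ K a j ⊔ K b j)
include hδ hρ c1 c2 n1 n2 n3 hd

lemma CG_even (j : ℕ) (hj : j < d) (n : ℕ) (hn : 2 * n ≤ j) : D2 ρ v (CG K j (2 * n)) (n * δ) := by
  induction n with
  | zero => simpa [CG] using D2.bot ρ v
  | succ n ih =>
    have := D2.sup hρ (ih (by omega)) (c1 (2 * n) j (by omega) hj) ?_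
    · refine this.mono ?_ (by push_cast; linarith)
      refine CG_le fun i hi => ?_
      rcases Nat.lt_or_ge i (2 * n) with h | h
      · exact (K_le_CG K j h).trans le_sup_left
      · refine le_trans ?_ le_sup_right
        obtain rfl | rfl : i = 2 * n ∨ i = 2 * n + 1 := by omega
        · exact le_sup_left
        · exact le_sup_right
    · refine sup_le ?_ ?_ <;>
      · refine le_norm_gen (fun L => ∃ i < 2 * n, L = K i j) (fun T h => CG_le fun i hi => h _ ⟨i, hi, rfl⟩) ?_
        rintro x hx _ ⟨i, hi, rfl⟩ y hy
        rw [n1 _ _ j (by omega) (by omega) x hx y hy]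
        exact K_le_CG K j hi hy

lemma CG_D2 (j : ℕ) (hj : j < d) : D2 ρ v (CG K j j) (((j + 1) / 2 : ℕ) * δ) := by
  obtain ⟨n, hn⟩ := Nat.even_or_odd' j
  rcases hn with hn | hn
  · have := CG_even hd hρ hδ c1 c2 n1 n2 n3 j hj n hn.ge
    rw [← hn] at this
    have e : (j + 1) / 2 = n := by omega
    rwa [e]
  · have e : (j + 1) / 2 = n + 1 := by omega
    rw [e]
    rcases Nat.eq_zero_or_pos n with h0 | h0
    · subst h0
      obtain rfl : j = 1 := by omega
      refine c2.mono (CG_le fun i hi => ?_) (by simp)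
      obtain rfl : i = 0 := by omega
      exact le_sup_left
    · obtain ⟨m, rfl⟩ : ∃ m, n = m + 1 := ⟨n - 1, by omega⟩
      have := D2.sup hρ (CG_even hd hρ hδ c1 c2 n1 n2 n3 j hj (m + 1) (by omega)) (c1 (2 * m + 1) j (by omega) hj) ?_
      · refine this.mono ?_ (by push_cast; linarith)
        refine CG_le fun i hi => ?_
        rcases Nat.lt_or_ge i (2 * (m + 1)) with h | h
        · exact (K_le_CG K j h).trans le_sup_left
        · refine le_trans ?_ le_sup_right
          obtain rfl : i = 2 * m + 1 + 1 := by omega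
          exact le_sup_right
      · refine sup_le ?_ ?_ <;>
        · refine le_norm_gen (fun L => ∃ i < 2 * (m + 1), L = K i j) (fun T h => CG_le fun i hi => h _ ⟨i, hi, rfl⟩) ?_
          rintro x hx _ ⟨i, hi, rfl⟩ y hy
          rw [n1 _ _ j (by omega) (by omega) x hx y hy]
          exact K_le_CG K j hi hy

lemma TG_D2 (n : ℕ) (hn : n ≤ d) : D2 ρ v (TG K n) ((n ^ 2 / 4 : ℕ) * δ) := by
  induction n with
  | zero => simpa [TG] using D2.bot ρ v
  | succ n ih =>
    have := D2.sup hρ (CG_D2 hd hρ hδ c1 c2 n1 n2 n3 n (by omega)) (ih (by omega)) ?_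
    · have e : (n + 1) ^ 2 / 4 = (n + 1) / 2 + n ^ 2 / 4 := by
        obtain ⟨m, rfl | rfl⟩ := Nat.even_or_odd' n
        · have : (2 * m + 1) ^ 2 = 4 * (m * m + m) + 1 := by ring
          have : (2 * m) ^ 2 = 4 * (m * m) := by ring
          omega
        · have : (2 * m + 1 + 1) ^ 2 = 4 * (m * m + 2 * m + 1) := by ring
          have : (2 * m + 1) ^ 2 = 4 * (m * m + m) + 1 := by ring
          omega
      rw [e]
      refine this.mono le_rfl (by push_cast; linarith)
    · refine TG_le fun a b hab hb => ?_
      refine le_norm_gen (fun L => ∃ i < n, L = K i n) (fun T h => CG_le fun i hi => h _ ⟨i, hi, rfl⟩) ?_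
      rintro x hx _ ⟨i, hi, rfl⟩ y hy
      by_cases hbi : b = i
      · subst hbi
        have := n3 a b n hab hb x hx y hy
        exact sup_le (K_le_CG K n (by omega)) (K_le_CG K n hb) this
      · rw [n2 a b i n hab hb hi hbi x hx y hy]
        exact K_le_CG K n hi hy
end tri
end Fou

open Matrix
namespace Fou
variable {H : Type*} [NormedAddCommGroup H] [InnerProductSpace ℂ H] [CompleteSpace H]
variable {d : ℕ} {R : Type*} [CommRing R]

lemma comm_mem {Γ : Type*} [Group Γ] (N : Subgroup Γ) [N.Normal] {x y z : Γ} (h : x * y = z * y * x) (hx : x ∈ N) : z ∈ N := by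
  rw [BG.comm_alg h]
  have := N.mul_mem hx (Subgroup.Normal.conj_mem ‹_› _ (N.inv_mem hx) y)
  convert this using 1
  group

/-- the ideal of a normal subgroup -/
def idl (hd : 3 ≤ d) (N : Subgroup (SLd d R)) [N.Normal] : Ideal R where
  carrier := {r | ∀ i j h, elem i j h r ∈ N}
  add_mem' := by
    intro a b ha hb i j h
    rw [elem_add]; exact N.mul_mem (ha i j h) (hb i j h)
  zero_mem' := by
    intro i j h
    rw [elem_zero]; exact N.one_mem
  smul_mem' := by
    intro c x hx i j h
    obtain ⟨l, h1, h2⟩ := exists_third hd i j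
    have := comm_mem N (elem_comm i l j h1.symm h2 h x c) (hx i l h1.symm)
    rwa [mul_comm] at this

lemma mem_idl (hd : 3 ≤ d) (N : Subgroup (SLd d R)) [N.Normal] {r : R} : r ∈ idl hd N ↔ ∀ i j h, elem i j h r ∈ N := Iff.rfl

variable (hd : 3 ≤ d) (ρ : SLd d R →* UU H)

/-- root subgroups over the finite quotient -/
noncomputable def ER (i j : Fin d) (h : i ≠ j) (a : R ⧸ idl hd ρ.ker) : UU H :=
  ρ (elem i j h (Function.surjInv Ideal.Quotient.mk_surjective a))

lemma ER_mk (i j : Fin d) (h : i ≠ j) (r : R) : ER hd ρ i j h (Ideal.Quotient.mk _ r) = ρ (elem i j h r) := by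
  unfold ER
  set s := Function.surjInv Ideal.Quotient.mk_surjective (Ideal.Quotient.mk (idl hd ρ.ker) r) with hs
  have e : Ideal.Quotient.mk (idl hd ρ.ker) s = Ideal.Quotient.mk _ r := Function.surjInv_eq _ _
  rw [Ideal.Quotient.eq] at e
  have := e i j h
  rw [MonoidHom.mem_ker] at this
  have e2 : s = (s - r) + r := by ring
  rw [e2, elem_add, map_mul, this, one_mul]

lemma quot_finite (hρ : Finite ρ.range) : Finite (R ⧸ idl hd ρ.ker) := by
  let f : (R ⧸ idl hd ρ.ker) → (Fin d → Fin d → ρ.range) := fun a i j =>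
    if h : i ≠ j then ⟨ER hd ρ i j h a, ⟨_, rfl⟩⟩ else 1
  refine Finite.of_injective f ?_
  intro a b hab
  obtain ⟨a, rfl⟩ := Ideal.Quotient.mk_surjective a
  obtain ⟨b, rfl⟩ := Ideal.Quotient.mk_surjective b
  rw [Ideal.Quotient.eq, mem_idl]
  intro i j h
  have := congrFun (congrFun hab i) j
  simp only [f, h, ne_eq, not_false_eq_true, dif_pos] at this
  have := congrArg Subtype.val this
  simp only [ER_mk] at this
  rw [MonoidHom.mem_ker, sub_eq_add_neg, elem_add, elem_neg, map_mul, map_inv, this, mul_inv_cancel]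

lemma ER_add (i j : Fin d) (h : i ≠ j) (a b) : ER hd ρ i j h (a + b) = ER hd ρ i j h a * ER hd ρ i j h b := by
  obtain ⟨a, rfl⟩ := Ideal.Quotient.mk_surjective a
  obtain ⟨b, rfl⟩ := Ideal.Quotient.mk_surjective b
  rw [← map_add, ER_mk, ER_mk, ER_mk, elem_add, map_mul]

lemma ER_zero (i j : Fin d) (h : i ≠ j) : ER hd ρ i j h 0 = 1 := by
  rw [← map_zero (Ideal.Quotient.mk _), ER_mk, elem_zero, map_one]

lemma ER_comm (i j k : Fin d) (hij : i ≠ j) (hjk : j ≠ k) (hik : i ≠ k) (a b) :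
    ER hd ρ i j hij a * ER hd ρ j k hjk b = ER hd ρ i k hik (a * b) * ER hd ρ j k hjk b * ER hd ρ i j hij a := by
  obtain ⟨a, rfl⟩ := Ideal.Quotient.mk_surjective a
  obtain ⟨b, rfl⟩ := Ideal.Quotient.mk_surjective b
  rw [← map_mul (Ideal.Quotient.mk _), ER_mk, ER_mk, ER_mk, ← map_mul ρ, ← map_mul ρ, ← map_mul ρ, elem_comm i j k hij hjk hik]

lemma ER_commute (i j k l : Fin d) (hij : i ≠ j) (hkl : k ≠ l) (hjk : j ≠ k) (hil : i ≠ l) (a b) :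
    ER hd ρ i j hij a * ER hd ρ k l hkl b = ER hd ρ k l hkl b * ER hd ρ i j hij a := by
  obtain ⟨a, rfl⟩ := Ideal.Quotient.mk_surjective a
  obtain ⟨b, rfl⟩ := Ideal.Quotient.mk_surjective b
  rw [ER_mk, ER_mk, ← map_mul ρ, ← map_mul ρ, elem_commute i j k l hij hkl hjk hil]

/-- two commuting root groups -/
noncomputable def VV (i j i' j' : Fin d) (h : i ≠ j) (h' : i' ≠ j') (hji' : j ≠ i') (hij' : i ≠ j') :
    Multiplicative ((R ⧸ idl hd ρ.ker) × (R ⧸ idl hd ρ.ker)) →* UU H where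
  toFun m := ER hd ρ i j h m.toAdd.1 * ER hd ρ i' j' h' m.toAdd.2
  map_one' := by
    change ER hd ρ i j h 0 * ER hd ρ i' j' h' 0 = 1
    rw [ER_zero, ER_zero, one_mul]
  map_mul' a b := by
    change ER hd ρ i j h (a.toAdd.1 + b.toAdd.1) * ER hd ρ i' j' h' (a.toAdd.2 + b.toAdd.2) = _
    rw [ER_add, ER_add, mul_assoc, ← mul_assoc _ (ER hd ρ i' j' h' _), ER_commute hd ρ i j i' j' h h' hji' hij']
    simp only [mul_assoc]

lemma VV_apply (i j i' j' : Fin d) (h : i ≠ j) (h' : i' ≠ j') (hji' : j ≠ i') (hij' : i ≠ j') (m) :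
    VV hd ρ i j i' j' h h' hji' hij' (Multiplicative.ofAdd m) = ER hd ρ i j h m.1 * ER hd ρ i' j' h' m.2 := rfl
end Fou

open Matrix
namespace Fou
variable {H : Type*} [NormedAddCommGroup H] [InnerProductSpace ℂ H] [CompleteSpace H]

lemma ga1 {Γ : Type*} [Group Γ] {p x y z : Γ} (h1 : p * x = x * p) (h2 : p * y = z * y * p) :
    p * (x * y) = (x * z) * y * p := by
  rw [← mul_assoc, h1, mul_assoc, h2]; simp only [mul_assoc]
lemma ga2 {Γ : Type*} [Group Γ] {p x y z : Γ} (h1 : p * x = z * x * p) (h2 : p * y = y * p) (h3 : z * x = x * z) :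
    p * (x * y) = x * (z * y) * p := by
  rw [← mul_assoc, h1, mul_assoc, h2, h3]; simp only [mul_assoc]
lemma ga3 {Γ : Type*} [Group Γ] {p y z z' : Γ} (h1 : y * p = z * p * y) (h2 : z' * z = 1) :
    p * y = z' * y * p := by
  rw [mul_assoc, h1, ← mul_assoc, ← mul_assoc, h2, one_mul]

section
variable {d : ℕ} {R : Type*} [CommRing R] (hd : 3 ≤ d) (ρ : SLd d R →* UU H)

lemma ER_neg_mul (i j : Fin d) (h : i ≠ j) (a b) (hab : a + b = 0) : ER hd ρ i j h a * ER hd ρ i j h b = 1 := by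
  rw [← ER_add, hab, ER_zero]

lemma col_p (i i' j : Fin d) (hi : i ≠ i') (h : i ≠ j) (h' : i' ≠ j) (r m) :
    ER hd ρ i i' hi r * VV hd ρ i j i' j h h' h'.symm h (Multiplicative.ofAdd m) =
      VV hd ρ i j i' j h h' h'.symm h (Multiplicative.ofAdd (sp r m)) * ER hd ρ i i' hi r := by
  rw [VV_apply, VV_apply]
  change _ = ER hd ρ i j h (m.1 + r * m.2) * ER hd ρ i' j h' m.2 * _
  rw [ER_add]
  exact ga1 (ER_commute hd ρ i i' i j hi h hi.symm h _ _) (ER_comm hd ρ i i' j hi h' h _ _)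

lemma col_q (i i' j : Fin d) (hi : i ≠ i') (h : i ≠ j) (h' : i' ≠ j) (r m) :
    ER hd ρ i' i hi.symm r * VV hd ρ i j i' j h h' h'.symm h (Multiplicative.ofAdd m) =
      VV hd ρ i j i' j h h' h'.symm h (Multiplicative.ofAdd (sq r m)) * ER hd ρ i' i hi.symm r := by
  rw [VV_apply, VV_apply]
  change _ = ER hd ρ i j h m.1 * ER hd ρ i' j h' (m.2 + r * m.1) * _
  rw [add_comm m.2, ER_add]
  exact ga2 (ER_comm hd ρ i' i j hi.symm h h' _ _) (ER_commute hd ρ i' i i' j hi.symm h' hi h' _ _)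
    (ER_commute hd ρ i' j i j h' h h.symm h' _ _)

lemma row_p (i j j' : Fin d) (hj : j ≠ j') (h : i ≠ j) (h' : i ≠ j') (r m) :
    ER hd ρ j' j hj.symm (-r) * VV hd ρ i j i j' h h' h.symm h' (Multiplicative.ofAdd m) =
      VV hd ρ i j i j' h h' h.symm h' (Multiplicative.ofAdd (sp r m)) * ER hd ρ j' j hj.symm (-r) := by
  rw [VV_apply, VV_apply]
  change _ = ER hd ρ i j h (m.1 + r * m.2) * ER hd ρ i j' h' m.2 * _
  rw [ER_add]
  exact ga1 (ER_commute hd ρ j' j i j hj.symm h h.symm hj.symm _ _)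
    (ga3 (ER_comm hd ρ i j' j h' hj.symm h _ _) (ER_neg_mul hd ρ _ _ _ _ _ (by ring)))

lemma row_q (i j j' : Fin d) (hj : j ≠ j') (h : i ≠ j) (h' : i ≠ j') (r m) :
    ER hd ρ j j' hj (-r) * VV hd ρ i j i j' h h' h.symm h' (Multiplicative.ofAdd m) =
      VV hd ρ i j i j' h h' h.symm h' (Multiplicative.ofAdd (sq r m)) * ER hd ρ j j' hj (-r) := by
  rw [VV_apply, VV_apply]
  change _ = ER hd ρ i j h m.1 * ER hd ρ i j' h' (m.2 + r * m.1) * _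
  rw [add_comm m.2, ER_add]
  exact ga2 (ga3 (ER_comm hd ρ i j j' h hj h' _ _) (ER_neg_mul hd ρ _ _ _ _ _ (by ring)))
    (ER_commute hd ρ j j' i j' hj h' h'.symm hj _ _)
    (ER_commute hd ρ i j' i j h' h h'.symm h _ _)

/-- root groups -/
def KK (d : ℕ) (R : Type*) [CommRing R] (i j : ℕ) : Subgroup (SLd d R) :=
  Subgroup.closure {g | ∃ (a b : Fin d) (h : a ≠ b) (r : R), (a : ℕ) = i ∧ (b : ℕ) = j ∧ g = elem a b h r}

lemma KK_le {i j : ℕ} {B : Subgroup (SLd d R)} (h : ∀ (a b : Fin d) (h : a ≠ b) (r : R), (a : ℕ) = i → (b : ℕ) = j → elem a b h r ∈ B) :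
    KK d R i j ≤ B := by
  refine (Subgroup.closure_le _).2 ?_
  rintro _ ⟨a, b, hab, r, h1, h2, rfl⟩
  exact h a b hab r h1 h2

lemma KK_mem {i j : ℕ} {x : SLd d R} (hx : x ∈ KK d R i j) : x = 1 ∨
    ∃ (a b : Fin d) (h : a ≠ b) (r : R), (a : ℕ) = i ∧ (b : ℕ) = j ∧ x = elem a b h r := by
  induction hx using Subgroup.closure_induction with
  | mem x hx => exact Or.inr hx
  | one => exact Or.inl rfl
  | mul x y _ _ hx hy =>
    rcases hx with rfl | ⟨a, b, h, r, h1, h2, rfl⟩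
    · rwa [one_mul]
    · rcases hy with rfl | ⟨a', b', h', r', h1', h2', rfl⟩
      · rw [mul_one]; exact Or.inr ⟨a, b, h, r, h1, h2, rfl⟩
      · obtain rfl : a = a' := Fin.ext (by omega)
        obtain rfl : b = b' := Fin.ext (by omega)
        exact Or.inr ⟨a, b, h, r + r', h1, h2, (elem_add _ _ _ _ _).symm⟩
  | inv x _ hx =>
    rcases hx with rfl | ⟨a, b, h, r, h1, h2, rfl⟩
    · left; exact inv_one
    · exact Or.inr ⟨a, b, h, -r, h1, h2, (elem_neg _ _ _ _).symm⟩

lemma elem_mem_KK {a b : Fin d} (h : a ≠ b) (r : R) : elem a b h r ∈ KK d R a b :=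
  Subgroup.subset_closure ⟨a, b, h, r, rfl, rfl, rfl⟩

lemma conj_one {Γ : Type*} [Group Γ] (y : Γ) : (1 : Γ) * y * (1 : Γ)⁻¹ = y := by group
lemma conj_one' {Γ : Type*} [Group Γ] (y : Γ) : y * 1 * y⁻¹ = 1 := by group

lemma KK_commute {i j k l : ℕ} (hjk : j ≠ k) (hil : i ≠ l) :
    ∀ x ∈ KK d R i j, ∀ y ∈ KK d R k l, x * y * x⁻¹ = y := by
  intro x hx y hy
  rcases KK_mem hx with rfl | ⟨a, b, h, r, h1, h2, rfl⟩
  · exact conj_one y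
  rcases KK_mem hy with rfl | ⟨a', b', h', r', h1', h2', rfl⟩
  · exact conj_one' _
  exact BG.conj_alg2 (elem_commute a b a' b' h h' (fun e => hjk (by rw [← h2, e, h1'])) (fun e => hil (by rw [← h1, e, h2'])) _ _)

lemma KK_conj {i j k : ℕ} (hik : i ≠ k) :
    ∀ x ∈ KK d R i j, ∀ y ∈ KK d R j k, x * y * x⁻¹ ∈ KK d R i k ⊔ KK d R j k := by
  intro x hx y hy
  rcases KK_mem hx with rfl | ⟨a, b, h, r, rfl, rfl, rfl⟩
  · rw [conj_one y]; exact (le_sup_right : _ ≤ KK d R i k ⊔ KK d R j k) hy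
  rcases KK_mem hy with rfl | ⟨a', b', h', r', h1', rfl, rfl⟩
  · rw [conj_one']; exact Subgroup.one_mem _
  obtain rfl : a' = b := Fin.ext h1'
  have hab : a ≠ b' := fun e => hik (by rw [e])
  rw [BG.conj_alg1 (elem_comm a a' b' h h' hab r r')]
  exact Subgroup.mul_mem_sup (elem_mem_KK _ _) (elem_mem_KK _ _)

lemma KK_conj' {i j k : ℕ} (hik : i ≠ k) :
    ∀ x ∈ KK d R j k, ∀ y ∈ KK d R i j, x * y * x⁻¹ ∈ KK d R i k ⊔ KK d R i j := by
  intro x hx y hy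
  rcases KK_mem hx with rfl | ⟨a', b', h', r', rfl, rfl, rfl⟩
  · rw [conj_one y]; exact (le_sup_right : _ ≤ KK d R i k ⊔ KK d R i j) hy
  rcases KK_mem hy with rfl | ⟨a, b, h, r, rfl, h1', rfl⟩
  · rw [conj_one']; exact Subgroup.one_mem _
  obtain rfl : b = a' := Fin.ext h1'
  have hab : a ≠ b' := fun e => hik (by rw [e])
  rw [BG.conj_alg3 (elem_comm a b b' h h' hab r r')]
  exact Subgroup.mul_mem_sup (Subgroup.inv_mem _ (elem_mem_KK _ _)) (elem_mem_KK _ _)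
end

section
variable {d k : ℕ} (hd : 3 ≤ d) (ρ : SLd d (MvPolynomial (Fin k) ℤ) →* UU H) (hρ : Finite ρ.range) (v : H)
  (hS : ∀ s ∈ genSet d k, ‖ap (ρ s) v - v‖ ≤ 1)
include hd hρ hS

omit hρ hS in
lemma hgen_mk (a : MvPolynomial (Fin k) ℤ ⧸ idl hd ρ.ker) : ∃ Q : MvPolynomial (Fin k) ℤ,
    MvPolynomial.aeval (fun n => Ideal.Quotient.mk (idl hd ρ.ker) (MvPolynomial.X n)) Q = a := by
  obtain ⟨Q, rfl⟩ := Ideal.Quotient.mk_surjective a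
  refine ⟨Q, ?_⟩
  have := MvPolynomial.aeval_unique (Ideal.Quotient.mkₐ ℤ (idl hd ρ.ker))
  exact (DFunLike.congr_fun this Q).symm

omit hρ in
lemma ER_one_disp (i j : Fin d) (h : i ≠ j) : ‖ap (ER hd ρ i j h 1) v - v‖ ≤ 1 := by
  rw [← map_one (Ideal.Quotient.mk _), ER_mk]
  exact hS _ (Or.inl ⟨i, j, h, Or.inl rfl⟩)
omit hρ in
lemma ER_neg_disp (i j : Fin d) (h : i ≠ j) : ‖ap (ER hd ρ i j h (-1)) v - v‖ ≤ 1 := by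
  rw [← map_one (Ideal.Quotient.mk _), ← map_neg, ER_mk]
  exact hS _ (Or.inl ⟨i, j, h, Or.inr rfl⟩)
omit hρ in
lemma ER_X_disp (i j : Fin d) (h : i ≠ j) (hij : (i : ℕ) + 1 = j ∨ (j : ℕ) + 1 = i) (n : Fin k) :
    ‖ap (ER hd ρ i j h (Ideal.Quotient.mk _ (MvPolynomial.X n))) v - v‖ ≤ 1 := by
  rw [ER_mk]
  exact hS _ (Or.inr ⟨i, j, h, n, hij, Or.inl rfl⟩)
omit hρ in
lemma ER_nX_disp (i j : Fin d) (h : i ≠ j) (hij : (i : ℕ) + 1 = j ∨ (j : ℕ) + 1 = i) (n : Fin k) :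
    ‖ap (ER hd ρ i j h (-Ideal.Quotient.mk _ (MvPolynomial.X n))) v - v‖ ≤ 1 := by
  rw [← map_neg, ER_mk]
  exact hS _ (Or.inr ⟨i, j, h, n, hij, Or.inr rfl⟩)

lemma pair_D2 {i j i' j' : Fin d} {h : i ≠ j} {h' : i' ≠ j'} {hji' : j ≠ i'} {hij' : i ≠ j'}
    (p q : (MvPolynomial (Fin k) ℤ ⧸ idl hd ρ.ker) → UU H)
    (hp : ∀ r m, p r * VV hd ρ i j i' j' h h' hji' hij' (Multiplicative.ofAdd m) =
      VV hd ρ i j i' j' h h' hji' hij' (Multiplicative.ofAdd (sp r m)) * p r)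
    (hq : ∀ r m, q r * VV hd ρ i j i' j' h h' hji' hij' (Multiplicative.ofAdd m) =
      VV hd ρ i j i' j' h h' hji' hij' (Multiplicative.ofAdd (sq r m)) * q r)
    (p1 : ‖ap (p 1) v - v‖ ≤ 1) (p2 : ‖ap (p (-1)) v - v‖ ≤ 1)
    (p3 : ∀ n, ‖ap (p (Ideal.Quotient.mk _ (MvPolynomial.X n))) v - v‖ ≤ 1)
    (q1 : ‖ap (q 1) v - v‖ ≤ 1) (q2 : ‖ap (q (-1)) v - v‖ ≤ 1)
    (q3 : ∀ n, ‖ap (q (Ideal.Quotient.mk _ (MvPolynomial.X n))) v - v‖ ≤ 1) :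
    D2 ρ v (KK d _ i j ⊔ KK d _ i' j') (25 * 16 ^ k) := by
  have := quot_finite hd ρ hρ
  have := Fintype.ofFinite (MvPolynomial (Fin k) ℤ ⧸ idl hd ρ.ker)
  obtain ⟨w, w1, w2⟩ := relT (fun n => Ideal.Quotient.mk (idl hd ρ.ker) (MvPolynomial.X n)) (hgen_mk hd ρ)
    (VV hd ρ i j i' j' h h' hji' hij') v p q hp hq p1 p2 p3 q1 q2 q3
    (by
      have := ER_one_disp hd ρ v hS i j h
      rw [VV_apply, ER_zero, mul_one]; exact this)
    (by
      have := ER_one_disp hd ρ v hS i' j' h'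
      rw [VV_apply, ER_zero, one_mul]; exact this)
  refine ⟨w, ?_, w2⟩
  have : KK d _ i j ⊔ KK d _ i' j' ≤ stab ρ w := by
    refine sup_le (KK_le ?_) (KK_le ?_)
    · intro a b hab r ha hb
      obtain rfl := Fin.ext ha
      obtain rfl := Fin.ext hb
      rw [mem_stab, ← ER_mk hd]
      have := w1 (Multiplicative.ofAdd (Ideal.Quotient.mk _ r, 0))
      rwa [VV_apply, ER_zero, mul_one] at this
    · intro a b hab r ha hb
      obtain rfl := Fin.ext ha
      obtain rfl := Fin.ext hb
      rw [mem_stab, ← ER_mk hd]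
      have := w1 (Multiplicative.ofAdd (0, Ideal.Quotient.mk _ r))
      rwa [VV_apply, ER_zero, one_mul] at this
  exact fun g hg => this hg

lemma col_D2 (i j : ℕ) (hi : i + 1 < d) (hj : j < d) (h1 : i ≠ j) (h2 : i + 1 ≠ j) :
    D2 ρ v (KK d _ i j ⊔ KK d _ (i + 1) j) (25 * 16 ^ k) := by
  obtain ⟨a, ha⟩ : ∃ a : Fin d, (a : ℕ) = i := ⟨⟨i, by omega⟩, rfl⟩
  obtain ⟨a', ha'⟩ : ∃ a : Fin d, (a : ℕ) = i + 1 := ⟨⟨i + 1, by omega⟩, rfl⟩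
  obtain ⟨b, hb⟩ : ∃ a : Fin d, (a : ℕ) = j := ⟨⟨j, by omega⟩, rfl⟩
  have e0 : a ≠ a' := fun e => by subst e; omega
  have e1 : a ≠ b := fun e => by subst e; omega
  have e2 : a' ≠ b := fun e => by subst e; omega
  rw [← ha', ← ha, ← hb]
  exact pair_D2 hd ρ hρ v hS (ER hd ρ a a' e0) (ER hd ρ a' a e0.symm) (col_p hd ρ a a' b e0 e1 e2) (col_q hd ρ a a' b e0 e1 e2)
    (ER_one_disp hd ρ v hS _ _ _) (ER_neg_disp hd ρ v hS _ _ _) (ER_X_disp hd ρ v hS _ _ _ (by omega))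
    (ER_one_disp hd ρ v hS _ _ _) (ER_neg_disp hd ρ v hS _ _ _) (ER_X_disp hd ρ v hS _ _ _ (by omega))

lemma row_D2 (i j : ℕ) (hi : i + 1 < d) (hj : j < d) (h1 : i ≠ j) (h2 : i + 1 ≠ j) :
    D2 ρ v (KK d _ j i ⊔ KK d _ j (i + 1)) (25 * 16 ^ k) := by
  obtain ⟨a, ha⟩ : ∃ a : Fin d, (a : ℕ) = i := ⟨⟨i, by omega⟩, rfl⟩
  obtain ⟨a', ha'⟩ : ∃ a : Fin d, (a : ℕ) = i + 1 := ⟨⟨i + 1, by omega⟩, rfl⟩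
  obtain ⟨b, hb⟩ : ∃ a : Fin d, (a : ℕ) = j := ⟨⟨j, by omega⟩, rfl⟩
  have e0 : a ≠ a' := fun e => by subst e; omega
  have e1 : b ≠ a := fun e => by subst e; omega
  have e2 : b ≠ a' := fun e => by subst e; omega
  rw [← ha', ← ha, ← hb]
  exact pair_D2 hd ρ hρ v hS (fun r => ER hd ρ a' a e0.symm (-r)) (fun r => ER hd ρ a a' e0 (-r))
    (row_p hd ρ b a a' e0 e1 e2) (row_q hd ρ b a a' e0 e1 e2)
    (ER_neg_disp hd ρ v hS _ _ _) (by rw [neg_neg]; exact ER_one_disp hd ρ v hS _ _ _) (ER_nX_disp hd ρ v hS _ _ _ (by omega))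
    (ER_neg_disp hd ρ v hS _ _ _) (by rw [neg_neg]; exact ER_one_disp hd ρ v hS _ _ _) (ER_nX_disp hd ρ v hS _ _ _ (by omega))

lemma UG_D2 : D2 ρ v (BG.UG d _) ((d ^ 2 / 4 : ℕ) * (25 * 16 ^ k)) := by
  have := TG_D2 hd hρ (v := v) (K := KK d _) (δ := 25 * 16 ^ k) (by positivity)
    (fun i j h1 h2 => col_D2 hd ρ hρ v hS i j (by omega) h2 (by omega) (by omega))
    (row_D2 hd ρ hρ v hS 1 0 (by omega) (by omega) (by omega) (by omega))
    (fun i i' j h1 h2 => KK_commute (by omega) (by omega))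
    (fun a b i j h1 h2 h3 h4 => KK_commute (by omega) (by omega))
    (fun a b j h1 h2 => KK_conj (by omega)) d le_rfl
  refine this.mono ((Subgroup.closure_le _).2 ?_) le_rfl
  rintro _ ⟨a, b, h, r, hf, rfl⟩
  exact K_le_TG (KK d _) (by simpa using hf) b.2 (elem_mem_KK h r)

lemma LG_D2 : D2 ρ v (BG.LG d _) ((d ^ 2 / 4 : ℕ) * (25 * 16 ^ k)) := by
  have := TG_D2 hd hρ (v := v) (K := fun i j => KK d _ j i) (δ := 25 * 16 ^ k) (by positivity)
    (fun i j h1 h2 => row_D2 hd ρ hρ v hS i j (by omega) h2 (by omega) (by omega))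
    (col_D2 hd ρ hρ v hS 1 0 (by omega) (by omega) (by omega) (by omega))
    (fun i i' j h1 h2 => KK_commute (by omega) (by omega))
    (fun a b i j h1 h2 h3 h4 => KK_commute (by omega) (by omega))
    (fun a b j h1 h2 => KK_conj' (by omega)) d le_rfl
  refine this.mono ((Subgroup.closure_le _).2 ?_) le_rfl
  rintro _ ⟨a, b, h, r, hf, rfl⟩
  have hf' : (b : ℕ) < a := by simp at hf; exact hf
  exact K_le_TG (fun i j => KK d _ j i) hf' a.2 (elem_mem_KK h r)

/-- every element is close to acting centrally -/
lemma near_central (g : SLd d (MvPolynomial (Fin k) ℤ)) : ∃ z : SLd d (MvPolynomial (Fin k) ℤ),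
    (∀ x, ρ z * ρ x = ρ x * ρ z) ∧ ‖ap (ρ g * ρ z) v - v‖ ^ 2 ≤ 64 * ((d ^ 2 / 4 : ℕ) * (25 * 16 ^ k)) := by
  set δ : ℝ := (d ^ 2 / 4 : ℕ) * (25 * 16 ^ k) with hδ
  have hδ0 : 0 ≤ δ := by positivity
  have := quot_finite hd ρ hρ
  obtain ⟨y, hy, hyk⟩ := BG.Y4_lift (Ideal.Quotient.mk (idl hd ρ.ker)) Ideal.Quotient.mk_surjective (Lau.EE_top hd k g)
  have disp : ∀ K, D2 ρ v K δ → ∀ g ∈ K, ‖ap (ρ g) v - v‖ ≤ 2 * √δ := by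
    rintro K ⟨w, w1, w2⟩ g hg
    have e : ap (ρ g) v - v = ap (ρ g) (v - w) - (v - w) := by rw [ap_sub, w1 g hg]; abel
    have h1 : ‖v - w‖ ≤ √δ := Real.le_sqrt_of_sq_le w2
    rw [e]
    refine (norm_sub_le _ _).trans ?_
    rw [ap_norm]; linarith
  have tri : ∀ a b : SLd d (MvPolynomial (Fin k) ℤ), ‖ap (ρ (a * b)) v - v‖ ≤ ‖ap (ρ a) v - v‖ + ‖ap (ρ b) v - v‖ := by
    intro a b
    have e : ap (ρ (a * b)) v - v = (ap (ρ a) v - v) + ap (ρ a) (ap (ρ b) v - v) := by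
      rw [map_mul, ap_mul, ap_sub]; abel
    rw [e]
    refine (norm_add_le _ _).trans ?_
    rw [ap_norm]
  refine ⟨(y⁻¹ * g)⁻¹, ?_, ?_⟩
  · intro x
    have h := rel_commutator hd ρ.ker (idl hd ρ.ker) (fun i j h r hr => hr i j h) (y⁻¹ * g) hyk (Lau.EE_top hd k x)
    rw [MonoidHom.mem_ker, map_mul, map_mul, map_mul, map_inv ρ x, map_inv ρ (y⁻¹ * g), mul_inv_eq_one, mul_inv_eq_iff_eq_mul] at h
    rw [map_inv, inv_mul_eq_iff_eq_mul, ← mul_assoc, h, mul_assoc, mul_inv_cancel, mul_one]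
  · have e : ρ g * ρ (y⁻¹ * g)⁻¹ = ρ y := by
      rw [← map_mul]; congr 1; rw [_root_.mul_inv_rev, inv_inv, ← mul_assoc, mul_inv_cancel, one_mul]
    rw [e]
    obtain ⟨a, ha, b, hb, c, hc, e', he, rfl⟩ := hy
    have h1 := disp _ (UG_D2 hd ρ hρ v hS) a ha
    have h2 := disp _ (LG_D2 hd ρ hρ v hS) b hb
    have h3 := disp _ (UG_D2 hd ρ hρ v hS) c hc
    have h4 := disp _ (LG_D2 hd ρ hρ v hS) e' he
    have t1 := tri (a * b * c) e'
    have t2 := tri (a * b) c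
    have t3 := tri a b
    have h5 : ‖ap (ρ (a * b * c * e')) v - v‖ ≤ 8 * √δ := by linarith
    calc _ ≤ (8 * √δ) ^ 2 := pow_le_pow_left₀ (norm_nonneg _) h5 2
      _ = 64 * δ := by rw [mul_pow, Real.sq_sqrt hδ0]; norm_num
end
end Fou

open Matrix
namespace Fou
open scoped ComplexConjugate
variable {H : Type*} [NormedAddCommGroup H] [InnerProductSpace ℂ H] [CompleteSpace H]

section top
variable (Γ : Subgroup (UU H)) [Fintype Γ] (u : H)

/-- averaged rank one projections -/
noncomputable def TT : H →ₗ[ℂ] H where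
  toFun w := ∑ γ : Γ, inner ℂ (ap (γ : UU H) u) w • ap (γ : UU H) u
  map_add' x y := by simp only [inner_add_right, add_smul, Finset.sum_add_distrib]
  map_smul' c x := by simp only [inner_smul_right, mul_smul, Finset.smul_sum, RingHom.id_apply]

lemma TT_apply (w : H) : TT Γ u w = ∑ γ : Γ, inner ℂ (ap (γ : UU H) u) w • ap (γ : UU H) u := rfl

lemma TT_inner (x y : H) : inner ℂ x (TT Γ u y) =
    ∑ γ : Γ, inner ℂ (ap (γ : UU H) u) y * inner ℂ x (ap (γ : UU H) u) := by
  rw [TT_apply, inner_sum]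
  simp only [inner_smul_right]

lemma TT_symm (x y : H) : inner ℂ (TT Γ u x) y = inner ℂ x (TT Γ u y) := by
  rw [TT_inner, TT_apply, sum_inner]
  refine Finset.sum_congr rfl fun γ _ => ?_
  rw [inner_smul_left, inner_conj_symm, mul_comm]

lemma TT_self (x : H) : inner ℂ x (TT Γ u x) = ((∑ γ : Γ, ‖inner ℂ x (ap (γ : UU H) u)‖ ^ 2 : ℝ) : ℂ) := by
  rw [TT_inner]
  push_cast
  refine Finset.sum_congr rfl fun γ _ => ?_
  rw [← inner_conj_symm, Complex.conj_mul']

lemma TT_comm {g : UU H} (hg : g ∈ Γ) (w : H) : TT Γ u (ap g w) = ap g (TT Γ u w) := by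
  rw [TT_apply, TT_apply, ap_sum]
  refine (Fintype.sum_equiv (Equiv.mulLeft (⟨g, hg⟩ : Γ)) _ _ fun x => ?_).symm
  change ap g (inner ℂ (ap (x : UU H) u) w • ap (x : UU H) u) = inner ℂ (ap g (ap (x : UU H) u)) (ap g w) • ap g (ap (x : UU H) u)
  rw [ap_smul, ap_inner]

lemma top_eig (hu : u ≠ 0) (h : (Fintype.card Γ : ℝ) * ‖u‖ ^ 4 < 2 * ∑ γ : Γ, ‖inner ℂ u (ap (γ : UU H) u)‖ ^ 2) :
    ∃ b : H, b ≠ 0 ∧ ∀ γ ∈ Γ, ∃ c : ℂ, ap γ b = c • b := by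
  classical
  let W : Submodule ℂ H := Submodule.span ℂ (Set.range fun γ : Γ => ap (γ : UU H) u)
  have hW : ∀ γ : Γ, ap (γ : UU H) u ∈ W := fun γ => Submodule.subset_span ⟨γ, rfl⟩
  have huW : u ∈ W := hW 1
  have hgW : ∀ g ∈ Γ, ∀ w ∈ W, ap g w ∈ W := by
    intro g hg w hw
    induction hw using Submodule.span_induction with
    | mem x hx => obtain ⟨γ, rfl⟩ := hx; exact hW (⟨g, hg⟩ * γ)
    | zero => rw [ap_zero]; exact W.zero_mem
    | add x y _ _ hx hy => rw [ap_add]; exact W.add_mem hx hy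
    | smul c x _ hx => rw [ap_smul]; exact W.smul_mem _ hx
  have hfd : FiniteDimensional ℂ W := FiniteDimensional.span_of_finite ℂ (Set.finite_range _)
  have hTW : ∀ w ∈ W, TT Γ u w ∈ W := fun w _ => by
    rw [TT_apply]; exact W.sum_mem fun γ _ => W.smul_mem _ (hW γ)
  let T : W →ₗ[ℂ] W := (TT Γ u).restrict hTW
  have hT : T.IsSymmetric := fun x y => TT_symm Γ u x y
  let n := Module.finrank ℂ W
  let B := hT.eigenvectorBasis (n := n) rfl
  let l := hT.eigenvalues (n := n) rfl
  have hB : ∀ i, TT Γ u (B i : H) = (l i : ℂ) • (B i : H) := fun i => by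
    have := hT.apply_eigenvectorBasis (n := n) rfl i
    exact congrArg Subtype.val this
  have par : ∀ w ∈ W, ∑ i, ‖inner ℂ (B i : H) w‖ ^ 2 = ‖w‖ ^ 2 := fun w hw => B.sum_sq_norm_inner_right ⟨w, hw⟩
  have rep : ∀ w ∈ W, ∑ i, inner ℂ (B i : H) w • (B i : H) = w := fun w hw => by
    have := congrArg Subtype.val (B.sum_repr' ⟨w, hw⟩)
    simpa using this
  have hB1 : ∀ i, ‖(B i : H)‖ = 1 := fun i => B.orthonormal.1 i
  have hl : ∀ i, l i = ∑ γ : Γ, ‖inner ℂ (B i : H) (ap (γ : UU H) u)‖ ^ 2 := fun i => by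
    have := TT_self Γ u (B i : H)
    rw [hB, inner_smul_right, inner_self_eq_norm_sq_to_K, hB1] at this
    simp only [RCLike.ofReal_one, one_pow, mul_one, Complex.ofReal_one, Complex.coe_algebraMap] at this
    exact_mod_cast this
  have hl0 : ∀ i, 0 ≤ l i := fun i => by rw [hl]; positivity
  have htr : ∑ i, l i = Fintype.card Γ * ‖u‖ ^ 2 := by
    rw [Finset.sum_congr rfl fun i _ => hl i, Finset.sum_comm, Finset.sum_congr rfl fun (γ : Γ) _ => par _ (hW γ)]
    simp [ap_norm]
  have hq : ∑ γ : Γ, ‖inner ℂ u (ap (γ : UU H) u)‖ ^ 2 = ∑ i, l i * ‖inner ℂ (B i : H) u‖ ^ 2 := by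
    have h1 := TT_self Γ u u
    have h2 : TT Γ u u = ∑ i, inner ℂ (B i : H) u • (l i : ℂ) • (B i : H) := by
      have h5 := congrArg (TT Γ u) (rep u huW)
      rw [← h5, map_sum]
      simp only [map_smul, hB]
    rw [h2, inner_sum] at h1
    have h3 : ∀ i, inner ℂ u (inner ℂ (B i : H) u • (l i : ℂ) • (B i : H)) = ((l i * ‖inner ℂ (B i : H) u‖ ^ 2 : ℝ) : ℂ) := by
      intro i
      rw [inner_smul_right, inner_smul_right, ← inner_conj_symm u]
      push_cast
      rw [← Complex.mul_conj']
      ring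
    rw [Finset.sum_congr rfl fun i _ => h3 i] at h1
    exact_mod_cast h1.symm
  have hu0 : 0 < ‖u‖ := norm_pos_iff.2 hu
  obtain ⟨i, hi⟩ : ∃ i, Fintype.card Γ * ‖u‖ ^ 2 < 2 * l i := by
    by_contra hc
    push Not at hc
    have : 2 * ∑ i, l i * ‖inner ℂ (B i : H) u‖ ^ 2 ≤ ∑ i, Fintype.card Γ * ‖u‖ ^ 2 * ‖inner ℂ (B i : H) u‖ ^ 2 := by
      rw [Finset.mul_sum]
      refine Finset.sum_le_sum fun i _ => ?_
      rw [← mul_assoc]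
      exact mul_le_mul_of_nonneg_right (hc i) (sq_nonneg _)
    rw [← Finset.mul_sum, par u huW, ← hq] at this
    nlinarith
  have huniq : ∀ j, j ≠ i → l j ≠ l i := by
    intro j hj e
    have : l j + l i ≤ ∑ i, l i := by
      rw [← Finset.sum_pair hj]
      exact Finset.sum_le_sum_of_subset_of_nonneg (Finset.subset_univ _) fun _ _ _ => hl0 _
    rw [htr] at this
    linarith
  refine ⟨B i, ?_, ?_⟩
  · intro e
    have := hB1 i
    rw [e, norm_zero] at this
    exact zero_ne_one this
  · intro g hg
    refine ⟨inner ℂ (B i : H) (ap g (B i)), ?_⟩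
    have h0 : ∀ j, j ≠ i → inner ℂ (B j : H) (ap g (B i)) = 0 := by
      intro j hj
      have := TT_symm Γ u (B j) (ap g (B i))
      rw [TT_comm Γ u hg, hB, hB, ap_smul, inner_smul_left, inner_smul_right, Complex.conj_ofReal, ← sub_eq_zero, ← sub_mul] at this
      rcases mul_eq_zero.1 this with h | h
      · exfalso
        apply huniq j hj
        exact_mod_cast sub_eq_zero.1 h
      · exact h
    conv_lhs => rw [← rep (ap g (B i)) (hgW g hg _ (B i).2)]
    rw [Finset.sum_eq_single i]
    · intro j _ hj
      rw [h0 j hj, zero_smul]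
    · intro h; exact absurd (Finset.mem_univ _) h
end top

lemma P_sub {M : Type*} [AddCommGroup M] [Fintype M] (V : Multiplicative M →* UU H) (χ : AddChar M ℂ) (v w : H) :
    P V χ (v - w) = P V χ v - P V χ w := by
  unfold P
  simp only [ap_sub, smul_sub, Finset.sum_sub_distrib]

lemma mu_total {M : Type*} [AddCommGroup M] [Fintype M] (V : Multiplicative M →* UU H) (w : H) :
    ∑ χ : AddChar M ℂ, ‖P V χ w‖ ^ 2 = ‖w‖ ^ 2 := by
  rw [← congrArg (fun x => ‖x‖ ^ 2) (P_sum V w)]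
  exact (mu_sum V w Finset.univ).symm

lemma disp_inner (g : UU H) (z : ℂ) (hz : ‖z‖ = 1) (u : H) :
    2 * ‖u‖ ^ 2 - 2 * ‖inner ℂ u (ap g u)‖ ≤ ‖z • ap g u - u‖ ^ 2 := by
  have h := norm_sub_sq (𝕜 := ℂ) (z • ap g u) u
  rw [norm_smul, hz, one_mul, ap_norm, inner_smul_left] at h
  have h2 : RCLike.re (conj z * inner ℂ (ap g u) u) ≤ ‖conj z * inner ℂ (ap g u) u‖ := RCLike.re_le_norm _
  rw [norm_mul, RCLike.norm_conj, hz, one_mul, norm_inner_symm] at h2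
  linarith

theorem almost_central (Γ : Subgroup (UU H)) [Fintype Γ] {M : Type*} [AddCommGroup M] [Fintype M]
    (V : Multiplicative M →* UU H) (hVc : ∀ γ ∈ Γ, ∀ m, γ * V m = V m * γ) (v : H) (hv : v ≠ 0)
    (h : ∀ γ : Γ, ∃ m : M, ‖ap ((γ : UU H) * V (Multiplicative.ofAdd m)) v - v‖ ^ 2 ≤ 5 / 12 * ‖v‖ ^ 2) :
    ∃ b : H, b ≠ 0 ∧ ∀ γ ∈ Γ, ∃ c : ℂ, ap γ b = c • b := by
  classical
  choose ζ hd using h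
  have hVP : ∀ m ψ w, P V ψ (ap (V (Multiplicative.ofAdd m)) w) = ap (V (Multiplicative.ofAdd m)) (P V ψ w) := by
    intro m ψ w
    refine P_intertwine V _ (AddEquiv.refl _) (fun m' => ?_) ψ w
    change V _ * V _ = V (Multiplicative.ofAdd m') * V _
    rw [← map_mul V, ← map_mul V, mul_comm]
  have hPc : ∀ (γ : Γ) ψ w, P V ψ (ap (γ : UU H) w) = ap (γ : UU H) (P V ψ w) := by
    intro γ ψ w
    exact P_intertwine V (γ : UU H) (AddEquiv.refl _) (fun m => hVc γ γ.2 _) ψ w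
  obtain ⟨ψ, hψ0, hψ⟩ : ∃ ψ : AddChar M ℂ, P V ψ v ≠ 0 ∧
      ∑ γ : Γ, ‖ap ((γ : UU H) * V (Multiplicative.ofAdd (ζ γ))) (P V ψ v) - P V ψ v‖ ^ 2 ≤ Fintype.card Γ * (5 / 12 * ‖P V ψ v‖ ^ 2) := by
    by_contra hc
    push Not at hc
    have t1 : ∑ ψ, ∑ γ : Γ, ‖ap ((γ : UU H) * V (Multiplicative.ofAdd (ζ γ))) (P V ψ v) - P V ψ v‖ ^ 2 ≤ Fintype.card Γ * (5 / 12 * ‖v‖ ^ 2) := by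
      rw [Finset.sum_comm]
      have e : ∀ γ : Γ, ∑ ψ, ‖ap ((γ : UU H) * V (Multiplicative.ofAdd (ζ γ))) (P V ψ v) - P V ψ v‖ ^ 2 = ‖ap ((γ : UU H) * V (Multiplicative.ofAdd (ζ γ))) v - v‖ ^ 2 := by
        intro γ
        rw [← mu_total V]
        refine Finset.sum_congr rfl fun ψ _ => ?_
        rw [P_sub, ap_mul, ap_mul, hPc, hVP]
      rw [Finset.sum_congr rfl fun γ _ => e γ]
      refine (Finset.sum_le_card_nsmul _ _ _ fun γ _ => hd γ).trans ?_
      rw [nsmul_eq_mul, Finset.card_univ]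
    have t2 : Fintype.card Γ * (5 / 12 * ‖v‖ ^ 2) = ∑ ψ, Fintype.card Γ * (5 / 12 * ‖P V ψ v‖ ^ 2) := by
      rw [← mu_total V v, Finset.mul_sum, Finset.mul_sum]
    rw [t2] at t1
    refine absurd t1 (not_le.2 (Finset.sum_lt_sum (fun ψ _ => ?_) ?_))
    · by_cases h0 : P V ψ v = 0
      · rw [h0]; simp only [ap_zero]; simp
      · exact (hc ψ h0).le
    · by_contra hn
      push Not at hn
      apply hv
      rw [← P_sum V v]
      refine Finset.sum_eq_zero fun ψ _ => ?_
      by_contra h0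
      exact absurd (hc ψ h0) (not_lt.2 (hn ψ (Finset.mem_univ _)))
  set u := P V ψ v with hu
  refine top_eig Γ u hψ0 ?_
  have hu0 : 0 < ‖u‖ := norm_pos_iff.2 hψ0
  have hcard : (0 : ℝ) < Fintype.card Γ := by exact_mod_cast Fintype.card_pos
  have s1 : ∀ γ : Γ, 2 * ‖u‖ ^ 2 - 2 * ‖inner ℂ u (ap (γ : UU H) u)‖ ≤ ‖ap ((γ : UU H) * V (Multiplicative.ofAdd (ζ γ))) u - u‖ ^ 2 := by
    intro γ
    have e : ap ((γ : UU H) * V (Multiplicative.ofAdd (ζ γ))) u = ψ (ζ γ) • ap (γ : UU H) u := by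
      rw [ap_mul, hu, V_P, ap_smul]
    rw [e]
    exact disp_inner _ _ (AddChar.norm_apply _ _) _
  have s2 := Finset.sum_le_sum fun (γ : Γ) (_ : γ ∈ Finset.univ) => s1 γ
  rw [Finset.sum_sub_distrib, Finset.sum_const, ← Finset.mul_sum, nsmul_eq_mul, Finset.card_univ] at s2
  have s3 := sq_sum_le_card_mul_sum_sq (s := (Finset.univ : Finset Γ)) (f := fun γ : Γ => ‖inner ℂ u (ap (γ : UU H) u)‖)
  rw [Finset.card_univ] at s3
  set S1 := ∑ γ : Γ, ‖inner ℂ u (ap (γ : UU H) u)‖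
  set S2 := ∑ γ : Γ, ‖inner ℂ u (ap (γ : UU H) u)‖ ^ 2
  set n : ℝ := (Fintype.card Γ : ℝ)
  have s4 : 19 / 24 * (n * ‖u‖ ^ 2) ≤ S1 := by linarith
  have s5 : (19 / 24 * (n * ‖u‖ ^ 2)) ^ 2 ≤ S1 ^ 2 := pow_le_pow_left₀ (by positivity) s4 2
  have s6 : n * (n * ‖u‖ ^ 4) < n * (2 * S2) := by
    have : 0 < (n * ‖u‖ ^ 2) ^ 2 := by positivity
    nlinarith
  exact lt_of_mul_lt_mul_left s6 hcard.le

theorem almost_central' (Γ : Subgroup (UU H)) [Fintype Γ] (v : H) (hv : v ≠ 0)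
    (h : ∀ γ : Γ, ∃ z : Γ, z ∈ Subgroup.center Γ ∧ ‖ap ((γ * z : Γ) : UU H) v - v‖ ^ 2 ≤ 5 / 12 * ‖v‖ ^ 2) :
    ∃ b : H, b ≠ 0 ∧ ∀ γ ∈ Γ, ∃ c : ℂ, ap γ b = c • b := by
  letI : CommGroup (Subgroup.center Γ) := { (inferInstance : Group (Subgroup.center Γ)) with
    mul_comm := fun a b => Subtype.ext (Subgroup.mem_center_iff.1 b.2 a) }
  have : Fintype (Additive (Subgroup.center Γ)) := Fintype.ofFinite _
  refine almost_central (M := Additive (Subgroup.center Γ)) Γ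
    { toFun := fun m => (((Additive.toMul (Multiplicative.toAdd m) : Subgroup.center Γ) : Γ) : UU H)
      map_one' := rfl
      map_mul' := fun _ _ => rfl } ?_ v hv ?_
  · intro γ hγ m
    have hz := Subgroup.mem_center_iff.1 (Additive.toMul (Multiplicative.toAdd m) : Subgroup.center Γ).2 ⟨γ, hγ⟩
    exact congrArg Subtype.val hz
  · intro γ
    obtain ⟨z, hz, h⟩ := h γ
    exact ⟨Additive.ofMul ⟨z, hz⟩, h⟩
end Fou

open Matrix
namespace Fou
variable {H : Type*} [NormedAddCommGroup H] [InnerProductSpace ℂ H] [CompleteSpace H]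

lemma num_bound (d k : ℕ) : 64 * (((d ^ 2 / 4 : ℕ) : ℝ) * (25 * 16 ^ k)) ≤
    5 / 12 * ((2 * (d : ℝ) ^ 2 + 18 * (k : ℝ) + 30) * 2 ^ (2 * k + 1)) ^ 2 := by
  have h1 : ((d ^ 2 / 4 : ℕ) : ℝ) ≤ (d : ℝ) ^ 2 / 4 := by
    have := Nat.cast_div_le (α := ℝ) (m := d ^ 2) (n := 4)
    push_cast at this; exact this
  have h2 : ((2 : ℝ) ^ (2 * k + 1)) ^ 2 = 4 * 16 ^ k := by
    rw [← pow_mul, show (2 * k + 1) * 2 = 2 + 4 * k by ring, pow_add, pow_mul]; norm_num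
  have h3 : (2 * (d : ℝ) ^ 2 + 30) ^ 2 ≤ (2 * (d : ℝ) ^ 2 + 18 * (k : ℝ) + 30) ^ 2 := by
    refine pow_le_pow_left₀ (by positivity) ?_ 2
    have : (0 : ℝ) ≤ k := Nat.cast_nonneg k
    linarith
  have h4 : 64 * ((d : ℝ) ^ 2 / 4) * 25 ≤ 5 / 12 * (2 * (d : ℝ) ^ 2 + 30) ^ 2 * 4 := by
    nlinarith [sq_nonneg ((d : ℝ) ^ 2 - 15)]
  have h5 : (0 : ℝ) < 16 ^ k := by positivity
  rw [mul_pow, h2]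
  have h6 : 64 * ((d ^ 2 / 4 : ℕ) : ℝ) * 25 ≤ 5 / 12 * (2 * (d : ℝ) ^ 2 + 18 * (k : ℝ) + 30) ^ 2 * 4 := by linarith
  have := mul_le_mul_of_nonneg_right h6 h5.le
  linarith

lemma scalar_comm {x y z : UU H} (h : x * y = z * y * x) {b : H} (hb : b ≠ 0) {c c' : ℂ}
    (hx : ap x b = c • b) (hy : ap y b = c' • b) : ap z b = b := by
  have h1 : ap (x * y) b = ap (z * y * x) b := by rw [h]
  rw [ap_mul, ap_mul, ap_mul, hx, hy, ap_smul, ap_smul, ap_smul, hx, hy, ap_smul, smul_comm] at h1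
  have n0 : ∀ (g : UU H) (a : ℂ), ap g b = a • b → a ≠ 0 := by
    rintro g a hg rfl
    have := ap_norm g b
    rw [hg, zero_smul, norm_zero] at this
    exact hb (norm_eq_zero.1 this.symm)
  have := smul_right_injective H (n0 _ _ hx) h1
  exact (smul_right_injective H (n0 _ _ hy) this).symm

theorem main {d k : ℕ} (hd : 3 ≤ d) (ρ : SLd d (MvPolynomial (Fin k) ℤ) →* UU H) (hρ : Finite ρ.range) (v : H) (hv : v ≠ 0)
    (hS : ∀ s ∈ genSet d k, ‖ap (ρ s) v - v‖ ≤ ((2 * (d : ℝ) ^ 2 + 18 * (k : ℝ) + 30) * 2 ^ (2 * k + 1))⁻¹ * ‖v‖) :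
    ∃ w : H, w ≠ 0 ∧ ∀ g, ap (ρ g) w = w := by
  set L : ℝ := (2 * (d : ℝ) ^ 2 + 18 * (k : ℝ) + 30) * 2 ^ (2 * k + 1) with hL
  have hL0 : 0 < L := by positivity
  have hv0 : 0 < ‖v‖ := norm_pos_iff.2 hv
  let c : ℝ := L / ‖v‖
  have hc0 : 0 < c := by positivity
  let v' : H := (c : ℂ) • v
  have hnc : ‖(c : ℂ)‖ = c := by rw [Complex.norm_real, Real.norm_of_nonneg hc0.le]
  have hv' : ‖v'‖ = L := by
    rw [norm_smul, hnc]; exact div_mul_cancel₀ _ hv0.ne'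
  have hv'0 : v' ≠ 0 := fun e => by rw [e, norm_zero] at hv'; exact hL0.ne hv'
  have hS' : ∀ s ∈ genSet d k, ‖ap (ρ s) v' - v'‖ ≤ 1 := by
    intro s hs
    rw [ap_smul, ← smul_sub, norm_smul, hnc]
    calc c * ‖ap (ρ s) v - v‖ ≤ c * (L⁻¹ * ‖v‖) := mul_le_mul_of_nonneg_left (hS s hs) hc0.le
      _ = 1 := by simp only [c]; field_simp
  have := Fintype.ofFinite ρ.range
  obtain ⟨b, hb, hbc⟩ := almost_central' ρ.range v' hv'0 (by
    rintro ⟨_, g, rfl⟩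
    obtain ⟨z, hz, hzd⟩ := near_central hd ρ hρ v' hS' g
    refine ⟨⟨ρ z, z, rfl⟩, ?_, ?_⟩
    · rw [Subgroup.mem_center_iff]
      rintro ⟨_, x, rfl⟩
      exact Subtype.ext (hz x).symm
    · rw [hv']
      exact hzd.trans (num_bound d k))
  refine ⟨b, hb, ?_⟩
  have hsc : ∀ g, ∃ c : ℂ, ap (ρ g) b = c • b := fun g => hbc _ ⟨g, rfl⟩
  have key : EE d (MvPolynomial (Fin k) ℤ) ≤ stab ρ b := by
    refine (Subgroup.closure_le _).2 ?_
    rintro _ ⟨i, j, h, r, rfl⟩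
    change ap (ρ (elem i j h r)) b = b
    obtain ⟨l, h1, h2⟩ := exists_third hd i j
    have e := congrArg ρ (elem_comm i l j h1.symm h2 h r 1)
    rw [map_mul, map_mul, map_mul, mul_one] at e
    obtain ⟨c1, e1⟩ := hsc (elem i l h1.symm r)
    obtain ⟨c2, e2⟩ := hsc (elem l j h2 1)
    exact scalar_comm e hb e1 e2
  exact fun g => key (Lau.EE_top hd k g)
end Fou

/-- Property (τ) for the universal lattices with an explicit τ-constant: for `d ≥ 3`,
`G = SL_d(ℤ[x₁,…,x_k])`, `S` the standard generating set and
`ε = 1/((2d² + 18k + 30)·2^(2k+1))`, every unitary representation of `G` whose kernel has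
finite index and which has a nonzero `(S,ε)`-almost-invariant vector has a nonzero
invariant vector. -/
theorem universal_lattice_tau (d k : ℕ) (hd : 3 ≤ d)
    (H : Type*) [NormedAddCommGroup H] [InnerProductSpace ℂ H] [CompleteSpace H]
    (ρ : Matrix.SpecialLinearGroup (Fin d) (MvPolynomial (Fin k) ℤ) →*
      unitary (H →L[ℂ] H))
    (hker : ρ.ker.FiniteIndex)
    (v : H) (hv : v ≠ 0)
    (halmost : ∀ s ∈ genSet d k,
      ‖(ρ s : H →L[ℂ] H) v - v‖ <
        ((2 * (d : ℝ) ^ 2 + 18 * (k : ℝ) + 30) * 2 ^ (2 * k + 1))⁻¹ * ‖v‖) :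
    ∃ w : H, w ≠ 0 ∧ ∀ g, (ρ g : H →L[ℂ] H) w = w := by
  have hρ : Finite ρ.range :=
    Finite.of_equiv _ (QuotientGroup.quotientKerEquivRange ρ).toEquiv
  exact Fou.main hd ρ hρ v hv (fun s hs => (halmost s hs).le)
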